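/- Fix integers p and q with 1 ≤ p ≤ q, p + q ≥ 3, and p odd. Let n = p + q and let B be a symmetric n×n integer matrix with det B = ±1 whose real extension has signature (p,q), i.e. there exists an invertible real n×n matrix S with Sᵀ B S equal to the diagonal matrix with p entries +1 followed by q entries −1. Let SO(Λ) denote the group of integer n×n matrices g with gᵀ B g = B and det g = 1. Then for every natural number N ≥ 1 there exists a finite-index subgroup Γ ≤ SO(Λ) such that the group cohomology H^p(Γ;ℚ) (with trivial ℚ-coefficients) has ℚ-dimension at least N. -/

import Mathlib

open Matrix

/-- The group `SO(Λ)` of integral matrices `g` with `gᵀ B g = B` and `det g = 1`, realized as a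
subgroup of `GL_n(ℤ)`. -/
def SOLam (n : ℕ) (B : Matrix (Fin n) (Fin n) ℤ) :
    Subgroup (Matrix.GeneralLinearGroup (Fin n) ℤ) where
  carrier := {g | (g : Matrix (Fin n) (Fin n) ℤ)ᵀ * B * (g : Matrix (Fin n) (Fin n) ℤ) = B ∧
    (g : Matrix (Fin n) (Fin n) ℤ).det = 1}
  one_mem' := by
    constructor
    · simp
    · simp
  mul_mem' := by
    rintro a b ⟨ha, hda⟩ ⟨hb, hdb⟩
    constructor
    · have hab : ((a * b : Matrix.GeneralLinearGroup (Fin n) ℤ) : Matrix (Fin n) (Fin n) ℤ)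
        = (a : Matrix (Fin n) (Fin n) ℤ) * (b : Matrix (Fin n) (Fin n) ℤ) := rfl
      rw [hab, Matrix.transpose_mul]
      calc (b : Matrix (Fin n) (Fin n) ℤ)ᵀ * (a : Matrix (Fin n) (Fin n) ℤ)ᵀ * B *
            ((a : Matrix (Fin n) (Fin n) ℤ) * (b : Matrix (Fin n) (Fin n) ℤ))
          = (b : Matrix (Fin n) (Fin n) ℤ)ᵀ *
              ((a : Matrix (Fin n) (Fin n) ℤ)ᵀ * B * (a : Matrix (Fin n) (Fin n) ℤ)) *
              (b : Matrix (Fin n) (Fin n) ℤ) := by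
            simp only [mul_assoc]
        _ = B := by rw [ha]; exact hb
    · have hab : ((a * b : Matrix.GeneralLinearGroup (Fin n) ℤ) : Matrix (Fin n) (Fin n) ℤ)
        = (a : Matrix (Fin n) (Fin n) ℤ) * (b : Matrix (Fin n) (Fin n) ℤ) := rfl
      rw [hab, Matrix.det_mul, hda, hdb, one_mul]
  inv_mem' := by
    rintro g ⟨hg, hdg⟩
    have h1 : (g : Matrix (Fin n) (Fin n) ℤ) * ((g⁻¹ : Matrix.GeneralLinearGroup (Fin n) ℤ) :
        Matrix (Fin n) (Fin n) ℤ) = 1 := g.mul_inv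
    constructor
    · conv_lhs => rw [← hg]
      calc ((g⁻¹ : Matrix.GeneralLinearGroup (Fin n) ℤ) : Matrix (Fin n) (Fin n) ℤ)ᵀ *
            ((g : Matrix (Fin n) (Fin n) ℤ)ᵀ * B * (g : Matrix (Fin n) (Fin n) ℤ)) *
            ((g⁻¹ : Matrix.GeneralLinearGroup (Fin n) ℤ) : Matrix (Fin n) (Fin n) ℤ)
          = ((g : Matrix (Fin n) (Fin n) ℤ) *
              ((g⁻¹ : Matrix.GeneralLinearGroup (Fin n) ℤ) : Matrix (Fin n) (Fin n) ℤ))ᵀ * B *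
              ((g : Matrix (Fin n) (Fin n) ℤ) *
              ((g⁻¹ : Matrix.GeneralLinearGroup (Fin n) ℤ) : Matrix (Fin n) (Fin n) ℤ)) := by
            rw [Matrix.transpose_mul]; simp only [mul_assoc]
        _ = B := by rw [h1]; simp
    · have h2 : ((g : Matrix (Fin n) (Fin n) ℤ) *
          ((g⁻¹ : Matrix.GeneralLinearGroup (Fin n) ℤ) : Matrix (Fin n) (Fin n) ℤ)).det = 1 := by
        rw [h1, Matrix.det_one]
      rw [Matrix.det_mul, hdg, one_mul] at h2
      exact h2

namespace OrderedChain

/-- Ordered simplicial chains: formal integer combinations of finite vertex lists.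
The empty list is the augmentation simplex. -/
abbrev Ch (V : Type*) := List V →₀ ℤ

variable {V W : Type*}

/-- Joining a vertex in front of every simplex. -/
noncomputable def cone (e : V) : Ch V →ₗ[ℤ] Ch V := Finsupp.lmapDomain ℤ ℤ (List.cons e)

@[simp] theorem cone_single (e : V) (l : List V) (a : ℤ) :
    cone e (Finsupp.single l a) = Finsupp.single (e :: l) a := by
  simp [cone]

/-- The boundary of one ordered simplex. -/
noncomputable def bdList : List V → Ch V
  | [] => 0
  | x :: l => Finsupp.single l 1 - cone x (bdList l)

/-- The boundary operator of the augmented ordered chain complex. -/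
noncomputable def bd : Ch V →ₗ[ℤ] Ch V := Finsupp.linearCombination ℤ bdList

@[simp] theorem bd_single (l : List V) (a : ℤ) : bd (Finsupp.single l a) = a • bdList l := by
  simp [bd]

theorem bd_cone (e : V) (c : Ch V) : bd (cone e c) = c - cone e (bd c) := by
  induction c using Finsupp.induction_linear with
  | zero => simp
  | add f g hf hg => simp only [map_add, hf, hg]; abel
  | single l a =>
    simp only [cone_single, bd_single, bdList, smul_sub, map_smul]
    simp

theorem bd_bd (c : Ch V) : bd (bd c) = 0 := by
  have key : ∀ l : List V, bd (bdList l) = 0 := by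
    intro l
    induction l with
    | nil => simp [bdList]
    | cons x l ih => simp [bdList, bd_cone, ih]
  induction c using Finsupp.induction_linear with
  | zero => simp
  | add f g hf hg => simp only [map_add, hf, hg, add_zero]
  | single l a => simp [key]

/-- The chain map induced by a map of vertices. -/
noncomputable def cmap (f : V → W) : Ch V →ₗ[ℤ] Ch W := Finsupp.lmapDomain ℤ ℤ (List.map f)

@[simp] theorem cmap_single (f : V → W) (l : List V) (a : ℤ) :
    cmap f (Finsupp.single l a) = Finsupp.single (l.map f) a := by
  simp [cmap]

theorem cmap_cone (f : V → W) (e : V) (c : Ch V) : cmap f (cone e c) = cone (f e) (cmap f c) := by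
  induction c using Finsupp.induction_linear with
  | zero => simp
  | add f g hf hg => simp only [map_add, hf, hg]
  | single l a => simp

theorem bd_cmap (f : V → W) (c : Ch V) : bd (cmap f c) = cmap f (bd c) := by
  have key : ∀ l : List V, bdList (l.map f) = cmap f (bdList l) := by
    intro l
    induction l with
    | nil => simp [bdList]
    | cons x l ih => simp [bdList, cmap_cone, ih]
  induction c using Finsupp.induction_linear with
  | zero => simp
  | add f g hf hg => simp only [map_add, hf, hg]
  | single l a => simp [key]

theorem cmap_cmap {X : Type*} (g : W → X) (f : V → W) (c : Ch V) :
    cmap g (cmap f c) = cmap (g ∘ f) c := by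
  induction c using Finsupp.induction_linear with
  | zero => simp
  | add f g hf hg => simp only [map_add, hf, hg]
  | single l a => simp

theorem cmap_id (c : Ch V) : cmap id c = c := by
  induction c using Finsupp.induction_linear with
  | zero => simp
  | add f g hf hg => simp only [map_add, hf, hg]
  | single l a => simp

/-- The prism over one ordered simplex, interpolating between the vertex maps `f` and `g`. -/
noncomputable def prismList (f g : V → W) : List V → Ch W
  | [] => 0
  | x :: l => Finsupp.single (f x :: g x :: l.map g) 1 - cone (f x) (prismList f g l)

/-- The prism operator, a chain homotopy between the chain maps of two vertex maps. -/
noncomputable def prism (f g : V → W) : Ch V →ₗ[ℤ] Ch W := Finsupp.linearCombination ℤ (prismList f g)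

@[simp] theorem prism_single (f g : V → W) (l : List V) (a : ℤ) :
    prism f g (Finsupp.single l a) = a • prismList f g l := by
  simp [prism]

theorem prism_cone (f g : V → W) (e : V) (c : Ch V) :
    prism f g (cone e c) = cone (f e) (cone (g e) (cmap g c)) - cone (f e) (prism f g c) := by
  induction c using Finsupp.induction_linear with
  | zero => simp
  | add f g hf hg => simp only [map_add, hf, hg]; abel
  | single l a =>
    simp only [cone_single, prism_single, prismList, smul_sub, map_smul, cmap_single]
    simp

theorem bd_prism (f g : V → W) (c : Ch V) :
    bd (prism f g c) = cmap g c - cmap f c - prism f g (bd c) := by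
  have key : ∀ l : List V, bd (prismList f g l) =
      Finsupp.single (l.map g) 1 - Finsupp.single (l.map f) 1 - prism f g (bdList l) := by
    intro l
    induction l with
    | nil => simp [bdList, prismList]
    | cons x l ih =>
      have hg : bdList (l.map g) = cmap g (bdList l) := by
        simpa using bd_cmap g (Finsupp.single l 1)
      simp only [prismList, map_sub, bd_single, bdList, bd_cone, ih, prism_cone, one_smul,
        List.map_cons, prism_single, cone_single, hg]
      abel
  induction c using Finsupp.induction_linear with
  | zero => simp
  | add f g hf hg => simp only [map_add, hf, hg]; abel
  | single l a =>
    simp only [prism_single, map_smul, key, cmap_single, bd_single, smul_sub]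
    simp

/-- Chains with `r` vertices whose simplices satisfy `K`. -/
noncomputable def Cn (K : Set V → Prop) (r : ℕ) : Submodule ℤ (Ch V) :=
  Finsupp.supported ℤ ℤ {l | l.length = r ∧ K {x | x ∈ l}}

theorem single_mem_Cn {K : Set V → Prop} {l : List V} (hl : K {x | x ∈ l}) (a : ℤ) :
    Finsupp.single l a ∈ Cn K l.length :=
  Finsupp.single_mem_supported ℤ a ⟨rfl, hl⟩

theorem single_mem_Cn' {K : Set V → Prop} {l : List V} {r : ℕ} (hr : l.length = r)
    (hl : K {x | x ∈ l}) (a : ℤ) : Finsupp.single l a ∈ Cn K r := by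
  subst hr; exact single_mem_Cn hl a

theorem mem_Cn_iff {K : Set V → Prop} {r : ℕ} {z : Ch V} :
    z ∈ Cn K r ↔ ∀ l ∈ z.support, l.length = r ∧ K {x | x ∈ l} := by
  rw [Cn, Finsupp.mem_supported]; rfl

/-- To check that a linear map sends `Cn K r` into a submodule, it suffices to check simplices. -/
theorem map_mem_of_single {M : Type*} [AddCommGroup M] (φ : Ch V →ₗ[ℤ] M)
    {N : Submodule ℤ M} {z : Ch V} (h : ∀ l ∈ z.support, φ (Finsupp.single l 1) ∈ N) :
    φ z ∈ N := by
  rw [← Finsupp.sum_single z, Finsupp.sum, map_sum]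
  refine N.sum_mem fun l hl => ?_
  rw [← mul_one (z l), ← smul_eq_mul, ← Finsupp.smul_single, map_smul]
  exact N.smul_mem _ (h l hl)

theorem eq_of_single {M : Type*} [AddCommGroup M] (φ ψ : Ch V →ₗ[ℤ] M)
    {z : Ch V} (h : ∀ l ∈ z.support, φ (Finsupp.single l 1) = ψ (Finsupp.single l 1)) :
    φ z = ψ z := by
  have := map_mem_of_single (φ - ψ) (N := ⊥) (z := z) (fun l hl => by simp [h l hl])
  simpa [sub_eq_zero] using this

theorem cone_mem {K K' : Set V → Prop} {e : V} {r : ℕ} {z : Ch V} (hz : z ∈ Cn K r)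
    (h : ∀ S, K S → K' (insert e S)) : cone e z ∈ Cn K' (r + 1) := by
  rw [mem_Cn_iff] at hz
  refine map_mem_of_single _ fun l hl => ?_
  rw [cone_single]
  refine single_mem_Cn' (by simp [(hz l hl).1]) ?_ _
  convert h _ (hz l hl).2 using 1
  ext x; simp

/-- A family of simplices closed under passing to faces. -/
noncomputable def DownClosed (K : Set V → Prop) : Prop := ∀ ⦃S T : Set V⦄, S ⊆ T → K T → K S

theorem bdList_mem {K : Set V → Prop} (hK : DownClosed K) :
    ∀ {l : List V} {r : ℕ}, l.length = r + 1 → K {x | x ∈ l} → bdList l ∈ Cn K r := by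
  intro l
  induction l generalizing K with
  | nil => intro r h; simp at h
  | cons x l ih =>
    intro r hr hl
    have hr' : l.length = r := by simpa using hr
    refine Submodule.sub_mem _ (single_mem_Cn' hr' (hK (by intro y; simp; tauto) hl) 1) ?_
    cases r with
    | zero =>
      have : l = [] := List.length_eq_zero_iff.mp hr'
      subst this; simp [bdList]
    | succ r =>
      refine cone_mem (K := fun S => K (insert x S)) (ih ?_ hr' ?_) (fun S hS => hS)
      · intro S T hST hT
        exact hK (Set.insert_subset_insert hST) hT
      · refine hK ?_ hl
        intro y; simp

theorem bd_mem {K : Set V → Prop} (hK : DownClosed K) {r : ℕ} {z : Ch V}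
    (hz : z ∈ Cn K (r + 1)) : bd z ∈ Cn K r := by
  rw [mem_Cn_iff] at hz
  refine map_mem_of_single _ fun l hl => ?_
  simpa using bdList_mem hK (hz l hl).1 (hz l hl).2

theorem setOf_mem_map (f : V → W) (l : List V) : {x | x ∈ l.map f} = f '' {x | x ∈ l} := by
  ext x; simp

theorem cmap_mem_of_support {K' : Set W → Prop} {f : V → W} {r : ℕ} {z : Ch V}
    (h : ∀ l ∈ z.support, l.length = r ∧ K' (f '' {x | x ∈ l})) : cmap f z ∈ Cn K' r := by
  refine map_mem_of_single _ fun l hl => ?_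
  rw [cmap_single]
  exact single_mem_Cn' (by simp [(h l hl).1]) (by rw [setOf_mem_map]; exact (h l hl).2) _

theorem cmap_mem {K : Set V → Prop} {K' : Set W → Prop} {f : V → W} {r : ℕ} {z : Ch V}
    (hz : z ∈ Cn K r) (h : ∀ S, K S → K' (f '' S)) : cmap f z ∈ Cn K' r := by
  rw [mem_Cn_iff] at hz
  exact cmap_mem_of_support fun l hl => ⟨(hz l hl).1, h _ (hz l hl).2⟩

theorem mono_mem {K K' : Set V → Prop} {r : ℕ} {z : Ch V}
    (hz : z ∈ Cn K r) (h : ∀ S, K S → K' S) : z ∈ Cn K' r := by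
  rw [mem_Cn_iff] at hz ⊢
  exact fun l hl => ⟨(hz l hl).1, h _ (hz l hl).2⟩

theorem prismList_mem {K' : Set W → Prop} (hK : DownClosed K') {f g : V → W} :
    ∀ {l : List V} {r : ℕ}, l.length = r → K' (f '' {x | x ∈ l} ∪ g '' {x | x ∈ l}) →
      prismList f g l ∈ Cn K' (r + 1) := by
  intro l
  induction l generalizing K' with
  | nil => intro r _ _; simp [prismList]
  | cons x l ih =>
    intro r hr hl
    refine Submodule.sub_mem _ (single_mem_Cn' (by simp [← hr]) (hK ?_ hl) 1) ?_
    · intro y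
      simp only [List.mem_cons, List.mem_map, Set.mem_ofPred_eq, Set.mem_union, Set.mem_image]
      rintro (h | h | ⟨a, ha, h⟩)
      · exact Or.inl ⟨x, by simp, h.symm⟩
      · exact Or.inr ⟨x, by simp, h.symm⟩
      · exact Or.inr ⟨a, by simp [ha], h⟩
    · obtain ⟨r, rfl⟩ : ∃ k, r = k + 1 := ⟨l.length, by simpa using hr.symm⟩
      refine cone_mem (K := fun S => K' (insert (f x) S)) (ih ?_ (by simpa using hr) ?_)
        (fun S hS => hS)
      · intro S T hST hT
        exact hK (Set.insert_subset_insert hST) hT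
      · refine hK ?_ hl
        rintro y (rfl | ⟨a, ha, rfl⟩ | ⟨a, ha, rfl⟩)
        · exact Or.inl ⟨x, by simp, rfl⟩
        · exact Or.inl ⟨a, by simp at ha; simp [ha], rfl⟩
        · exact Or.inr ⟨a, by simp at ha; simp [ha], rfl⟩

theorem prism_mem_of_support {K' : Set W → Prop} (hK : DownClosed K') {f g : V → W} {r : ℕ}
    {z : Ch V} (h : ∀ l ∈ z.support, l.length = r ∧ K' (f '' {x | x ∈ l} ∪ g '' {x | x ∈ l})) :
    prism f g z ∈ Cn K' (r + 1) := by
  refine map_mem_of_single _ fun l hl => ?_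
  simpa using prismList_mem hK (h l hl).1 (h l hl).2

/-- The augmented complex of `K` has at most the homology of a `(d-1)`-sphere in degrees
`≥ d - 1`: vanishing above, cyclic in the bottom degree. Degrees count vertices. -/
structure SphereLike (K : Set V → Prop) (d : ℕ) : Prop where
  above : ∀ r, d < r → ∀ z ∈ Cn K r, bd z = 0 → ∃ y ∈ Cn K (r + 1), bd y = z
  cyclic : ∃ z₀ ∈ Cn K d, bd z₀ = 0 ∧ ∀ z ∈ Cn K d, bd z = 0 →
    ∃ a : ℤ, ∃ y ∈ Cn K (d + 1), z = a • z₀ + bd y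

theorem exists_add_of_or {K A B : Set V → Prop} (h : ∀ S, K S → A S ∨ B S) {r : ℕ} {z : Ch V}
    (hz : z ∈ Cn K r) : ∃ a ∈ Cn A r, ∃ b ∈ Cn B r, a + b = z := by
  classical
  rw [mem_Cn_iff] at hz
  refine ⟨z.filter fun l => A {x | x ∈ l}, ?_, z.filter fun l => ¬ A {x | x ∈ l}, ?_,
    Finsupp.filter_add_filter_not _ _⟩ <;> rw [mem_Cn_iff] <;> intro l hl <;>
    rw [Finsupp.support_filter, Finset.mem_filter] at hl
  · exact ⟨(hz l hl.1).1, hl.2⟩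
  · exact ⟨(hz l hl.1).1, (h _ (hz l hl.1).2).resolve_left hl.2⟩

theorem mem_inf {A B K : Set V → Prop} (h : ∀ S, A S → B S → K S) {r : ℕ} {z : Ch V}
    (hA : z ∈ Cn A r) (hB : z ∈ Cn B r) : z ∈ Cn K r := by
  rw [mem_Cn_iff] at *
  exact fun l hl => ⟨(hA l hl).1, h _ (hA l hl).2 (hB l hl).2⟩

/-- Suspension: a union of two cones (with apices `e` and `e'`) whose intersection is sphere-like
is sphere-like of one dimension more. -/
theorem SphereLike.suspension {K L : Set V → Prop} (hK : DownClosed K) {e e' : V} {d : ℕ}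
    (hL : SphereLike L d)
    (hor : ∀ S, K S → K (insert e S) ∨ K (insert e' S))
    (hand : ∀ S, K (insert e S) → K (insert e' S) → L S)
    (hLe : ∀ S, L S → K (insert e S)) (hLe' : ∀ S, L S → K (insert e' S)) :
    SphereLike K (d + 1) := by
  have hA : DownClosed fun S => K (insert e S) :=
    fun S T hST hT => hK (Set.insert_subset_insert hST) hT
  have hB : DownClosed fun S => K (insert e' S) :=
    fun S T hST hT => hK (Set.insert_subset_insert hST) hT
  have split : ∀ r, ∀ z ∈ Cn K (r + 1), bd z = 0 →
      ∃ a ∈ Cn (fun S => K (insert e S)) (r + 1), ∃ b ∈ Cn (fun S => K (insert e' S)) (r + 1),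
        a + b = z ∧ bd a ∈ Cn L r ∧ bd b = - bd a := by
    intro r z hz hz0
    obtain ⟨a, ha, b, hb, rfl⟩ := exists_add_of_or hor hz
    have hab : bd b = - bd a := by
      rw [map_add] at hz0
      rw [eq_neg_iff_add_eq_zero, add_comm, hz0]
    refine ⟨a, ha, b, hb, rfl, mem_inf hand (bd_mem hA ha) ?_, hab⟩
    have := bd_mem hB hb
    rw [hab] at this
    simpa using Submodule.neg_mem _ this
  refine ⟨?_, ?_⟩
  · intro r hr z hz hz0
    obtain ⟨r, rfl⟩ : ∃ k, r = k + 1 := ⟨r - 1, by omega⟩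
    obtain ⟨a, ha, b, hb, rfl, haL, hab⟩ := split r z hz hz0
    obtain ⟨γ, hγ, hγa⟩ := hL.above r (by omega) _ haL (bd_bd a)
    refine ⟨cone e (a - γ) + cone e' (b + γ), Submodule.add_mem _ ?_ ?_, ?_⟩
    · exact cone_mem (Submodule.sub_mem _ ha (mono_mem hγ hLe)) fun S hS => hS
    · exact cone_mem (Submodule.add_mem _ hb (mono_mem hγ hLe')) fun S hS => hS
    · simp [bd_cone, hγa, hab]
  · obtain ⟨z₀, hz₀, hz₀0, hgen⟩ := hL.cyclic
    have m1 : cone e z₀ ∈ Cn (fun S => K (insert e S)) (d + 1) :=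
      cone_mem hz₀ fun S hS => by simpa using hLe S hS
    have m2 : cone e' z₀ ∈ Cn (fun S => K (insert e' S)) (d + 1) :=
      cone_mem hz₀ fun S hS => by simpa using hLe' S hS
    refine ⟨cone e z₀ - cone e' z₀, Submodule.sub_mem _ (cone_mem hz₀ hLe) (cone_mem hz₀ hLe'),
      by simp [bd_cone, hz₀0], ?_⟩
    intro z hz hz0
    obtain ⟨a, ha, b, hb, rfl, haL, hab⟩ := split d z hz hz0
    obtain ⟨m, γ, hγ, hγa⟩ := hgen _ haL (bd_bd a)
    refine ⟨m, cone e (a - γ - m • cone e z₀) + cone e' (b + γ + m • cone e' z₀),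
      Submodule.add_mem _ ?_ ?_, ?_⟩
    · exact cone_mem (Submodule.sub_mem _ (Submodule.sub_mem _ ha (mono_mem hγ hLe))
        (Submodule.smul_mem _ _ m1)) fun S hS => hS
    · exact cone_mem (Submodule.add_mem _ (Submodule.add_mem _ hb (mono_mem hγ hLe'))
        (Submodule.smul_mem _ _ m2)) fun S hS => hS
    · simp only [map_add, map_sub, bd_cone, hab, hγa, map_smul, hz₀0, map_zero, sub_zero,
        map_neg]
      module

end OrderedChain

namespace OrderedChain

variable {V : Type*} [AddCommGroup V] [Module ℝ V]

/-- Simplices whose convex hull misses the subspace `U`. -/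
def Misses (U : Submodule ℝ V) (S : Set V) : Prop := ∀ x ∈ convexHull ℝ S, x ∉ U

theorem Misses.downClosed (U : Submodule ℝ V) : DownClosed (Misses U) :=
  fun _ _ hST hT x hx => hT x (convexHull_mono hST hx)

theorem Misses.insert_iff {U : Submodule ℝ V} {e : V} (he : e ∉ U) {S : Set V} :
    Misses U (insert e S) ↔ ∀ x ∈ convexHull ℝ S, ∀ t : ℝ, 0 ≤ t → x + t • e ∉ U := by
  rcases S.eq_empty_or_nonempty with rfl | hS
  · simp [Misses, he]
  rw [Misses, convexHull_insert hS]
  constructor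
  · intro h x hx t ht hmem
    refine h ((1 + t)⁻¹ • (x + t • e)) ?_ (U.smul_mem _ hmem)
    rw [mem_convexJoin]
    refine ⟨e, rfl, x, hx, t / (1 + t), 1 / (1 + t), by positivity, by positivity, ?_, ?_⟩
    · field_simp; ring
    · rw [smul_add, smul_smul, add_comm]
      congr 2 <;> field_simp
  · intro h y hy hyU
    rw [mem_convexJoin] at hy
    obtain ⟨e', rfl, x, hx, a, b, ha, hb, hab, rfl⟩ := hy
    rcases hb.eq_or_lt with rfl | hb
    · have : a = 1 := by linarith
      subst this
      simp [he] at hyU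
    · refine h x hx (a / b) (by positivity) ?_
      have := U.smul_mem b⁻¹ hyU
      rw [smul_add, smul_smul, smul_smul, inv_mul_cancel₀ hb.ne', one_smul, add_comm] at this
      convert this using 3
      field_simp

theorem sphereLike_misses [FiniteDimensional ℝ V] (d : ℕ) (U : Submodule ℝ V)
    (h : Module.finrank ℝ U + d = Module.finrank ℝ V) : SphereLike (Misses U) d := by
  induction d generalizing U with
  | zero =>
    have hU : U = ⊤ := Submodule.eq_top_of_finrank_eq (by simpa using h)
    subst hU
    have hempty : ∀ l : List V, Misses ⊤ {x | x ∈ l} → l = [] := by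
      intro l hl
      rw [List.eq_nil_iff_forall_not_mem]
      intro x hx
      exact hl x (subset_convexHull ℝ _ hx) trivial
    refine ⟨?_, ?_⟩
    · intro r hr z hz _
      refine ⟨0, Submodule.zero_mem _, ?_⟩
      rw [map_zero, eq_comm, ← Finsupp.support_eq_empty, Finset.eq_empty_iff_forall_notMem]
      intro l hl
      have := mem_Cn_iff.mp hz l hl
      rw [hempty l this.2] at this
      simp at this
      omega
    · refine ⟨Finsupp.single [] 1, ?_, ?_, ?_⟩
      · refine single_mem_Cn' rfl ?_ 1
        intro x hx
        simp at hx
      · simp [bdList]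
      · intro z hz _
        refine ⟨z [], 0, Submodule.zero_mem _, ?_⟩
        ext l
        by_cases hl : l = []
        · simp [hl]
        · have : z l = 0 := by
            by_contra hne
            exact hl (hempty l (mem_Cn_iff.mp hz l (Finsupp.mem_support_iff.mpr hne)).2)
          simp [this, Ne.symm hl]
  | succ d ih =>
    obtain ⟨e, he⟩ : ∃ e, e ∉ U := by
      by_contra! hall
      have : U = ⊤ := by rw [eq_top_iff]; exact fun x _ => hall x
      rw [this, finrank_top] at h
      omega
    have hne : -e ∉ U := by simpa using he
    have hrank : Module.finrank ℝ ↥(U ⊔ ℝ ∙ e) = Module.finrank ℝ U + 1 :=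
      Submodule.finrank_sup_span_singleton he
    refine (ih (U ⊔ ℝ ∙ e) (by omega)).suspension (Misses.downClosed U) (e := -e) (e' := e) ?_ ?_ ?_ ?_
    · intro S hS
      rw [Misses.insert_iff he, Misses.insert_iff hne]
      by_contra! hcon
      obtain ⟨⟨x, hx, t, ht, hxt⟩, ⟨y, hy, u, hu, hyu⟩⟩ := hcon
      rcases ht.eq_or_lt with rfl | ht
      · exact hS x hx (by simpa using hxt)
      refine hS ((u + t)⁻¹ • (u • x + t • y)) ?_ ?_
      · have := (convex_convexHull ℝ S) hx hy (a := u / (u + t)) (b := t / (u + t))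
          (by positivity) (by positivity) (by field_simp)
        convert this using 1
        rw [smul_add, smul_smul, smul_smul]
        congr 2 <;> field_simp
      · refine U.smul_mem _ ?_
        have := U.add_mem (U.smul_mem u hxt) (U.smul_mem t hyu)
        convert this using 1
        module
    · intro S h1 h2 x hx hxU
      rw [Misses.insert_iff hne] at h1
      rw [Misses.insert_iff he] at h2
      obtain ⟨u, hu, w, hw, rfl⟩ := Submodule.mem_sup.mp hxU
      obtain ⟨c, rfl⟩ := Submodule.mem_span_singleton.mp hw
      rcases le_total 0 c with hc | hc
      · exact h1 _ hx c hc (by simpa using hu)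
      · exact h2 _ hx (-c) (by linarith) (by simpa using hu)
    · intro S hS
      rw [Misses.insert_iff hne]
      intro x hx t _ hmem
      refine hS x hx (Submodule.mem_sup.mpr ⟨_, hmem, t • e,
        Submodule.smul_mem _ _ (Submodule.mem_span_singleton_self e), by module⟩)
    · intro S hS
      rw [Misses.insert_iff he]
      intro x hx t _ hmem
      refine hS x hx (Submodule.mem_sup.mpr ⟨_, hmem, (-t) • e,
        Submodule.smul_mem _ _ (Submodule.mem_span_singleton_self e), by module⟩)

end OrderedChain

namespace OrderedChain

variable {n : ℕ}

/-- The diagonal quadratic form with coefficients `s`. -/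
def diagForm (s : Fin n → ℝ) (x : Fin n → ℝ) : ℝ := ∑ i, s i * x i ^ 2

/-- Simplices whose convex hull consists of negative vectors. -/
def Neg (s : Fin n → ℝ) (S : Set (Fin n → ℝ)) : Prop := ∀ x ∈ convexHull ℝ S, diagForm s x < 0

theorem Neg.downClosed (s : Fin n → ℝ) : DownClosed (Neg s) :=
  fun _ _ hST hT x hx => hT x (convexHull_mono hST hx)

theorem continuous_diagForm (s : Fin n → ℝ) : Continuous (diagForm s) := by
  unfold diagForm; fun_prop

theorem Neg.exists_thickening {s : Fin n → ℝ} {S : Set (Fin n → ℝ)} (hS : Neg s S)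
    (hfin : S.Finite) : ∃ ε > 0, ∀ S' ⊆ Metric.thickening ε S, Neg s S' := by
  obtain ⟨ε, hε, h⟩ := (hfin.isCompact_convexHull ℝ).exists_thickening_subset_open
    ((isOpen_Iio (a := (0 : ℝ))).preimage (continuous_diagForm s)) (fun x hx => hS x hx)
  refine ⟨ε, hε, fun S' hS' x hx => h ?_⟩
  have h1 : S' ⊆ Metric.thickening ε (convexHull ℝ S) :=
    hS'.trans (Metric.thickening_subset_of_subset ε (subset_convexHull ℝ S))
  exact convexHull_min h1 ((convex_convexHull ℝ S).thickening ε) hx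

/-- Scaling the positive coordinates by `c`. -/
noncomputable def scalePos (s : Fin n → ℝ) (c : ℝ) : (Fin n → ℝ) →ₗ[ℝ] (Fin n → ℝ) where
  toFun x i := if 0 < s i then c * x i else x i
  map_add' x y := by ext i; simp only [Pi.add_apply]; split_ifs <;> ring
  map_smul' a x := by ext i; simp only [Pi.smul_apply, smul_eq_mul, RingHom.id_apply]; split_ifs <;> ring

theorem scalePos_apply (s : Fin n → ℝ) (c : ℝ) (x : Fin n → ℝ) (i : Fin n) :
    scalePos s c x i = if 0 < s i then c * x i else x i := rfl

theorem scalePos_one (s : Fin n → ℝ) : ⇑(scalePos s 1) = id := by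
  ext x i; simp [scalePos_apply]

theorem diagForm_scalePos_le (s : Fin n → ℝ) {c : ℝ} (hc : c ∈ Set.Icc (0 : ℝ) 1) (x : Fin n → ℝ) :
    diagForm s (scalePos s c x) ≤ diagForm s x := by
  refine Finset.sum_le_sum fun i _ => ?_
  rw [scalePos_apply]
  split_ifs with h
  · refine mul_le_mul_of_nonneg_left ?_ h.le
    rw [mul_pow]
    have : c ^ 2 ≤ 1 := pow_le_one₀ hc.1 hc.2
    nlinarith [sq_nonneg (x i)]
  · exact le_rfl

theorem continuous_scalePos (s : Fin n → ℝ) (x : Fin n → ℝ) :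
    Continuous fun c => scalePos s c x := by
  refine continuous_pi fun i => ?_
  simp only [scalePos_apply]
  split_ifs <;> fun_prop

theorem Neg.image_scalePos {s : Fin n → ℝ} {c : ℝ} (hc : c ∈ Set.Icc (0 : ℝ) 1)
    {S : Set (Fin n → ℝ)} (hS : Neg s S) : Neg s (scalePos s c '' S) := by
  intro x hx
  rw [← (scalePos s c).image_convexHull] at hx
  obtain ⟨y, hy, rfl⟩ := hx
  exact (diagForm_scalePos_le s hc y).trans_lt (hS y hy)

/-- Cycles of negative simplices are homologous to their images under `scalePos`. -/
theorem exists_bd_scalePos {s : Fin n → ℝ} {r : ℕ} {z : Ch (Fin n → ℝ)} (hz : z ∈ Cn (Neg s) r)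
    (hz0 : bd z = 0) (c : ℝ) (hc : c ∈ Set.Icc (0 : ℝ) 1) :
    ∃ y ∈ Cn (Neg s) (r + 1), bd y = cmap (scalePos s c) z - z := by
  let R : Set.Icc (0 : ℝ) 1 → Set.Icc (0 : ℝ) 1 → Prop := fun a b =>
    ∃ y ∈ Cn (Neg s) (r + 1), bd y = cmap (scalePos s b) z - cmap (scalePos s a) z
  have hz' := mem_Cn_iff.mp hz
  have key : R ⟨1, by simp⟩ ⟨c, hc⟩ := by
    have hsymm : Std.Symm R := ⟨fun a b ⟨y, hy, h⟩ =>
      ⟨-y, Submodule.neg_mem _ hy, by rw [map_neg, h]; abel⟩⟩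
    have htrans : IsTrans _ R := ⟨fun a b d ⟨y, hy, h⟩ ⟨y', hy', h'⟩ =>
      ⟨y + y', Submodule.add_mem _ hy hy', by rw [map_add, h, h']; abel⟩⟩
    refine PreconnectedSpace.induction₂ R ?_ htrans _ _
    · intro a
      have hloc : ∀ l ∈ z.support, ∀ᶠ b : Set.Icc (0 : ℝ) 1 in nhds a, Neg s
          (scalePos s (a : ℝ) '' {x | x ∈ l} ∪ scalePos s (b : ℝ) '' {x | x ∈ l}) := by
        intro l hl
        have hfin : (scalePos s (a : ℝ) '' {x | x ∈ l}).Finite := (List.finite_toSet l).image _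
        obtain ⟨ε, hε, hthick⟩ := ((hz' l hl).2.image_scalePos a.2).exists_thickening hfin
        have hev : ∀ᶠ b : Set.Icc (0 : ℝ) 1 in nhds a, ∀ x ∈ {x | x ∈ l},
            dist (scalePos s (b : ℝ) x) (scalePos s (a : ℝ) x) < ε := by
          rw [Filter.eventually_all_finite (List.finite_toSet l)]
          intro x _
          have hcont : Continuous fun b : Set.Icc (0 : ℝ) 1 => scalePos s (b : ℝ) x :=
            (continuous_scalePos s x).comp continuous_subtype_val
          exact hcont.continuousAt (Metric.ball_mem_nhds _ hε)
        filter_upwards [hev] with b hb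
        refine hthick _ (Set.union_subset (Metric.self_subset_thickening hε _) ?_)
        rintro _ ⟨x, hx, rfl⟩
        rw [Metric.mem_thickening_iff]
        exact ⟨_, ⟨x, hx, rfl⟩, hb x hx⟩
      have hall := (Finset.eventually_all z.support).mpr hloc
      filter_upwards [hall] with b hb
      refine ⟨prism (scalePos s (a : ℝ)) (scalePos s (b : ℝ)) z,
        prism_mem_of_support (Neg.downClosed s) fun l hl => ⟨(hz' l hl).1, hb l hl⟩, ?_⟩
      rw [bd_prism, hz0, map_zero, sub_zero]
  obtain ⟨y, hy, h⟩ := key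
  refine ⟨y, hy, ?_⟩
  rw [h, scalePos_one, cmap_id]

/-- The subspace of vectors with vanishing negative coordinates. -/
def posSubspace (s : Fin n → ℝ) : Submodule ℝ (Fin n → ℝ) where
  carrier := {x | ∀ i, s i < 0 → x i = 0}
  add_mem' := by intro x y hx hy i hi; simp [hx i hi, hy i hi]
  zero_mem' := by intro i _; rfl
  smul_mem' := by intro a x hx i hi; simp [hx i hi]

theorem finrank_posSubspace (s : Fin n → ℝ) :
    Module.finrank ℝ (posSubspace s) + Fintype.card {i // s i < 0} = n := by
  classical
  let f : (Fin n → ℝ) →ₗ[ℝ] ({i // s i < 0} → ℝ) := LinearMap.funLeft ℝ ℝ Subtype.val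
  have hker : posSubspace s = LinearMap.ker f := by
    ext x
    simp only [LinearMap.mem_ker, funext_iff, f, LinearMap.funLeft_apply, Subtype.forall]
    rfl
  have hsurj : LinearMap.range f = ⊤ :=
    LinearMap.range_eq_top.mpr (LinearMap.funLeft_surjective_of_injective _ _ _ Subtype.val_injective)
  have := LinearMap.finrank_range_add_finrank_ker f
  rw [hsurj, finrank_top, ← hker] at this
  simp only [Module.finrank_fintype_fun_eq_card, Fintype.card_fin] at this
  omega

theorem Neg.misses {s : Fin n → ℝ} {S : Set (Fin n → ℝ)} (hS : Neg s S) :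
    Misses (posSubspace s) S := by
  intro x hx hxU
  refine (hS x hx).not_ge (Finset.sum_nonneg fun i _ => ?_)
  rcases lt_or_ge (s i) 0 with h | h
  · simp [hxU i h]
  · positivity

theorem Misses.neg_scalePos {s : Fin n → ℝ} {S : Set (Fin n → ℝ)}
    (hS : Misses (posSubspace s) S) : Neg s (scalePos s 0 '' S) := by
  intro x hx
  rw [← (scalePos s 0).image_convexHull] at hx
  obtain ⟨y, hy, rfl⟩ := hx
  obtain ⟨j, hj, hyj⟩ : ∃ j, s j < 0 ∧ y j ≠ 0 := by
    have := hS y hy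
    by_contra! hcon
    exact this hcon
  have hle : ∀ i ∈ Finset.univ, s i * (scalePos s 0 y i) ^ 2 ≤ 0 := by
    intro i _
    rw [scalePos_apply]
    split_ifs with h
    · simp
    · exact mul_nonpos_of_nonpos_of_nonneg (not_lt.mp h) (sq_nonneg _)
  refine Finset.sum_neg' hle ⟨j, Finset.mem_univ _, ?_⟩
  rw [scalePos_apply, if_neg hj.le.not_gt]
  exact mul_neg_of_neg_of_pos hj (by positivity)

theorem sphereLike_neg {s : Fin n → ℝ} {q : ℕ}
    (hq : Fintype.card {i // s i < 0} = q) : SphereLike (Neg s) q := by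
  have hM : SphereLike (Misses (posSubspace s)) q := by
    refine sphereLike_misses q _ ?_
    rw [← hq, finrank_posSubspace]; simp
  have h01 : (0 : ℝ) ∈ Set.Icc (0 : ℝ) 1 := by simp
  refine ⟨?_, ?_⟩
  · intro r hr z hz hz0
    obtain ⟨y, hy, hyz⟩ := hM.above r hr z (mono_mem hz fun _ h => h.misses) hz0
    obtain ⟨w, hw, hwz⟩ := exists_bd_scalePos hz hz0 0 h01
    refine ⟨cmap (scalePos s 0) y - w,
      Submodule.sub_mem _ (cmap_mem hy fun _ h => h.neg_scalePos) hw, ?_⟩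
    rw [map_sub, bd_cmap, hyz, hwz]; abel
  · obtain ⟨z₀, hz₀, hz₀0, hgen⟩ := hM.cyclic
    refine ⟨cmap (scalePos s 0) z₀, cmap_mem hz₀ fun _ h => h.neg_scalePos,
      by rw [bd_cmap, hz₀0, map_zero], ?_⟩
    intro z hz hz0
    obtain ⟨a, y, hy, hyz⟩ := hgen z (mono_mem hz fun _ h => h.misses) hz0
    obtain ⟨w, hw, hwz⟩ := exists_bd_scalePos hz hz0 0 h01
    refine ⟨a, cmap (scalePos s 0) y - w,
      Submodule.sub_mem _ (cmap_mem hy fun _ h => h.neg_scalePos) hw, ?_⟩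
    have h1 : cmap (scalePos s 0) z = a • cmap (scalePos s 0) z₀ + bd (cmap (scalePos s 0) y) := by
      rw [bd_cmap, ← map_smul, ← map_add, ← hyz]
    rw [map_sub, hwz, h1]
    abel

end OrderedChain

namespace OrderedChain

variable {n : ℕ}

/-- Simplices no face of which with fewer than `n` vertices spans a vector of `X`. -/
def Generic (X : Set (Fin n → ℝ)) (S : Set (Fin n → ℝ)) : Prop :=
  ∀ A : Finset (Fin n → ℝ), ↑A ⊆ S → A.card < n → ∀ w ∈ X, w ∉ Submodule.span ℝ (A : Set (Fin n → ℝ))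

/-- Negative simplices that are generic for `X`. -/
def NegGen (s : Fin n → ℝ) (X : Set (Fin n → ℝ)) (S : Set (Fin n → ℝ)) : Prop :=
  Neg s S ∧ Generic X S

theorem Generic.downClosed (X : Set (Fin n → ℝ)) : DownClosed (Generic X) :=
  fun _ _ hST hT A hA => hT A (hA.trans hST)

theorem NegGen.downClosed (s : Fin n → ℝ) (X : Set (Fin n → ℝ)) : DownClosed (NegGen s X) :=
  fun _ _ hST hT => ⟨Neg.downClosed s hST hT.1, Generic.downClosed X hST hT.2⟩

theorem generic_empty {X : Set (Fin n → ℝ)} (hX0 : (0 : Fin n → ℝ) ∉ X) : Generic X ∅ := by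
  intro A hA _ w hw hmem
  rw [Set.subset_empty_iff.mp hA, Submodule.span_empty, Submodule.mem_bot] at hmem
  exact hX0 (hmem ▸ hw)

theorem exists_mem_ball_avoiding {X : Set (Fin n → ℝ)} (hX : X.Countable) (T : Finset (Fin n → ℝ))
    (u : Fin n → ℝ) {ε : ℝ} (hε : 0 < ε) : ∃ v, dist v u < ε ∧ ∀ A ⊆ T, A.card + 1 < n → ∀ w ∈ X,
      v ∉ Submodule.span ℝ (insert w (A : Set (Fin n → ℝ))) := by
  classical
  by_contra! hcon
  have hsub : Metric.ball u ε ⊆ ⋃ A ∈ (T.powerset.filter fun A => A.card + 1 < n : Set (Finset (Fin n → ℝ))),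
      ⋃ w ∈ X, (Submodule.span ℝ (insert w (A : Set (Fin n → ℝ))) : Set (Fin n → ℝ)) := by
    intro v hv
    obtain ⟨A, hAT, hcard, w, hw, hmem⟩ := hcon v hv
    simp only [Set.mem_iUnion]
    exact ⟨A, by simp [hAT, hcard], w, hw, hmem⟩
  have hnull : MeasureTheory.volume (⋃ A ∈ (T.powerset.filter fun A => A.card + 1 < n : Set (Finset (Fin n → ℝ))),
      ⋃ w ∈ X, (Submodule.span ℝ (insert w (A : Set (Fin n → ℝ))) : Set (Fin n → ℝ))) = 0 := by
    rw [MeasureTheory.measure_biUnion_null_iff (Finset.countable_toSet _)]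
    intro A hA
    rw [MeasureTheory.measure_biUnion_null_iff hX]
    intro w _
    refine MeasureTheory.Measure.addHaar_submodule _ _ ?_
    intro htop
    have hcard : A.card + 1 < n := by simpa using (Finset.mem_filter.mp hA).2
    have h1 := finrank_span_finset_le_card (R := ℝ) (insert w A)
    rw [Finset.coe_insert, Set.finrank, htop, finrank_top, Module.finrank_fin_fun] at h1
    have h2 := Finset.card_insert_le w A
    omega
  exact (Metric.measure_ball_pos MeasureTheory.volume u hε).ne'
    (MeasureTheory.measure_mono_null hsub hnull)

theorem Generic.insert {X : Set (Fin n → ℝ)} {T : Set (Fin n → ℝ)} (hT : Generic X T)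
    {v : Fin n → ℝ} (hv : ∀ A : Finset (Fin n → ℝ), ↑A ⊆ T → A.card + 1 < n → ∀ w ∈ X,
      v ∉ Submodule.span ℝ (insert w (A : Set (Fin n → ℝ)))) : Generic X (insert v T) := by
  classical
  intro A hA hcard w hw hmem
  by_cases hvA : v ∈ A
  · have hsub : ((A.erase v : Finset _) : Set (Fin n → ℝ)) ⊆ T := by
      intro x hx
      simp only [Finset.coe_erase, Set.mem_sdiff, Finset.mem_coe, Set.mem_singleton_iff] at hx
      exact (hA hx.1).resolve_left hx.2
    have hc : (A.erase v).card + 1 < n := by rwa [Finset.card_erase_add_one hvA]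
    rw [← Finset.insert_erase hvA, Finset.coe_insert, Submodule.mem_span_insert] at hmem
    obtain ⟨c, y, hy, hwy⟩ := hmem
    by_cases hc0 : c = 0
    · subst hc0
      exact hT _ hsub (by omega) w hw (by rw [hwy]; simpa using hy)
    · refine hv _ hsub hc w hw ?_
      rw [Submodule.mem_span_insert]
      refine ⟨c⁻¹, -(c⁻¹ • y), Submodule.neg_mem _ (Submodule.smul_mem _ _ hy), ?_⟩
      rw [hwy, smul_add, smul_smul, inv_mul_cancel₀ hc0]
      module
  · refine hT A ?_ hcard w hw hmem
    intro x hx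
    refine (hA hx).resolve_left ?_
    rintro rfl
    exact hvA hx

/-- General position: the vertices in `U` can be moved slightly so that all simplices formed by
their new positions, possibly joined with a generic old simplex, are generic. -/
theorem exists_perturbation {X : Set (Fin n → ℝ)} (hX : X.Countable) (U : Finset (Fin n → ℝ))
    {ε : ℝ} (hε : 0 < ε) : ∃ ρ : (Fin n → ℝ) → (Fin n → ℝ), (∀ u ∈ U, dist (ρ u) u < ε) ∧
      ∀ S ⊆ (U : Set (Fin n → ℝ)), Generic X S → Generic X (S ∪ ρ '' U) := by
  classical
  suffices H : ∀ U' ⊆ U, ∃ ρ : (Fin n → ℝ) → (Fin n → ℝ), (∀ u ∈ U', dist (ρ u) u < ε) ∧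
      ∀ S ⊆ (U : Set (Fin n → ℝ)), Generic X S → Generic X (S ∪ ρ '' U') from H U subset_rfl
  intro U'
  induction U' using Finset.induction_on with
  | empty => intro _; exact ⟨id, by simp, fun S _ hS => by simpa using hS⟩
  | insert u U' hu ih =>
    intro hsub
    obtain ⟨ρ, hρ, hgen⟩ := ih ((Finset.subset_insert _ _).trans hsub)
    obtain ⟨v, hvu, hv⟩ := exists_mem_ball_avoiding hX (U ∪ U'.image ρ) u hε
    have heq : ∀ x ∈ U', Function.update ρ u v x = ρ x := by
      intro x hx
      rw [Function.update_of_ne]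
      rintro rfl
      exact hu hx
    refine ⟨Function.update ρ u v, ?_, ?_⟩
    · intro x hx
      rcases Finset.mem_insert.mp hx with rfl | hx
      · simpa using hvu
      · rw [heq x hx]; exact hρ x hx
    · intro S hSU hS
      have := (hgen S hSU hS).insert (v := v) fun A hA => hv A ?_
      · convert this using 1
        rw [Finset.coe_insert, Set.image_insert_eq, Function.update_self, Set.union_insert,
          Set.image_congr heq]
      · intro x hx
        rcases hA hx with h | ⟨y, hy, rfl⟩
        · exact Finset.mem_union_left _ (hSU h)
        · exact Finset.mem_union_right _ (Finset.mem_image_of_mem _ hy)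

theorem Neg.eventually_thickening {s : Fin n → ℝ} {S : Set (Fin n → ℝ)} (hS : Neg s S)
    (hfin : S.Finite) :
    ∀ᶠ ε in nhdsWithin (0 : ℝ) (Set.Ioi 0), ∀ S' ⊆ Metric.thickening ε S, Neg s S' := by
  obtain ⟨ε, hε, h⟩ := hS.exists_thickening hfin
  filter_upwards [Ioo_mem_nhdsGT hε] with ε' hε' S' hS'
  exact h S' (hS'.trans (Metric.thickening_mono hε'.2.le _))

/-- A generic negative cycle bounding a negative chain bounds a generic negative chain. -/
theorem exists_generic_bd {s : Fin n → ℝ} {X : Set (Fin n → ℝ)} (hX : X.Countable)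
    (hX0 : (0 : Fin n → ℝ) ∉ X) {r : ℕ} {z y : Ch (Fin n → ℝ)} (hz : z ∈ Cn (NegGen s X) r)
    (hy : y ∈ Cn (Neg s) (r + 1)) (hyz : bd y = z) :
    ∃ y' ∈ Cn (NegGen s X) (r + 1), bd y' = z := by
  classical
  have hz' := mem_Cn_iff.mp hz
  have hy' := mem_Cn_iff.mp hy
  let F := y.support ∪ z.support
  have hF : ∀ l ∈ F, Neg s {x | x ∈ l} := by
    intro l hl
    rcases Finset.mem_union.mp hl with h | h
    · exact (hy' l h).2
    · exact (hz' l h).2.1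
  obtain ⟨ε, hthick, hε⟩ := (((Finset.eventually_all F).mpr fun l hl =>
    (hF l hl).eventually_thickening (List.finite_toSet l)).and self_mem_nhdsWithin).exists
  obtain ⟨ρ, hρ, hgen⟩ := exists_perturbation hX (F.biUnion List.toFinset) hε
  have hU : ∀ l ∈ F, {x | x ∈ l} ⊆ ((F.biUnion List.toFinset : Finset _) : Set (Fin n → ℝ)) := by
    intro l hl x hx
    simp only [Finset.coe_biUnion, Set.mem_iUnion]
    exact ⟨l, hl, by simpa using hx⟩
  have hnear : ∀ l ∈ F, ρ '' {x | x ∈ l} ⊆ Metric.thickening ε {x | x ∈ l} := by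
    rintro l hl _ ⟨x, hx, rfl⟩
    rw [Metric.mem_thickening_iff]
    exact ⟨x, hx, hρ x (hU l hl hx)⟩
  refine ⟨cmap ρ y - prism id ρ z, Submodule.sub_mem _ ?_ ?_, ?_⟩
  · refine cmap_mem_of_support fun l hl => ⟨(hy' l hl).1, ?_, ?_⟩
    · exact hthick l (Finset.mem_union_left _ hl) _ (hnear l (Finset.mem_union_left _ hl))
    · refine Generic.downClosed X ?_ (hgen ∅ (Set.empty_subset _) (generic_empty hX0))
      rw [Set.empty_union]
      exact Set.image_mono (hU l (Finset.mem_union_left _ hl))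
  · refine prism_mem_of_support (NegGen.downClosed s X) fun l hl => ⟨(hz' l hl).1, ?_, ?_⟩
    · refine hthick l (Finset.mem_union_right _ hl) _ (Set.union_subset ?_
        (hnear l (Finset.mem_union_right _ hl)))
      rw [Set.image_id]
      exact Metric.self_subset_thickening hε _
    · rw [Set.image_id]
      refine Generic.downClosed X ?_ (hgen {x | x ∈ l} (hU l (Finset.mem_union_right _ hl))
        (hz' l hl).2.2)
      exact Set.union_subset_union_right _ (Set.image_mono (hU l (Finset.mem_union_right _ hl)))
  · rw [map_sub, bd_cmap, bd_prism, hyz, ← hyz, bd_bd, hyz, map_zero, cmap_id]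
    abel

end OrderedChain

namespace OrderedChain

variable {n : ℕ}

/-- `w` is a combination of the `x i` with positive coefficients. -/
def InOpenCone {ι : Type*} [Fintype ι] (x : ι → (Fin n → ℝ)) (w : Fin n → ℝ) : Prop :=
  ∃ c : ι → ℝ, (∀ i, 0 < c i) ∧ ∑ i, c i • x i = w

open Classical in
/-- The signed indicator of the open simplicial cone on `x`, evaluated at `w`. -/
noncomputable def coneIndex (w : Fin n → ℝ) (x : Fin n → (Fin n → ℝ)) : ℤ :=
  if InOpenCone x w then (SignType.sign (Matrix.of x).det : ℤ) else 0

/-- The coefficients of the linear relation among `n + 1` vectors given by Cramer's rule. -/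
noncomputable def cramerRel (x : Fin (n + 1) → (Fin n → ℝ)) (i : Fin (n + 1)) : ℝ :=
  (-1) ^ (i : ℕ) * (Matrix.of (x ∘ i.succAbove)).det

theorem sum_cramerRel (x : Fin (n + 1) → (Fin n → ℝ)) : ∑ i, cramerRel x i • x i = 0 := by
  ext j
  let A : Matrix (Fin (n + 1)) (Fin (n + 1)) ℝ :=
    Matrix.of fun i => (Fin.cons (x i j) (x i) : Fin (n + 1) → ℝ)
  have h0 : A.det = 0 := by
    refine Matrix.det_zero_of_column_eq (i := 0) (j := j.succ) (Fin.succ_ne_zero j).symm fun i => ?_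
    simp [A]
  rw [Matrix.det_succ_column_zero] at h0
  simp only [Finset.sum_apply, Pi.smul_apply, smul_eq_mul, Pi.zero_apply]
  rw [← h0]
  refine Finset.sum_congr rfl fun i _ => ?_
  have : A.submatrix i.succAbove Fin.succ = Matrix.of (x ∘ i.succAbove) := by
    ext a b; simp [A]
  rw [this, cramerRel]
  simp only [A, Matrix.of_apply, Fin.cons_zero]
  ring

theorem exists_eq_smul_cramerRel {x : Fin (n + 1) → (Fin n → ℝ)} {i : Fin (n + 1)}
    (hi : cramerRel x i ≠ 0) {c : Fin (n + 1) → ℝ} (hc : ∑ j, c j • x j = 0) :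
    ∃ t : ℝ, ∀ j, c j = t * cramerRel x j := by
  have hdet : IsUnit (Matrix.of (x ∘ i.succAbove)).det := by
    rw [isUnit_iff_ne_zero]
    intro h
    exact hi (by rw [cramerRel, h, mul_zero])
  have hli : LinearIndependent ℝ (x ∘ i.succAbove) :=
    Matrix.linearIndependent_rows_of_isUnit ((Matrix.isUnit_iff_isUnit_det _).mpr hdet)
  refine ⟨c i / cramerRel x i, ?_⟩
  have h1 : ∑ j, (c j - c i / cramerRel x i * cramerRel x j) • x j = 0 := by
    simp only [sub_smul, mul_smul, Finset.sum_sub_distrib, ← Finset.smul_sum, sum_cramerRel, hc]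
    simp
  rw [Fin.sum_univ_succAbove _ i] at h1
  have h2 : c i - c i / cramerRel x i * cramerRel x i = 0 := by field_simp; ring
  rw [h2, zero_smul, zero_add] at h1
  have h3 := Fintype.linearIndependent_iff.mp hli _ h1
  intro j
  by_cases hj : j = i
  · subst hj; field_simp
  · obtain ⟨k, rfl⟩ := Fin.exists_succAbove_eq hj
    linarith [h3 k]

/-- `w` lies in the open cone on the vectors `x j`, `j ≠ i`. -/
def FacetCone (x : Fin (n + 1) → (Fin n → ℝ)) (w : Fin n → ℝ) (i : Fin (n + 1)) : Prop :=
  ∃ c : Fin (n + 1) → ℝ, c i = 0 ∧ (∀ j, j ≠ i → 0 < c j) ∧ ∑ j, c j • x j = w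

theorem inOpenCone_succAbove_iff (x : Fin (n + 1) → (Fin n → ℝ)) (w : Fin n → ℝ) (i : Fin (n + 1)) :
    InOpenCone (x ∘ i.succAbove) w ↔ FacetCone x w i := by
  constructor
  · rintro ⟨c, hc, hw⟩
    refine ⟨i.insertNth 0 c, by simp, ?_, ?_⟩
    · intro j hj
      obtain ⟨k, rfl⟩ := Fin.exists_succAbove_eq hj
      simpa using hc k
    · rw [Fin.sum_univ_succAbove _ i]
      simpa using hw
  · rintro ⟨c, hci, hc, hw⟩
    refine ⟨fun j => c (i.succAbove j), fun j => hc _ (Fin.succAbove_ne i j), ?_⟩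
    rw [Fin.sum_univ_succAbove _ i] at hw
    simpa [hci] using hw

theorem FacetCone.exists_opposite {x : Fin (n + 1) → (Fin n → ℝ)} {w : Fin n → ℝ}
    (h0 : (0 : Fin n → ℝ) ∉ convexHull ℝ (Set.range x))
    (hgen : ∀ c : Fin (n + 1) → ℝ, ∑ j, c j • x j = w → ∀ a b, a ≠ b → c a = 0 → c b ≠ 0)
    {k : Fin (n + 1) → ℝ} (hk : ∑ j, k j • x j = 0) {i : Fin (n + 1)} (hi : 0 < k i)
    (hf : FacetCone x w i) : ∃ j, k j < 0 ∧ FacetCone x w j := by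
  classical
  obtain ⟨c, hci, hc, hw⟩ := hf
  have hneg : (Finset.univ.filter fun j => k j < 0).Nonempty := by
    by_contra hcon
    rw [Finset.not_nonempty_iff_eq_empty, Finset.filter_eq_empty_iff] at hcon
    have hnn : ∀ j, 0 ≤ k j := fun j => not_lt.mp (hcon (Finset.mem_univ j))
    have hpos : 0 < ∑ j, k j := Finset.sum_pos' (fun j _ => hnn j) ⟨i, Finset.mem_univ i, hi⟩
    refine h0 ?_
    have := Finset.centerMass_mem_convexHull Finset.univ (fun j _ => hnn j) hpos
      (fun j _ => Set.mem_range_self (f := x) j)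
    rwa [Finset.centerMass, hk, smul_zero] at this
  obtain ⟨j, hj, hmin⟩ := Finset.exists_min_image _ (fun j => c j / (- k j)) hneg
  have hkj : k j < 0 := by simpa using hj
  have hji : j ≠ i := by rintro rfl; linarith
  set t := c j / (- k j) with ht
  have htpos : 0 < t := div_pos (hc j hji) (by linarith)
  have hsol : ∑ m, (c m + t * k m) • x m = w := by
    simp only [add_smul, mul_smul, Finset.sum_add_distrib, ← Finset.smul_sum, hk, hw]
    simp
  have hzero : c j + t * k j = 0 := by have := hkj.ne; rw [ht]; field_simp; ring
  refine ⟨j, hkj, fun m => c m + t * k m, hzero, fun m hm => ?_, hsol⟩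
  refine lt_of_le_of_ne ?_ (Ne.symm (hgen _ hsol j m hm.symm hzero))
  have hcm : 0 ≤ c m := by
    by_cases hmi : m = i
    · rw [hmi, hci]
    · exact (hc m hmi).le
  rcases lt_or_ge (k m) 0 with h | h
  · have := hmin m (by simpa using h)
    rw [le_div_iff₀ (by linarith)] at this
    linarith
  · positivity

theorem FacetCone.unique {x : Fin (n + 1) → (Fin n → ℝ)} {w : Fin n → ℝ} {i j : Fin (n + 1)}
    (hi : cramerRel x i ≠ 0) (hij : 0 < cramerRel x i * cramerRel x j)
    (hfi : FacetCone x w i) (hfj : FacetCone x w j) : i = j := by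
  by_contra hne
  obtain ⟨c, hci, hc, hw⟩ := hfi
  obtain ⟨d, hdj, hd, hw'⟩ := hfj
  obtain ⟨t, ht⟩ := exists_eq_smul_cramerRel hi (c := fun m => d m - c m)
    (by simp [sub_smul, Finset.sum_sub_distrib, hw, hw'])
  have h1 := ht i
  have h2 := ht j
  have h3 := hd i hne
  have h4 := hc j (Ne.symm hne)
  rw [hci, sub_zero] at h1
  rw [hdj, zero_sub] at h2
  have h5 : d i * (- c j) = t ^ 2 * (cramerRel x i * cramerRel x j) := by rw [h1, h2]; ring
  nlinarith [mul_pos h3 h4, mul_nonneg (sq_nonneg t) hij.le]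

theorem sum_coneIndex_succAbove {x : Fin (n + 1) → (Fin n → ℝ)} {w : Fin n → ℝ}
    (h0 : (0 : Fin n → ℝ) ∉ convexHull ℝ (Set.range x))
    (hgen : ∀ c : Fin (n + 1) → ℝ, ∑ j, c j • x j = w → ∀ a b, a ≠ b → c a = 0 → c b ≠ 0) :
    ∑ i : Fin (n + 1), (-1 : ℤ) ^ (i : ℕ) * coneIndex w (x ∘ i.succAbove) = 0 := by
  classical
  have hterm : ∀ i : Fin (n + 1), (-1 : ℤ) ^ (i : ℕ) * coneIndex w (x ∘ i.succAbove) =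
      if FacetCone x w i then (SignType.sign (cramerRel x i) : ℤ) else 0 := by
    intro i
    rw [coneIndex, inOpenCone_succAbove_iff]
    split_ifs with h
    · rw [cramerRel, sign_mul, SignType.coe_mul]
      congr 1
      rcases Nat.even_or_odd i with h | h <;> simp [h.neg_one_pow]
    · simp
  rw [Finset.sum_congr rfl fun i _ => hterm i]
  have hzero : ∀ i, ¬ (FacetCone x w i ∧ cramerRel x i ≠ 0) →
      (if FacetCone x w i then (SignType.sign (cramerRel x i) : ℤ) else 0) = 0 := by
    intro i hi
    split_ifs with h
    · have : cramerRel x i = 0 := by by_contra hne; exact hi ⟨h, hne⟩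
      simp [this]
    · rfl
  by_cases hex : ∃ i, FacetCone x w i ∧ cramerRel x i ≠ 0
  swap
  · exact Finset.sum_eq_zero fun i _ => hzero i fun h => hex ⟨i, h⟩
  have hpair : ∃ i j, FacetCone x w i ∧ FacetCone x w j ∧ 0 < cramerRel x i ∧ cramerRel x j < 0 := by
    obtain ⟨i, hi, hne⟩ := hex
    rcases lt_or_gt_of_ne hne with hlt | hgt
    · obtain ⟨j, hj, hfj⟩ := hi.exists_opposite h0 hgen (k := fun j => - cramerRel x j)
        (by simp [neg_smul, sum_cramerRel]) (by simpa using hlt)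
      exact ⟨j, i, hfj, hi, by simpa using hj, hlt⟩
    · obtain ⟨j, hj, hfj⟩ := hi.exists_opposite h0 hgen (sum_cramerRel x) hgt
      exact ⟨i, j, hi, hfj, hgt, hj⟩
  obtain ⟨i, j, hi, hj, hki, hkj⟩ := hpair
  have hij : i ≠ j := by rintro rfl; linarith
  rw [Finset.sum_eq_add i j hij]
  · rw [if_pos hi, if_pos hj, sign_pos hki, sign_neg hkj]; simp
  · intro m _ hm
    refine hzero m ?_
    rintro ⟨hfm, hkm⟩
    rcases lt_or_gt_of_ne hkm with hlt | hgt
    · exact hm.2 (hfm.unique hkm (mul_pos_of_neg_of_neg hlt hkj) hj)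
    · exact hm.1 (hfm.unique hkm (mul_pos hgt hki) hi)
  · simp
  · simp

theorem bdList_eq_sum {V : Type*} (l : List V) : bdList l =
    ∑ i ∈ Finset.range l.length, (-1 : ℤ) ^ i • (Finsupp.single (l.eraseIdx i) 1 : Ch V) := by
  induction l with
  | nil => simp [bdList]
  | cons x l ih =>
    rw [bdList, ih, List.length_cons, Finset.sum_range_succ', map_sum, sub_eq_add_neg, add_comm]
    congr 1
    · rw [← Finset.sum_neg_distrib]
      refine Finset.sum_congr rfl fun i _ => ?_
      rw [map_smul, cone_single, List.eraseIdx_cons_succ, pow_succ]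
      module
    · simp

/-- The first `n` entries of a list of vectors. -/
def vertices (n : ℕ) (l : List (Fin n → ℝ)) (i : Fin n) : Fin n → ℝ := l.getD i 0

/-- The total signed number of points of `X` in the open cone on the list `l`. -/
noncomputable def countList (X : Set (Fin n → ℝ)) (l : List (Fin n → ℝ)) : ℤ :=
  ∑ᶠ w ∈ X, coneIndex w (vertices n l)

/-- The linear extension of `countList` to chains. -/
noncomputable def count (X : Set (Fin n → ℝ)) : Ch (Fin n → ℝ) →ₗ[ℤ] ℤ :=
  Finsupp.linearCombination ℤ (countList X)

@[simp] theorem count_single (X : Set (Fin n → ℝ)) (l : List (Fin n → ℝ)) (a : ℤ) :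
    count X (Finsupp.single l a) = a * countList X l := by
  simp [count]

/-- Every open cone on negative vectors contains only finitely many elements of `X`. -/
def FiniteInCones (s : Fin n → ℝ) (X : Set (Fin n → ℝ)) : Prop :=
  ∀ x : Fin n → (Fin n → ℝ), Neg s (Set.range x) → {w ∈ X | InOpenCone x w}.Finite

theorem count_bd {s : Fin n → ℝ} {X : Set (Fin n → ℝ)} (hfin : FiniteInCones s X)
    {z : Ch (Fin n → ℝ)} (hz : z ∈ Cn (NegGen s X) (n + 1)) : count X (bd z) = 0 := by
  classical
  have hz' := mem_Cn_iff.mp hz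
  refine eq_of_single (count X ∘ₗ bd) 0 fun l hl => ?_
  obtain ⟨hlen, hneg, hgen⟩ := hz' l hl
  let x : Fin (n + 1) → (Fin n → ℝ) := fun i => l.getD i 0
  have hx : ∀ i, x i ∈ {y | y ∈ l} := by
    intro i
    have : (i : ℕ) < l.length := by omega
    simp only [x, List.getD_eq_getElem _ _ this]
    exact List.getElem_mem this
  have hrange : Set.range x ⊆ {y | y ∈ l} := by rintro _ ⟨i, rfl⟩; exact hx i
  have hvert : ∀ i : Fin (n + 1), vertices n (l.eraseIdx i) = x ∘ i.succAbove := by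
    intro i
    ext1 j
    simp only [vertices, x, Function.comp_apply, List.getD_eq_getElem?_getD,
      List.getElem?_eraseIdx]
    by_cases h : (j : ℕ) < i
    · rw [if_pos h, Fin.succAbove_of_castSucc_lt _ _ h]; simp
    · rw [if_neg h, Fin.succAbove_of_le_castSucc _ _ (by simpa [Fin.le_def] using h)]; simp
  have hsupp : ∀ i : Fin (n + 1), {w ∈ X | coneIndex w (x ∘ i.succAbove) ≠ 0}.Finite := by
    intro i
    refine (hfin (x ∘ i.succAbove) (Neg.downClosed s ?_ hneg)).subset ?_
    · exact (Set.range_comp_subset_range _ _).trans hrange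
    · rintro w ⟨hw, hne⟩
      refine ⟨hw, ?_⟩
      by_contra hcon
      exact hne (by rw [coneIndex, if_neg hcon])
  simp only [LinearMap.comp_apply, bd_single, one_smul, LinearMap.zero_apply]
  rw [bdList_eq_sum, map_sum, hlen, Finset.sum_range fun i => count X _]
  simp only [map_smul, count_single, one_mul, countList, hvert, smul_eq_mul]
  have hS : (⋃ i : Fin (n + 1), {w ∈ X | coneIndex w (x ∘ i.succAbove) ≠ 0}).Finite :=
    Set.finite_iUnion hsupp
  have hcount : ∀ i : Fin (n + 1), ∑ᶠ w ∈ X, coneIndex w (x ∘ i.succAbove) =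
      ∑ w ∈ hS.toFinset, coneIndex w (x ∘ i.succAbove) := by
    intro i
    refine finsum_mem_eq_sum_of_inter_support_eq _ ?_
    ext w
    simp only [Set.mem_inter_iff, Function.mem_support, Set.Finite.coe_toFinset, Set.mem_iUnion]
    constructor
    · rintro ⟨h1, h2⟩; exact ⟨⟨i, h1, h2⟩, h2⟩
    · rintro ⟨⟨j, h1, -⟩, h2⟩; exact ⟨h1, h2⟩
  simp only [hcount, Finset.mul_sum]
  rw [Finset.sum_comm]
  refine Finset.sum_eq_zero fun w hw => ?_
  have hwX : w ∈ X := by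
    rw [Set.Finite.mem_toFinset, Set.mem_iUnion] at hw
    exact hw.choose_spec.1
  refine sum_coneIndex_succAbove ?_ ?_
  · intro h0
    have := Neg.downClosed s hrange hneg 0 h0
    simp [diagForm] at this
  · intro c hc a b hab ha hb
    refine hgen (((Finset.univ.erase a).erase b).image x) ?_ ?_ w hwX ?_
    · intro y hy
      simp only [Finset.coe_image] at hy
      obtain ⟨j, -, rfl⟩ := hy
      exact hx j
    · refine Finset.card_image_le.trans_lt ?_
      rw [Finset.card_erase_of_mem (by simp [hab.symm]), Finset.card_erase_of_mem (by simp)]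
      simp
      have : a ≠ b := hab
      have h2 : n ≠ 0 := by
        rintro rfl
        exact this (Fin.ext (by omega))
      omega
    · rw [← hc]
      refine Submodule.sum_mem _ fun j _ => ?_
      by_cases hja : j = a
      · rw [hja, ha, zero_smul]; exact Submodule.zero_mem _
      by_cases hjb : j = b
      · rw [hjb, hb, zero_smul]; exact Submodule.zero_mem _
      refine Submodule.smul_mem _ _ (Submodule.subset_span ?_)
      simp only [Finset.coe_image]
      exact ⟨j, by simp [hja, hjb], rfl⟩

theorem inOpenCone_map_iff {ι : Type*} [Fintype ι] (g : (Fin n → ℝ) ≃ₗ[ℝ] (Fin n → ℝ))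
    (x : ι → (Fin n → ℝ)) (w : Fin n → ℝ) : InOpenCone (g ∘ x) (g w) ↔ InOpenCone x w := by
  simp only [InOpenCone, Function.comp_apply, ← map_smul, ← map_sum, g.injective.eq_iff]

theorem countList_map (g : (Fin n → ℝ) ≃ₗ[ℝ] (Fin n → ℝ)) (hg : LinearMap.det (g : (Fin n → ℝ) →ₗ[ℝ] _) = 1)
    (X : Set (Fin n → ℝ)) (l : List (Fin n → ℝ)) :
    countList (g '' X) (l.map g) = countList X l := by
  have hv : vertices n (l.map g) = g ∘ vertices n l := by
    ext1 i
    simp only [vertices, Function.comp_apply, List.getD_eq_getElem?_getD, List.getElem?_map]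
    cases l[(i : ℕ)]? <;> simp
  have hdet : (Matrix.of (g ∘ vertices n l)).det = (Matrix.of (vertices n l)).det := by
    have : Matrix.of (g ∘ vertices n l) =
        Matrix.of (vertices n l) * (LinearMap.toMatrix' (g : (Fin n → ℝ) →ₗ[ℝ] _)).transpose := by
      ext i j
      have := congrFun (LinearMap.toMatrix'_mulVec (g : (Fin n → ℝ) →ₗ[ℝ] _) (vertices n l i)) j
      simp only [LinearEquiv.coe_coe] at this
      rw [Matrix.of_apply, Function.comp_apply, ← this, Matrix.mul_apply, Matrix.mulVec, dotProduct]
      exact Finset.sum_congr rfl fun k _ => mul_comm _ _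
    rw [this, Matrix.det_mul, Matrix.det_transpose, LinearMap.det_toMatrix', hg, mul_one]
  rw [countList, hv, finsum_mem_image g.injective.injOn]
  refine finsum_mem_congr rfl fun w _ => ?_
  have hiff := inOpenCone_map_iff g (vertices n l) w
  by_cases h : InOpenCone (vertices n l) w
  · rw [coneIndex, coneIndex, hdet, if_pos h, if_pos (hiff.mpr h)]
  · rw [coneIndex, coneIndex, if_neg h, if_neg fun h' => h (hiff.mp h')]

theorem count_cmap (g : (Fin n → ℝ) ≃ₗ[ℝ] (Fin n → ℝ)) (hg : LinearMap.det (g : (Fin n → ℝ) →ₗ[ℝ] _) = 1)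
    (X : Set (Fin n → ℝ)) (z : Ch (Fin n → ℝ)) : count (g '' X) (cmap g z) = count X z :=
  eq_of_single (count (g '' X) ∘ₗ cmap g) (count X) fun l _ => by
    simp [countList_map g hg]

/-- A discrete subset of a level set of the form meets cones on negative vectors in finite sets. -/
theorem finiteInCones {s : Fin n → ℝ} {X : Set (Fin n → ℝ)} (κ : ℝ)
    (hκ : ∀ w ∈ X, diagForm s w = κ) (hint : ∀ w ∈ X, ∃ m : Fin n → ℤ, w = fun i => (m i : ℝ)) :
    FiniteInCones s X := by
  intro x hx
  rcases (Set.range x).eq_empty_or_nonempty with hemp | hne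
  · have hempty : IsEmpty (Fin n) := Set.range_eq_empty_iff.mp hemp
    exact Set.toFinite _
  have hcomp : IsCompact (convexHull ℝ (Set.range x)) := (Set.finite_range x).isCompact_convexHull ℝ
  obtain ⟨y₀, hy₀, hmax⟩ := hcomp.exists_isMaxOn hne.convexHull (continuous_diagForm s).continuousOn
  obtain ⟨R, hR⟩ := hcomp.isBounded.exists_norm_le
  set δ := - diagForm s y₀ with hδ
  have hδpos : 0 < δ := by have := hx y₀ hy₀; linarith
  have hbound : ∀ w ∈ {w ∈ X | InOpenCone x w}, ‖w‖ ≤ (|κ| / δ + 1) * R := by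
    rintro w ⟨hwX, c, hc, rfl⟩
    have hpos : 0 < ∑ i, c i := by
      obtain ⟨_, i, -⟩ := hne
      exact Finset.sum_pos (fun i _ => hc i) ⟨i, Finset.mem_univ i⟩
    have hmem := Finset.centerMass_mem_convexHull Finset.univ (fun j _ => (hc j).le) hpos
      (fun j _ => Set.mem_range_self (f := x) j)
    set t := ∑ i, c i
    set y := Finset.centerMass Finset.univ c x
    have hy : ∑ i, c i • x i = t • y := by
      simp only [y, Finset.centerMass]
      rw [smul_smul, mul_inv_cancel₀ hpos.ne', one_smul]
    have hQ : κ = t ^ 2 * diagForm s y := by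
      rw [← hκ _ hwX, hy]
      simp only [diagForm, Pi.smul_apply, smul_eq_mul, Finset.mul_sum]
      exact Finset.sum_congr rfl fun i _ => by ring
    have h1 : diagForm s y ≤ - δ := by rw [hδ, neg_neg]; exact hmax hmem
    have h2 : t ^ 2 * δ ≤ |κ| := by
      have := neg_le_abs κ
      nlinarith [mul_le_mul_of_nonneg_left h1 (sq_nonneg t)]
    have h3 : t ≤ |κ| / δ + 1 := by
      have : t ^ 2 ≤ |κ| / δ := by rwa [le_div_iff₀ hδpos]
      nlinarith [sq_nonneg (t - 1)]
    rw [hy, norm_smul, Real.norm_of_nonneg hpos.le]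
    exact mul_le_mul h3 (hR y hmem) (norm_nonneg _) (by positivity)
  set C := (|κ| / δ + 1) * R
  refine ((Set.finite_Icc (fun _ : Fin n => -⌈C⌉) (fun _ => ⌈C⌉)).image
    (fun m i => (m i : ℝ))).subset ?_
  intro w hw
  obtain ⟨m, rfl⟩ := hint w hw.1
  refine ⟨m, ?_, rfl⟩
  have hle : ∀ i, |(m i : ℝ)| ≤ ⌈C⌉ := fun i =>
    ((norm_le_pi_norm (fun i => (m i : ℝ)) i).trans (hbound _ hw)).trans (Int.le_ceil _)
  constructor <;> intro i <;> have := abs_le.mp (hle i) <;> norm_cast at this <;> tauto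

end OrderedChain

namespace ListCochain

variable {G M N I : Type*}

section Defs
variable [AddCommGroup M]

/-- The part of the bar differential that multiplies adjacent entries of `g :: l`
or deletes the last one. -/
def tailDiff [Mul G] (f : List G → M) : G → List G → M
  | _, [] => f []
  | g, h :: l => f (g * h :: l) - tailDiff (fun m => f (g :: m)) h l

/-- The inhomogeneous differential, on cochains of all degrees simultaneously. -/
def diff [Monoid G] (ρ : Representation ℤ G M) (f : List G → M) : List G → M
  | [] => 0
  | g :: l => ρ g (f l) - tailDiff f g l

/-- The alternating insertion of `a` at all places of a list. -/
def insertion (a : G) (f : List G → M) : List G → M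
  | [] => f [a]
  | h :: l => f (a :: h :: l) - insertion a (fun m => f (h :: m)) l

/-- Evaluation of a cochain on the shuffle cycle of the elements `t i`, for `i` in a list. -/
def eval (t : I → G) : List I → (List G → M) → M
  | [], f => f []
  | i :: l, f => eval t l (insertion (t i) f)

/-- The Koszul differential associated with commuting endomorphisms `τ i`. -/
def koszul (τ : I → Module.End ℤ M) (E : List I → M) : List I → M
  | [] => 0
  | i :: l => (τ i (E l) - E l) - koszul τ (fun m => E (i :: m)) l

end Defs

variable [AddCommGroup M] [AddCommGroup N]

section TailDiff
variable [Mul G]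

theorem tailDiff_sub (f f' : List G → M) (g : G) (l : List G) :
    tailDiff (fun m => f m - f' m) g l = tailDiff f g l - tailDiff f' g l := by
  induction l generalizing f f' g with
  | nil => rfl
  | cons h l ih => simp only [tailDiff, ih]; abel

theorem tailDiff_comp (φ : M →ₗ[ℤ] N) (f : List G → M) (g : G) (l : List G) :
    tailDiff (fun m => φ (f m)) g l = φ (tailDiff f g l) := by
  induction l generalizing f g with
  | nil => rfl
  | cons h l ih => simp only [tailDiff, ih, map_sub]

theorem tailDiff_congr {f f' : List G → M} {g : G} {l : List G}
    (h : ∀ m : List G, m.length = l.length → f m = f' m) : tailDiff f g l = tailDiff f' g l := by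
  induction l generalizing f f' g with
  | nil => exact h [] rfl
  | cons k l ih =>
    rw [tailDiff, tailDiff, h _ (by simp), ih fun m hm => h _ (by simp [hm])]

theorem tailDiff_mem {f : List G → M} {P : Submodule ℤ M} {g : G} {l : List G}
    (h : ∀ m : List G, m.length = l.length → f m ∈ P) : tailDiff f g l ∈ P := by
  induction l generalizing f g with
  | nil => exact h [] rfl
  | cons k l ih =>
    exact P.sub_mem (h _ (by simp)) (ih fun m hm => h _ (by simp [hm]))

end TailDiff

theorem tailDiff_tailDiff [Semigroup G] (f : List G → M) (g h : G) (l : List G) :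
    tailDiff (fun m => tailDiff f g m) h l = tailDiff f (g * h) l := by
  induction l generalizing f g h with
  | nil => rfl
  | cons k l ih =>
    simp only [tailDiff, tailDiff_sub, ih, mul_assoc]
    abel

section Diff
variable [Monoid G] (ρ : Representation ℤ G M)

theorem diff_diff (f : List G → M) (l : List G) : diff ρ (diff ρ f) l = 0 := by
  cases l with
  | nil => rfl
  | cons g l =>
    cases l with
    | nil => simp [diff, tailDiff]
    | cons h l =>
      simp only [diff, tailDiff, tailDiff_sub, tailDiff_comp, tailDiff_tailDiff, map_sub, map_mul,
        Module.End.mul_apply]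
      abel

theorem diff_congr {f f' : List G → M} {l : List G}
    (h : ∀ m : List G, m.length + 1 = l.length → f m = f' m) : diff ρ f l = diff ρ f' l := by
  cases l with
  | nil => rfl
  | cons g l => rw [diff, diff, h l (by simp), tailDiff_congr fun m hm => h m (by simp [hm])]

theorem diff_mem {f : List G → M} {P : Submodule ℤ M} {l : List G}
    (hP : ∀ g, ∀ x ∈ P, ρ g x ∈ P)
    (h : ∀ m : List G, m.length + 1 = l.length → f m ∈ P) : diff ρ f l ∈ P := by
  cases l with
  | nil => exact P.zero_mem
  | cons g l => exact P.sub_mem (hP _ _ (h l (by simp))) (tailDiff_mem fun m hm => h m (by simp [hm]))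

theorem diff_comp (σ : Representation ℤ G N) (φ : M →ₗ[ℤ] N) (hφ : ∀ g x, φ (ρ g x) = σ g (φ x))
    (f : List G → M) (l : List G) : diff σ (fun m => φ (f m)) l = φ (diff ρ f l) := by
  cases l with
  | nil => simp [diff]
  | cons g l => simp [diff, tailDiff_comp, hφ]

end Diff

section Insertion

theorem insertion_sub (a : G) (f f' : List G → M) (l : List G) :
    insertion a (fun m => f m - f' m) l = insertion a f l - insertion a f' l := by
  induction l generalizing f f' with
  | nil => rfl
  | cons h l ih => simp only [insertion, ih]; abel

theorem insertion_comp (φ : M →ₗ[ℤ] N) (a : G) (f : List G → M) (l : List G) :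
    insertion a (fun m => φ (f m)) l = φ (insertion a f l) := by
  induction l generalizing f with
  | nil => rfl
  | cons h l ih => simp only [insertion, ih, map_sub]

theorem insertion_congr {A : Set G} {a : G} (ha : a ∈ A) {f f' : List G → M} {l : List G}
    (hl : ∀ x ∈ l, x ∈ A)
    (h : ∀ m : List G, (∀ x ∈ m, x ∈ A) → m.length = l.length + 1 → f m = f' m) :
    insertion a f l = insertion a f' l := by
  induction l generalizing f f' with
  | nil => exact h [a] (by simpa using ha) rfl
  | cons k l ih =>
    rw [insertion, insertion, h, ih fun x hx => hl x (by simp [hx])]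
    · intro m hm hlen
      refine h _ ?_ (by simp [hlen])
      rintro x hx
      rcases List.mem_cons.mp hx with rfl | hx
      · exact hl _ (by simp)
      · exact hm x hx
    · intro x hx
      rcases List.mem_cons.mp hx with rfl | hx
      · exact ha
      · exact hl x hx
    · simp

theorem insertion_mem {a : G} {f : List G → M} {P : Submodule ℤ M} {l : List G}
    (h : ∀ m : List G, m.length = l.length + 1 → f m ∈ P) : insertion a f l ∈ P := by
  induction l generalizing f with
  | nil => exact h [a] rfl
  | cons k l ih => exact P.sub_mem (h _ (by simp)) (ih fun m hm => h _ (by simp [hm]))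

theorem tailDiff_insertion [Semigroup G] {a : G} (f : List G → M) {h : G} {l : List G}
    (hh : a * h = h * a) (hl : ∀ x ∈ l, a * x = x * a) :
    tailDiff (insertion a f) h l - insertion a (fun m => tailDiff f h m) l =
      f (h :: l) - f (a * h :: l) + tailDiff (fun m => f (a :: m)) h l := by
  induction l generalizing f h with
  | nil => simp only [tailDiff, insertion, hh]; abel
  | cons k l ih =>
    have key := ih (fun m => f (h :: m)) (hl k (by simp)) fun x hx => hl x (by simp [hx])
    rw [sub_eq_iff_eq_add] at key
    have e1 : tailDiff (insertion a f) h (k :: l) = insertion a f (h * k :: l) -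
        tailDiff (fun m => f (a :: h :: m) - insertion a (fun m' => f (h :: m')) m) k l := rfl
    have e2 : tailDiff (fun m => insertion a (fun m' => f (h :: m')) m) k l =
        tailDiff (insertion a fun m' => f (h :: m')) k l := rfl
    rw [e1, tailDiff_sub, e2, key]
    simp only [insertion, tailDiff, insertion_sub, hh]
    abel

/-- Cartan's homotopy formula for the insertion of an element commuting with all entries. -/
theorem diff_insertion [Monoid G] (ρ : Representation ℤ G M) {a : G} (f : List G → M) {l : List G}
    (hl : ∀ x ∈ l, a * x = x * a) :
    insertion a (diff ρ f) l = (ρ a (f l) - f l) - diff ρ (insertion a f) l := by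
  cases l with
  | nil => simp [insertion, diff, tailDiff]
  | cons h l =>
    have key := tailDiff_insertion f (hl h List.mem_cons_self) fun x hx => hl x (List.mem_cons_of_mem h hx)
    rw [sub_eq_iff_eq_add] at key
    have e1 : insertion a (diff ρ f) (h :: l) = diff ρ f (a :: h :: l) -
        insertion a (fun m => ρ h (f m) - tailDiff f h m) l := rfl
    rw [e1, insertion_sub, insertion_comp]
    simp only [diff, key, tailDiff]
    abel

end Insertion

section Eval

theorem eval_comp (φ : M →ₗ[ℤ] N) (t : I → G) (l : List I) (f : List G → M) :
    eval t l (fun m => φ (f m)) = φ (eval t l f) := by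
  induction l generalizing f with
  | nil => rfl
  | cons i l ih =>
    rw [eval, eval, ← ih]
    congr 1
    ext m
    exact insertion_comp φ _ f m

theorem eval_sub (t : I → G) (l : List I) (f f' : List G → M) :
    eval t l (fun m => f m - f' m) = eval t l f - eval t l f' := by
  induction l generalizing f f' with
  | nil => rfl
  | cons i l ih =>
    rw [eval, eval, eval, ← ih]
    congr 1
    ext m
    exact insertion_sub _ f f' m

theorem eval_congr {t : I → G} {l : List I} {f f' : List G → M}
    (h : ∀ m : List G, (∀ x ∈ m, x ∈ Set.range t) → m.length = l.length → f m = f' m) :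
    eval t l f = eval t l f' := by
  induction l generalizing f f' with
  | nil => exact h [] (by simp) rfl
  | cons i l ih =>
    refine ih fun m hm hlen => insertion_congr (Set.mem_range_self i) hm fun m' hm' hlen' => ?_
    exact h m' hm' (by simp [hlen', hlen])

theorem eval_mem {t : I → G} {l : List I} {f : List G → M} {P : Submodule ℤ M}
    (h : ∀ m : List G, m.length = l.length → f m ∈ P) : eval t l f ∈ P := by
  induction l generalizing f with
  | nil => exact h [] rfl
  | cons i l ih =>
    exact ih fun m hlen => insertion_mem fun m' hlen' => h m' (by simp [hlen', hlen])

theorem eval_diff [Monoid G] (ρ : Representation ℤ G M) {t : I → G}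
    (ht : ∀ i j, t i * t j = t j * t i) (f : List G → M) (l : List I) :
    eval t l (diff ρ f) = koszul (fun i => ρ (t i)) (fun m => eval t m f) l := by
  induction l generalizing f with
  | nil => rfl
  | cons i l ih =>
    have e1 : eval t (i :: l) (diff ρ f) = eval t l
        (fun m => (ρ (t i) (f m) - f m) - diff ρ (insertion (t i) f) m) := by
      refine eval_congr fun m hm _ => diff_insertion ρ f fun x hx => ?_
      obtain ⟨j, rfl⟩ := hm x hx
      exact ht i j
    rw [e1, eval_sub, eval_sub, eval_comp, koszul, ih]
    rfl

end Eval

section Koszul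
variable (τ : I → Module.End ℤ M)

theorem koszul_sub (E E' : List I → M) (l : List I) :
    koszul τ (fun m => E m - E' m) l = koszul τ E l - koszul τ E' l := by
  induction l generalizing E E' with
  | nil => simp [koszul]
  | cons i l ih => simp only [koszul, ih, map_sub]; abel

theorem koszul_comp (σ : I → Module.End ℤ N) (φ : M →ₗ[ℤ] N) (E : List I → M) (l : List I)
    (hφ : ∀ i ∈ l, ∀ x, φ (τ i x) = σ i (φ x)) :
    koszul σ (fun m => φ (E m)) l = φ (koszul τ E l) := by
  induction l generalizing E with
  | nil => simp [koszul]
  | cons i l ih =>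
    have := ih (fun m => E (i :: m)) fun j hj => hφ j (by simp [hj])
    simp only [koszul, this, map_sub, hφ i (by simp)]

theorem koszul_congr {E E' : List I → M} {l : List I}
    (h : ∀ m : List I, m.Sublist l → m.length + 1 = l.length → E m = E' m) :
    koszul τ E l = koszul τ E' l := by
  induction l generalizing E E' with
  | nil => rfl
  | cons i l ih =>
    rw [koszul, koszul, h l (List.sublist_cons_self i l) (by simp),
      ih fun m hm hlen => h _ (hm.cons_cons i) (by simp [hlen])]

theorem koszul_mem {E : List I → M} {l : List I} {P : Submodule ℤ M}
    (hP : ∀ i, ∀ x ∈ P, τ i x ∈ P)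
    (h : ∀ m : List I, m.Sublist l → m.length + 1 = l.length → E m ∈ P) : koszul τ E l ∈ P := by
  induction l generalizing E with
  | nil => exact P.zero_mem
  | cons i l ih =>
    have hl := h l (List.sublist_cons_self i l) (by simp)
    exact P.sub_mem (P.sub_mem (hP i _ hl) hl)
      (ih fun m hm hlen => h _ (hm.cons_cons i) (by simp [hlen]))

theorem koszul_koszul (hτ : ∀ i j x, τ i (τ j x) = τ j (τ i x)) (E : List I → M) (l : List I) :
    koszul τ (koszul τ E) l = 0 := by
  induction l generalizing E with
  | nil => rfl
  | cons i l ih =>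
    have e1 : koszul τ (koszul τ E) (i :: l) = (τ i (koszul τ E l) - koszul τ E l) -
      koszul τ (fun m => (τ i (E m) - E m) - koszul τ (fun m' => E (i :: m')) m) l := rfl
    rw [e1, koszul_sub, koszul_sub, ih,
      koszul_comp τ τ (τ i) E l fun j _ x => hτ i j x]
    abel

theorem koszul_one (E : List I → M) (l : List I) : koszul (fun _ => (1 : Module.End ℤ M)) E l = 0 := by
  induction l generalizing E with
  | nil => rfl
  | cons i l ih => simp [koszul, ih]

end Koszul

end ListCochain

namespace OrderedChain

open ListCochain

variable {n : ℕ} {G : Type*} [Group G]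

/-- The action on chains induced by a linear action on vertices. -/
noncomputable def chainRep (a : G →* ((Fin n → ℝ) ≃ₗ[ℝ] (Fin n → ℝ))) :
    Representation ℤ G (Ch (Fin n → ℝ)) where
  toFun g := cmap (a g)
  map_one' := LinearMap.ext fun z => by rw [map_one]; exact cmap_id z
  map_mul' g h := LinearMap.ext fun z => by rw [map_mul]; exact (cmap_cmap (a g) (a h) z).symm

theorem chainRep_apply (a : G →* ((Fin n → ℝ) ≃ₗ[ℝ] (Fin n → ℝ))) (g : G) (z : Ch (Fin n → ℝ)) :
    chainRep a g z = cmap (a g) z := rfl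

/-- Linear automorphisms of determinant one preserving the form and the set `X`. -/
structure IsSym (s : Fin n → ℝ) (X : Set (Fin n → ℝ)) (g : (Fin n → ℝ) ≃ₗ[ℝ] (Fin n → ℝ)) : Prop where
  form : ∀ x, diagForm s (g x) = diagForm s x
  det : LinearMap.det (g : (Fin n → ℝ) →ₗ[ℝ] (Fin n → ℝ)) = 1
  image : g '' X = X

/-- The requirements on the set `X` of vectors to be counted in cones. -/
structure IsTarget (s : Fin n → ℝ) (X : Set (Fin n → ℝ)) : Prop where
  countable : X.Countable
  zero_notMem : (0 : Fin n → ℝ) ∉ X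
  finite : FiniteInCones s X

variable {s : Fin n → ℝ} {X : Set (Fin n → ℝ)} {q : ℕ}

theorem Neg.image {g : (Fin n → ℝ) ≃ₗ[ℝ] (Fin n → ℝ)} (hg : ∀ x, diagForm s (g x) = diagForm s x)
    {S : Set (Fin n → ℝ)} (hS : Neg s S) : Neg s (g '' S) := by
  intro x hx
  have := (g : (Fin n → ℝ) →ₗ[ℝ] (Fin n → ℝ)).image_convexHull S
  simp only [LinearEquiv.coe_coe] at this
  rw [← this] at hx
  obtain ⟨y, hy, rfl⟩ := hx
  rw [hg]
  exact hS y hy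

theorem Generic.image (g : (Fin n → ℝ) ≃ₗ[ℝ] (Fin n → ℝ)) {S : Set (Fin n → ℝ)}
    (hS : Generic X S) : Generic (g '' X) (g '' S) := by
  classical
  rintro A hA hcard _ ⟨w, hw, rfl⟩ hmem
  have hsub : ((A.image g.symm : Finset _) : Set (Fin n → ℝ)) ⊆ S := by
    rw [Finset.coe_image]
    rintro _ ⟨x, hx, rfl⟩
    obtain ⟨y, hy, rfl⟩ := hA hx
    simpa using hy
  refine hS _ hsub (Finset.card_image_le.trans_lt hcard) w hw ?_
  have h1 := Submodule.mem_map_of_mem (f := (g.symm : (Fin n → ℝ) →ₗ[ℝ] (Fin n → ℝ))) hmem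
  rw [Submodule.map_span] at h1
  simpa using h1

theorem IsSym.negGen {g : (Fin n → ℝ) ≃ₗ[ℝ] (Fin n → ℝ)} (hg : IsSym s X g)
    {S : Set (Fin n → ℝ)} (hS : NegGen s X S) : NegGen s X (g '' S) := by
  refine ⟨hS.1.image hg.form, ?_⟩
  have := hS.2.image g
  rwa [hg.image] at this

theorem IsSym.count {g : (Fin n → ℝ) ≃ₗ[ℝ] (Fin n → ℝ)} (hg : IsSym s X g) (z : Ch (Fin n → ℝ)) :
    count X (cmap g z) = count X z := by
  conv_lhs => rw [← hg.image]
  exact count_cmap g hg.det X z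

theorem IsTarget.exists_bd (hX : IsTarget s X) (hq : Fintype.card {i // s i < 0} = q)
    {r : ℕ} (hr : q < r) {z : Ch (Fin n → ℝ)} (hz : z ∈ Cn (NegGen s X) r) (hz0 : bd z = 0) :
    ∃ y ∈ Cn (NegGen s X) (r + 1), bd y = z := by
  obtain ⟨y, hy, hyz⟩ := (sphereLike_neg hq).above r hr z (mono_mem hz fun _ h => h.1) hz0
  exact exists_generic_bd hX.countable hX.zero_notMem hz hy hyz

/-- An equivariant chain map from the bar resolution to generic negative chains, in
degrees up to `k`, written as an inhomogeneous cochain. -/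
theorem IsTarget.exists_resolution (hX : IsTarget s X) (hq : Fintype.card {i // s i < 0} = q)
    (a : G →* ((Fin n → ℝ) ≃ₗ[ℝ] (Fin n → ℝ))) (ha : ∀ g, IsSym s X (a g))
    {z₀ : Ch (Fin n → ℝ)} (hz₀ : z₀ ∈ Cn (NegGen s X) q) (hz₀0 : bd z₀ = 0)
    (htriv : ∀ g, ∃ y ∈ Cn (Neg s) (q + 1), bd y = cmap (a g) z₀ - z₀) (k : ℕ) :
    ∃ L : List G → Ch (Fin n → ℝ), L [] = z₀ ∧ ∀ l : List G, l.length ≤ k →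
      L l ∈ Cn (NegGen s X) (q + l.length) ∧ bd (L l) = diff (chainRep a) L l := by
  have hstab : ∀ r g, ∀ x ∈ Cn (NegGen s X) r, chainRep a g x ∈ Cn (NegGen s X) r :=
    fun r g x hx => cmap_mem hx fun S hS => (ha g).negGen hS
  induction k with
  | zero =>
    refine ⟨fun _ => z₀, rfl, fun l hl => ?_⟩
    obtain rfl := List.length_eq_zero_iff.mp (Nat.le_zero.mp hl)
    exact ⟨hz₀, hz₀0⟩
  | succ k ih =>
    obtain ⟨L, hL0, hL⟩ := ih
    have hex : ∀ l : List G, l.length = k + 1 → ∃ y ∈ Cn (NegGen s X) (q + (k + 1)),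
        bd y = diff (chainRep a) L l := by
      intro l hl
      have hmem : diff (chainRep a) L l ∈ Cn (NegGen s X) (q + k) :=
        diff_mem _ (hstab _) fun m hm => by
          have hmk : m.length = k := by omega
          have := (hL m hmk.le).1
          rwa [hmk] at this
      rcases k.eq_zero_or_pos with rfl | hk
      · obtain ⟨g, rfl⟩ := List.length_eq_one_iff.mp hl
        obtain ⟨y, hy, hyz⟩ := htriv g
        have e : diff (chainRep a) L [g] = cmap (a g) z₀ - z₀ := by
          simp [diff, tailDiff, hL0, chainRep_apply]
        rw [e] at hmem ⊢
        exact exists_generic_bd hX.countable hX.zero_notMem hmem hy hyz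
      · refine hX.exists_bd hq (Nat.lt_add_of_pos_right hk) hmem ?_
        rw [← diff_comp (chainRep a) (chainRep a) bd (fun g x => bd_cmap _ x),
          ← diff_diff (chainRep a) L l]
        exact diff_congr _ fun m hm => (hL m (by omega)).2
    choose! Y hY hYbd using hex
    classical
    refine ⟨fun l => if l.length = k + 1 then Y l else L l, by simp [hL0], fun l hl => ?_⟩
    have hc : diff (chainRep a) (fun l => if l.length = k + 1 then Y l else L l) l =
        diff (chainRep a) L l := diff_congr _ fun m hm => if_neg (by omega)
    rw [hc]
    by_cases h : l.length = k + 1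
    · simp only [if_pos h]
      rw [h]
      exact ⟨hY l h, hYbd l h⟩
    · simp only [if_neg h]
      exact hL l (by omega)

/-- Comparison of two solutions of the Koszul equations. -/
theorem IsTarget.count_eq_of_koszul (hX : IsTarget s X) (hq : Fintype.card {i // s i < 0} = q)
    {I : Type*} (a : I → ((Fin n → ℝ) ≃ₗ[ℝ] (Fin n → ℝ))) (ha : ∀ i, IsSym s X (a i))
    (hcomm : ∀ i j, a i * a j = a j * a i) {J : List I} (hn : q + J.length = n)
    {E E' : List I → Ch (Fin n → ℝ)}
    (hE : ∀ l : List I, l.Sublist J → E l ∈ Cn (NegGen s X) (q + l.length) ∧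
      bd (E l) = koszul (fun i => cmap (a i)) E l)
    (hE' : ∀ l : List I, l.Sublist J → E' l ∈ Cn (NegGen s X) (q + l.length) ∧
      bd (E' l) = koszul (fun i => cmap (a i)) E' l)
    (h0 : ∃ y ∈ Cn (Neg s) (q + 1), bd y = E [] - E' []) :
    count X (E J) = count X (E' J) := by
  classical
  set τ : I → Module.End ℤ (Ch (Fin n → ℝ)) := fun i => cmap (a i) with hτ
  have hstab : ∀ r i, ∀ x ∈ Cn (NegGen s X) r, τ i x ∈ Cn (NegGen s X) r :=
    fun r i x hx => cmap_mem hx fun S hS => (ha i).negGen hS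
  have hτcomm : ∀ i j x, τ i (τ j x) = τ j (τ i x) := by
    intro i j x
    simp only [hτ, cmap_cmap]
    congr 2
    exact congrArg DFunLike.coe (hcomm i j)
  have key : ∀ k : ℕ, ∃ H : List I → Ch (Fin n → ℝ), ∀ l : List I, l.Sublist J → l.length < k →
      H l ∈ Cn (NegGen s X) (q + l.length + 1) ∧ bd (H l) = E l - E' l - koszul τ H l := by
    intro k
    induction k with
    | zero => exact ⟨0, fun l _ h => by omega⟩
    | succ k ih =>
      obtain ⟨H, hH⟩ := ih
      have hex : ∀ l : List I, l.Sublist J ∧ l.length = k → ∃ y ∈ Cn (NegGen s X) (q + k + 1),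
          bd y = E l - E' l - koszul τ H l := by
        rintro l ⟨hlJ, hl⟩
        have hmem : E l - E' l - koszul τ H l ∈ Cn (NegGen s X) (q + k) := by
          subst hl
          refine Submodule.sub_mem _ (Submodule.sub_mem _ (hE l hlJ).1 (hE' l hlJ).1) ?_
          refine koszul_mem τ (hstab _) fun m hm hlen => ?_
          have := (hH m (hm.trans hlJ) (by omega)).1
          rwa [add_assoc, hlen] at this
        rcases k.eq_zero_or_pos with rfl | hk
        · obtain rfl := List.length_eq_zero_iff.mp hl
          obtain ⟨y, hy, hyz⟩ := h0
          have e : koszul τ H [] = 0 := rfl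
          rw [e, sub_zero] at hmem ⊢
          exact exists_generic_bd hX.countable hX.zero_notMem hmem hy hyz
        · refine hX.exists_bd hq (Nat.lt_add_of_pos_right hk) hmem ?_
          have e1 : bd (koszul τ H l) = koszul τ (fun m => bd (H m)) l :=
            (koszul_comp τ τ bd H l fun i _ x => bd_cmap _ x).symm
          have e2 : koszul τ (fun m => bd (H m)) l =
              koszul τ (fun m => (E m - E' m) - koszul τ H m) l :=
            koszul_congr τ fun m hm hlen => (hH m (hm.trans hlJ) (by omega)).2
          rw [map_sub, map_sub, (hE l hlJ).2, (hE' l hlJ).2, e1, e2, koszul_sub, koszul_sub,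
            koszul_koszul τ hτcomm]
          abel
      choose! Y hY hYbd using hex
      refine ⟨fun l => if l.length = k then Y l else H l, fun l hlJ hl => ?_⟩
      have hc : koszul τ (fun l => if l.length = k then Y l else H l) l = koszul τ H l :=
        koszul_congr τ fun m _ hm => if_neg (by omega)
      rw [hc]
      by_cases h : l.length = k
      · simp only [if_pos h]
        rw [h]
        exact ⟨hY l ⟨hlJ, h⟩, hYbd l ⟨hlJ, h⟩⟩
      · simp only [if_neg h]
        exact hH l hlJ (by omega)
  obtain ⟨H, hH⟩ := key (J.length + 1)
  obtain ⟨hHJ, hbd⟩ := hH J (List.Sublist.refl J) (by omega)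
  rw [hn] at hHJ
  have h1 := count_bd hX.finite hHJ
  have h2 : count X (koszul τ H J) = 0 := by
    rw [← koszul_comp τ (fun _ => (1 : Module.End ℤ ℤ)) (count X) H J fun i _ x => (ha i).count x]
    exact koszul_one _ _
  rw [hbd, map_sub, map_sub, h2, sub_zero] at h1
  exact sub_eq_zero.mp h1

end OrderedChain

namespace OrderedChain

theorem finite_units_zmod (m : ℕ) : Finite (ZMod m)ˣ := by
  rcases m with _ | m
  · exact inferInstanceAs (Finite ℤˣ)
  · infer_instance

/-- The elements acting trivially on the homology of the complex of negative chains form a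
normal subgroup of finite index. -/
theorem exists_normal_finiteIndex_trivial {n q : ℕ} {G : Type*} [Group G] {s : Fin n → ℝ}
    (hq : Fintype.card {i // s i < 0} = q)
    (a : G →* ((Fin n → ℝ) ≃ₗ[ℝ] (Fin n → ℝ))) (ha : ∀ g x, diagForm s (a g x) = diagForm s x) :
    ∃ Γ : Subgroup G, Γ.Normal ∧ Γ.FiniteIndex ∧ ∀ g ∈ Γ, ∀ z ∈ Cn (Neg s) q, bd z = 0 →
      ∃ y ∈ Cn (Neg s) (q + 1), bd y = cmap (a g) z - z := by
  obtain ⟨z₀, hz₀, hz₀0, hcyc⟩ := (sphereLike_neg hq).cyclic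
  let Bd : Submodule ℤ (Ch (Fin n → ℝ)) := (Cn (Neg s) (q + 1)).map bd
  have hstab : ∀ g, ∀ x ∈ Bd, chainRep a g x ∈ Bd := by
    rintro g _ ⟨y, hy, rfl⟩
    exact ⟨_, cmap_mem hy fun S hS => hS.image (ha g), (bd_cmap _ y)⟩
  have hcyc' : ∀ z ∈ Cn (Neg s) q, bd z = 0 → ∃ k : ℤ, z - k • z₀ ∈ Bd := by
    intro z hz hz0
    obtain ⟨k, y, hy, rfl⟩ := hcyc z hz hz0
    exact ⟨k, y, hy, by abel⟩
  have hex : ∀ g, ∃ k : ℤ, chainRep a g z₀ - k • z₀ ∈ Bd := fun g =>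
    hcyc' _ (cmap_mem hz₀ fun S hS => hS.image (ha g))
      ((bd_cmap (a g) z₀).trans (by rw [hz₀0, map_zero]))
  choose α hα using hex
  obtain ⟨m, hm⟩ : ∃ m : ℕ, ∀ k : ℤ, k • z₀ ∈ Bd ↔ (m : ℤ) ∣ k := by
    obtain ⟨m, hm⟩ := Int.subgroup_cyclic (Bd.comap (LinearMap.toSpanSingleton ℤ _ z₀)).toAddSubgroup
    refine ⟨m.natAbs, fun k => ?_⟩
    have : k ∈ (Bd.comap (LinearMap.toSpanSingleton ℤ _ z₀)).toAddSubgroup ↔ k • z₀ ∈ Bd := by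
      simp
    rw [← this, hm, ← AddSubgroup.zmultiples_eq_closure, Int.mem_zmultiples_iff, Int.natAbs_dvd]
  have huniq : ∀ k l : ℤ, k • z₀ - l • z₀ ∈ Bd → ((k : ℤ) : ZMod m) = l := by
    intro k l h
    rw [← sub_smul, hm] at h
    rw [← sub_eq_zero, ← Int.cast_sub]
    exact (ZMod.intCast_zmod_eq_zero_iff_dvd _ _).mpr h
  let φ : G →* ZMod m :=
    { toFun := fun g => (α g : ZMod m)
      map_one' := by
        rw [← Int.cast_one]
        refine huniq _ _ ?_
        have := hα 1
        rw [map_one, Module.End.one_apply] at this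
        rw [one_smul, ← neg_sub]
        exact Bd.neg_mem this
      map_mul' := fun g h => by
        rw [← Int.cast_mul]
        refine huniq _ _ ?_
        have h1 := hα (g * h)
        have h2 := hstab g _ (hα h)
        have h3 := Bd.smul_mem (α h) (hα g)
        rw [map_mul, Module.End.mul_apply] at h1
        rw [map_sub, map_smul] at h2
        have h4 := Bd.sub_mem (Bd.add_mem h2 h3) h1
        rw [smul_sub, smul_smul, mul_comm (α h)] at h4
        convert h4 using 1
        abel }
  have := finite_units_zmod m
  refine ⟨φ.toHomUnits.ker, inferInstance, inferInstance, fun g hg z hz hz0 => ?_⟩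
  have hg1 : ((α g : ℤ) : ZMod m) = 1 := by
    have h : φ g = 1 := by simpa using congrArg Units.val (MonoidHom.mem_ker.mp hg)
    exact h
  have hg2 : (α g - 1) • z₀ ∈ Bd := by
    rw [hm]
    refine (ZMod.intCast_zmod_eq_zero_iff_dvd _ _).mp ?_
    rw [Int.cast_sub, hg1, Int.cast_one, sub_self]
  obtain ⟨k, hk⟩ := hcyc' z hz hz0
  suffices h : chainRep a g z - z ∈ Bd from h
  have h1 := hstab g _ hk
  rw [map_sub, map_smul] at h1
  have h2 := Bd.add_mem (Bd.sub_mem h1 hk)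
    (Bd.add_mem (Bd.smul_mem k (hα g)) (Bd.smul_mem k hg2))
  convert h2 using 1
  module

end OrderedChain

namespace ListCochain

section Comparison
variable {G M : Type*}

theorem contractNth_zero_eq_cons {n : ℕ} (op : G → G → G) (g : Fin (n + 2) → G) :
    Fin.contractNth 0 op g =
      (Fin.cons (op (g 0) (g 1)) (fun i : Fin n => g i.succ.succ) : Fin (n + 1) → G) := by
  funext k
  refine Fin.cases ?_ (fun k => ?_) k
  · rw [Fin.contractNth_apply_of_eq _ _ _ _ (by simp)]; simp
  · rw [Fin.contractNth_apply_of_gt _ _ _ _ (by simp)]; simp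

theorem contractNth_succ_eq_cons {n : ℕ} (op : G → G → G) (g : Fin (n + 2) → G) (j : Fin (n + 1)) :
    Fin.contractNth j.succ op g =
      (Fin.cons (g 0) (Fin.contractNth j op (fun i => g i.succ)) : Fin (n + 1) → G) := by
  funext k
  refine Fin.cases ?_ (fun k => ?_) k
  · rw [Fin.contractNth_apply_of_lt _ _ _ _ (by simp)]; simp
  · simp [Fin.contractNth]

theorem tailDiff_ofFn [AddCommGroup M] [Mul G] (n : ℕ) (f : List G → M) (g : Fin (n + 1) → G) :
    tailDiff f (g 0) (List.ofFn fun i : Fin n => g i.succ) =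
      ∑ j : Fin (n + 1), (-1 : ℤ) ^ (j : ℕ) • f (List.ofFn (Fin.contractNth j (· * ·) g)) := by
  induction n generalizing f with
  | zero => simp [tailDiff]
  | succ n ih =>
    rw [Fin.sum_univ_succ, List.ofFn_succ, tailDiff]
    have h := ih (fun m => f (g 0 :: m)) (fun i => g i.succ)
    rw [Fin.succ_zero_eq_one] at h
    rw [Fin.succ_zero_eq_one, h, contractNth_zero_eq_cons]
    simp only [contractNth_succ_eq_cons, List.ofFn_succ, Fin.cons_zero, Fin.cons_succ,
      Fin.val_zero, pow_zero, one_smul, Fin.val_succ, pow_succ, mul_neg, mul_one, neg_smul,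
      Finset.sum_neg_distrib, sub_eq_add_neg]

end Comparison

section Cohomology
open CategoryTheory groupCohomology
variable {G : Type} [Group G]

theorem d_apply (p : ℕ) (f : List G → ℚ) (g : Fin (p + 1) → G) :
    inhomogeneousCochains.d (Rep.trivial ℚ G ℚ) p (fun x => f (List.ofFn x)) g =
      diff (Representation.trivial ℤ G ℚ) f (List.ofFn g) := by
  rw [inhomogeneousCochains.d_hom_apply, List.ofFn_succ, diff, tailDiff_ofFn, sub_eq_add_neg,
    ← Finset.sum_neg_distrib]
  congr 1
  refine Finset.sum_congr rfl fun j _ => ?_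
  rw [pow_succ, mul_neg, mul_one, neg_smul]
  congr 1
  rcases Nat.even_or_odd (j : ℕ) with h | h <;> simp [h.neg_one_pow]

theorem exists_d_eq_of_π_eq_zero (A : Rep ℚ G) (p : ℕ) (x : cocycles A (p + 1))
    (hx : groupCohomology.π A (p + 1) x = 0) :
    ∃ y : (Fin p → G) → A, inhomogeneousCochains.d A p y = iCocycles A (p + 1) x := by
  have hex : (ShortComplex.mk (toCocycles A p (p + 1)) (groupCohomology.π A (p + 1))
      ((inhomogeneousCochains A).toCycles_comp_homologyπ p (p + 1))).Exact :=
    ShortComplex.exact_of_g_is_cokernel _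
      ((inhomogeneousCochains A).homologyIsCokernel p (p + 1) (by simp))
  obtain ⟨y, hy⟩ := (ShortComplex.moduleCat_exact_iff _).mp hex x hx
  refine ⟨y, ?_⟩
  rw [← hy, ← inhomogeneousCochains.d_def]
  exact (ConcreteCategory.congr_hom ((inhomogeneousCochains A).toCycles_i p (p + 1)) y).symm

/-- Cocycles detected by evaluation on tori yield a lower bound for the rank of cohomology. -/
theorem le_rank_groupCohomology {p N : ℕ} (hp : p ≠ 0) (c : Fin N → List G → ℤ)
    (hc : ∀ k, ∀ l : List G, l.length = p + 1 → diff (Representation.trivial ℤ G ℤ) (c k) l = 0)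
    {I : Type*} (t : Fin N → I → G) (ht : ∀ k i j, t k i * t k j = t k j * t k i)
    (J : List I) (hJ : J.length = p)
    (hne : ∀ k, eval (t k) J (c k) ≠ 0)
    (h0 : ∀ k k', k ≠ k' → eval (t k) J (c k') = 0) :
    (N : Cardinal) ≤ Module.rank ℚ (groupCohomology (Rep.trivial ℚ G ℚ) p) := by
  obtain ⟨p, rfl⟩ := Nat.exists_eq_succ_of_ne_zero hp
  set A := Rep.trivial ℚ G ℚ with hA
  let cQ : Fin N → List G → ℚ := fun k l => (c k l : ℚ)
  let φ : ℤ →ₗ[ℤ] ℚ := (Int.castAddHom ℚ).toIntLinearMap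
  have hcQ : ∀ k, ∀ l : List G, l.length = p + 2 →
      diff (Representation.trivial ℤ G ℚ) (cQ k) l = 0 := fun k l hl => by
    have := diff_comp (Representation.trivial ℤ G ℤ) (Representation.trivial ℤ G ℚ) φ
      (fun g x => rfl) (c k) l
    rw [hc k l hl, map_zero] at this
    exact this
  have hd : ∀ k, inhomogeneousCochains.d A (p + 1) (fun x => cQ k (List.ofFn x)) = 0 := by
    intro k
    funext g
    rw [d_apply, hcQ k _ (by simp)]
    rfl
  have hind : LinearIndependent ℚ fun k => groupCohomology.π A (p + 1) (cocyclesMk _ (hd k)) := by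
    rw [Fintype.linearIndependent_iff]
    intro a ha k
    have hx : groupCohomology.π A (p + 1) (∑ k, a k • cocyclesMk _ (hd k)) = 0 := by
      rw [map_sum, ← ha]
      simp only [map_smul]
    obtain ⟨y, hy⟩ := exists_d_eq_of_π_eq_zero A p _ hx
    classical
    let Y : List G → ℚ := fun l => if h : l.length = p then y fun i => l.get (i.cast h.symm) else 0
    have hY : ∀ l : List G, l.length = p + 1 →
        diff (Representation.trivial ℤ G ℚ) Y l = ∑ k, a k • cQ k l := by
      intro l hl
      obtain ⟨g, rfl⟩ : ∃ g : Fin (p + 1) → G, List.ofFn g = l := by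
        rw [← hl]
        exact ⟨l.get, List.ofFn_get l⟩
      rw [← d_apply]
      have e : (fun x : Fin p → G => Y (List.ofFn x)) = y := by
        funext x
        simp [Y]
      rw [e]
      refine (congrFun hy g).trans ?_
      rw [map_sum]
      simp only [map_smul]
      exact (Finset.sum_apply g _ _).trans (Finset.sum_congr rfl fun k _ =>
        congrArg (a k • ·) (congrFun (iCocycles_mk _ (hd k)) g))
    have h1 : eval (t k) J (fun l => ∑ k, a k • cQ k l) = 0 := by
      rw [← eval_congr fun m _ hm => hY m (hm.trans hJ), eval_diff _ (ht k)]
      exact koszul_one _ _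
    let F : List G → Fin N → ℚ := fun l k => cQ k l
    let Λ : (Fin N → ℚ) →ₗ[ℤ] ℚ := ∑ k, a k • LinearMap.proj k
    have h2 : ∀ k', eval (t k) J F k' = ((eval (t k) J (c k') : ℤ) : ℚ) := by
      intro k'
      rw [← LinearMap.proj_apply (R := ℤ) (φ := fun _ => ℚ) k' (eval (t k) J F), ← eval_comp]
      exact eval_comp φ (t k) J (c k')
    have h3 : Λ (eval (t k) J F) = 0 := by
      rw [← eval_comp, ← h1]
      congr 1
      funext l
      simp [Λ, F]
    have h4 : Λ (eval (t k) J F) = a k * ((eval (t k) J (c k) : ℤ) : ℚ) := by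
      have : Λ (eval (t k) J F) = ∑ k', a k' * eval (t k) J F k' := by simp [Λ]
      rw [this, Finset.sum_eq_single k (fun k' _ hk => by rw [h2, h0 k k' hk.symm]; simp) (by simp),
        h2]
    rw [h4] at h3
    exact (mul_eq_zero.mp h3).resolve_right (Int.cast_ne_zero.mpr (hne k))
  simpa using hind.cardinal_le_rank

end Cohomology
end ListCochain

namespace OrderedChain

open ListCochain

/-- A lower bound for the rank of the cohomology of a group acting on negative chains, in terms of
tori whose explicit cycles are separated by counting vectors in cones. -/
theorem le_rank_of_count {n p q N : ℕ} (hp : p ≠ 0) (hn : q + p = n) {Γ : Type} [Group Γ]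
    {s : Fin n → ℝ} (hq : Fintype.card {i // s i < 0} = q)
    (a : Γ →* ((Fin n → ℝ) ≃ₗ[ℝ] (Fin n → ℝ))) (X : Fin N → Set (Fin n → ℝ))
    (hX : ∀ k, IsTarget s (X k)) (ha : ∀ k g, IsSym s (X k) (a g))
    (htriv : ∀ g, ∀ z ∈ Cn (Neg s) q, bd z = 0 → ∃ y ∈ Cn (Neg s) (q + 1), bd y = cmap (a g) z - z)
    {I : Type*} (t : Fin N → I → Γ) (ht : ∀ k i j, t k i * t k j = t k j * t k i)
    (J : List I) (hJ : J.length = p) (E : Fin N → List I → Ch (Fin n → ℝ))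
    (hE : ∀ k k', ∀ l : List I, l.Sublist J → E k l ∈ Cn (NegGen s (X k')) (q + l.length))
    (hbd : ∀ k, ∀ l : List I, l.Sublist J → bd (E k l) = koszul (fun i => cmap (a (t k i))) (E k) l)
    (hE0 : ∀ k k', ∃ y ∈ Cn (Neg s) (q + 1), bd y = E k [] - E k' [])
    (hne : ∀ k, count (X k) (E k J) ≠ 0)
    (h0 : ∀ k k', k ≠ k' → count (X k') (E k J) = 0) :
    (N : Cardinal) ≤ Module.rank ℚ (groupCohomology (Rep.trivial ℚ Γ ℚ) p) := by
  have hres := fun k => (hX k).exists_resolution hq a (ha k) (hE k k [] (List.nil_sublist J))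
    (hbd k [] (List.nil_sublist J))
    (fun g => htriv g _ (mono_mem (hE k k [] (List.nil_sublist J)) fun _ h => h.1)
      (hbd k [] (List.nil_sublist J))) (p + 1)
  choose L hL0 hL using hres
  have hcount : ∀ k g (x : Ch (Fin n → ℝ)), count (X k) (chainRep a g x) =
      Representation.trivial ℤ Γ ℤ g (count (X k) x) := fun k g x => (ha k g).count x
  have heval : ∀ k k', eval (t k) J (fun l => count (X k') (L k' l)) = count (X k') (E k J) := by
    intro k k'
    rw [eval_comp]
    refine (hX k').count_eq_of_koszul hq (fun i => a (t k i)) (fun i => ha k' _)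
      (fun i j => by rw [← map_mul, ht, map_mul]) (J := J) (by omega)
      (E := fun l => eval (t k) l (L k')) (E' := E k) ?_ (fun l hl => ⟨hE k k' l hl, hbd k l hl⟩) ?_
    · intro l hl
      have hlen : l.length ≤ p := hJ ▸ hl.length_le
      refine ⟨eval_mem fun m hm => hm ▸ (hL k' m (by omega)).1, ?_⟩
      rw [← eval_comp, eval_congr fun m _ hm => (hL k' m (by omega)).2, eval_diff _ (ht k)]
      rfl
    · have : eval (t k) [] (L k') = E k' [] := hL0 k'
      rw [this]
      exact hE0 k' k
  refine le_rank_groupCohomology hp (fun k l => count (X k) (L k l)) ?_ t ht J hJ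
    (fun k => by rw [heval]; exact hne k) (fun k k' h => by rw [heval]; exact h0 k k' h)
  intro k l hl
  rw [diff_comp (chainRep a) _ (count (X k)) (hcount k), ← (hL k l hl.le).2]
  refine count_bd (hX k).finite ?_
  have := (hL k l hl.le).1
  rwa [hl, ← add_assoc, hn] at this

end OrderedChain

namespace OrderedChain

open ListCochain

section Torus
variable {V I : Type*} [AddCommGroup V]

/-- The join with the pair of points `e`, `-e`. -/
noncomputable def suspend (e : V) : Ch V →ₗ[ℤ] Ch V := cone e - cone (-e)

/-- The join with the pair of segments from `e` to `e'` and from `-e` to `-e'`. -/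
noncomputable def suspendSegment (e e' : V) : Ch V →ₗ[ℤ] Ch V :=
  cone e ∘ₗ cone e' - cone (-e) ∘ₗ cone (-e')

theorem bd_suspend (e : V) (x : Ch V) : bd (suspend e x) = - suspend e (bd x) := by
  simp only [suspend, LinearMap.sub_apply, map_sub, bd_cone]; abel

theorem bd_suspendSegment (e e' : V) (x : Ch V) :
    bd (suspendSegment e e' x) = suspend e' x - suspend e x + suspendSegment e e' (bd x) := by
  simp only [suspend, suspendSegment, LinearMap.sub_apply, LinearMap.comp_apply, map_sub, bd_cone]
  abel

theorem cmap_suspend (τ : V →+ V) (e : V) (x : Ch V) :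
    cmap τ (suspend e x) = suspend (τ e) (cmap τ x) := by
  simp only [suspend, LinearMap.sub_apply, map_sub, cmap_cone, map_neg]

theorem cmap_suspendSegment (τ : V →+ V) (e e' : V) (x : Ch V) :
    cmap τ (suspendSegment e e' x) = suspendSegment (τ e) (τ e') (cmap τ x) := by
  simp only [suspendSegment, LinearMap.sub_apply, LinearMap.comp_apply, map_sub, cmap_cone, map_neg]

variable [DecidableEq I] (P P' : I → V)

/-- The join of suspensions along `K`, thickened by segments along `l`. -/
noncomputable def torusChain : List I → List I → Ch V
  | [], _ => Finsupp.single [] 1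
  | j :: K, [] => suspend (P j) (torusChain K [])
  | j :: K, i :: l =>
    if i = j then (-1 : ℤ) ^ K.length • suspendSegment (P j) (P' j) (torusChain K l)
    else suspend (P j) (torusChain K (i :: l))

theorem torusChain_cons_of_notMem {j : I} {K l : List I} (h : j ∉ l) :
    torusChain P P' (j :: K) l = suspend (P j) (torusChain P P' K l) := by
  cases l with
  | nil => rfl
  | cons i l => rw [torusChain, if_neg]; rintro rfl; simp at h

theorem torusChain_cons_cons (j : I) (K l : List I) :
    torusChain P P' (j :: K) (j :: l) =
      (-1 : ℤ) ^ K.length • suspendSegment (P j) (P' j) (torusChain P P' K l) := by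
  rw [torusChain, if_pos rfl]

variable {P P'}

theorem cmap_torusChain {τ : V →+ V} {K : List I} (h : ∀ j ∈ K, τ (P j) = P j ∧ τ (P' j) = P' j)
    (l : List I) : cmap τ (torusChain P P' K l) = torusChain P P' K l := by
  induction K generalizing l with
  | nil => simp [torusChain, cmap_single]
  | cons j K ih =>
    have ih := ih fun i hi => h i (by simp [hi])
    obtain ⟨h1, h2⟩ := h j (by simp)
    cases l with
    | nil => rw [torusChain, cmap_suspend, h1, ih]
    | cons i l =>
      rw [torusChain]
      split_ifs
      · rw [map_smul, cmap_suspendSegment, h1, h2, ih]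
      · rw [cmap_suspend, h1, ih]

theorem bd_torusChain {τ : I → V →+ V} (hτ : ∀ i, τ i (P i) = P' i)
    (hfix : ∀ i j, i ≠ j → τ i (P j) = P j ∧ τ i (P' j) = P' j)
    {K l : List I} (hK : K.Nodup) (hl : l.Sublist K) :
    bd (torusChain P P' K l) =
      (-1 : ℤ) ^ (K.length + 1) • koszul (fun i => cmap (τ i)) (torusChain P P' K) l := by
  induction K generalizing l with
  | nil =>
    rw [List.sublist_nil.mp hl]
    simp [torusChain, koszul, bd_single, bdList]
  | cons j K ih =>
    obtain ⟨hj, hK⟩ := List.nodup_cons.mp hK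
    have hne : ∀ {m : List I}, m.Sublist K → ∀ i ∈ m, i ≠ j := fun hm i hi e => hj (e ▸ hm.subset hi)
    have hnm : ∀ {m : List I}, m.Sublist K → j ∉ m := fun hm h => hj (hm.subset h)
    rcases List.sublist_cons_iff.mp hl with hl | ⟨l, rfl, hl'⟩
    · rw [torusChain_cons_of_notMem P P' (hnm hl), bd_suspend, ih hK hl, map_smul,
        koszul_congr _ fun m hm _ => torusChain_cons_of_notMem P P' (hnm (hm.trans hl)),
        koszul_comp (fun i => cmap (τ i)) _ (suspend (P j)) (torusChain P P' K) l, List.length_cons,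
        pow_succ _ (K.length + 1), mul_neg, mul_one, neg_smul]
      intro i hi x
      rw [cmap_suspend, (hfix i j (hne hl i hi)).1]
    · replace hl := hl'
      have h1 : suspend (P' j) (torusChain P P' K l) =
          cmap (τ j) (torusChain P P' (j :: K) l) := by
        rw [torusChain_cons_of_notMem P P' (hnm hl), cmap_suspend, hτ,
          cmap_torusChain fun i hi => hfix j i fun e => hj (e ▸ hi)]
      have h2 : koszul (fun i => cmap (τ i)) (fun m => torusChain P P' (j :: K) (j :: m)) l =
          (-1 : ℤ) ^ K.length • suspendSegment (P j) (P' j)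
            (koszul (fun i => cmap (τ i)) (torusChain P P' K) l) := by
        rw [← LinearMap.smul_apply, ← koszul_comp (fun i => cmap (τ i)) (fun i => cmap (τ i))]
        · exact koszul_congr _ fun m _ _ => torusChain_cons_cons P P' j K m
        · intro i hi x
          obtain ⟨e1, e2⟩ := hfix i j (hne hl i hi)
          rw [LinearMap.smul_apply, LinearMap.smul_apply, map_smul, cmap_suspendSegment, e1, e2]
      rw [torusChain_cons_cons, map_smul, bd_suspendSegment, ih hK hl, koszul, h2, h1,
        torusChain_cons_of_notMem P P' (hnm hl), map_smul, List.length_cons]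
      simp only [pow_succ, mul_neg, mul_one, neg_neg, smul_add, smul_sub, neg_smul, smul_neg]
      abel

/-- The labels of the vertices of the simplices occurring in a torus chain. -/
def torusLabels : List I → List I → List (I ⊕ I)
  | [], _ => []
  | j :: K, [] => Sum.inl j :: torusLabels K []
  | j :: K, i :: l =>
    if i = j then Sum.inl j :: Sum.inr j :: torusLabels K l
    else Sum.inl j :: torusLabels K (i :: l)

theorem torusLabels_cons_of_notMem {j : I} {K l : List I} (h : j ∉ l) :
    torusLabels (j :: K) l = Sum.inl j :: torusLabels K l := by
  cases l with
  | nil => rfl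
  | cons i l => rw [torusLabels, if_neg]; rintro rfl; simp at h

theorem torusLabels_cons_cons (j : I) (K l : List I) :
    torusLabels (j :: K) (j :: l) = Sum.inl j :: Sum.inr j :: torusLabels K l := by
  rw [torusLabels, if_pos rfl]

theorem length_torusLabels {K l : List I} (hK : K.Nodup) (hl : l.Sublist K) :
    (torusLabels K l).length = K.length + l.length := by
  induction K generalizing l with
  | nil => simp [List.sublist_nil.mp hl, torusLabels]
  | cons j K ih =>
    obtain ⟨hj, hK⟩ := List.nodup_cons.mp hK
    rcases List.sublist_cons_iff.mp hl with hl | ⟨l, rfl, hl'⟩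
    · rw [torusLabels_cons_of_notMem fun h => hj (hl.subset h), List.length_cons, ih hK hl,
        List.length_cons]
      omega
    · replace hl := hl'
      rw [torusLabels_cons_cons, List.length_cons, List.length_cons, ih hK hl, List.length_cons,
        List.length_cons]
      omega

theorem mem_torusLabels {K l : List I} (hK : K.Nodup) (hl : l.Sublist K) (x : I) :
    (Sum.inl x ∈ torusLabels K l ↔ x ∈ K) ∧ (Sum.inr x ∈ torusLabels K l ↔ x ∈ l) := by
  induction K generalizing l with
  | nil => simp [List.sublist_nil.mp hl, torusLabels]
  | cons j K ih =>
    obtain ⟨hj, hK⟩ := List.nodup_cons.mp hK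
    rcases List.sublist_cons_iff.mp hl with hl | ⟨l, rfl, hl'⟩
    · rw [torusLabels_cons_of_notMem fun h => hj (hl.subset h)]
      simp [ih hK hl]
    · replace hl := hl'
      rw [torusLabels_cons_cons]
      simp [ih hK hl]

theorem nodup_torusLabels {K l : List I} (hK : K.Nodup) (hl : l.Sublist K) :
    (torusLabels K l).Nodup := by
  induction K generalizing l with
  | nil => simp [torusLabels]
  | cons j K ih =>
    obtain ⟨hj, hK⟩ := List.nodup_cons.mp hK
    rcases List.sublist_cons_iff.mp hl with hl | ⟨l, rfl, hl'⟩
    · rw [torusLabels_cons_of_notMem fun h => hj (hl.subset h)]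
      simp [ih hK hl, mem_torusLabels hK hl, hj]
    · replace hl := hl'
      have : j ∉ l := fun h => hj (hl.subset h)
      rw [torusLabels_cons_cons]
      simp [ih hK hl, mem_torusLabels hK hl, hj, this]

/-- The vertex with a given label, for a choice of signs. -/
def torusVertex (P P' : I → V) (ε : I → ℤˣ) : I ⊕ I → V
  | Sum.inl j => (ε j : ℤ) • P j
  | Sum.inr j => (ε j : ℤ) • P' j

theorem map_torusVertex_update (ε : I → ℤˣ) {j : I} (u : ℤˣ) {K l : List I} (hK : K.Nodup)
    (hl : l.Sublist K) (hj : j ∉ K) :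
    (torusLabels K l).map (torusVertex P P' (Function.update ε j u)) =
      (torusLabels K l).map (torusVertex P P' ε) := by
  refine List.map_congr_left fun x hx => ?_
  rcases x with i | i
  · have : i ≠ j := fun e => hj (e ▸ ((mem_torusLabels hK hl i).1.mp hx))
    simp [torusVertex, this]
  · have : i ≠ j := fun e => hj (e ▸ hl.subset ((mem_torusLabels hK hl i).2.mp hx))
    simp [torusVertex, this]

omit [AddCommGroup V] in
theorem cone_mem_supported {s s' : Set (List V)} {e : V} {z : Ch V}
    (hz : z ∈ Finsupp.supported ℤ ℤ s) (h : ∀ L ∈ s, e :: L ∈ s') :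
    cone e z ∈ Finsupp.supported ℤ ℤ s' := by
  have := Submodule.mem_map_of_mem (f := Finsupp.lmapDomain ℤ ℤ (List.cons e)) hz
  rw [Finsupp.lmapDomain_supported] at this
  refine Finsupp.supported_mono ?_ this
  rintro _ ⟨L, hL, rfl⟩
  exact h L hL

/-- A torus chain is the sum, over choices of signs, of signed simplices; we single out the one
with all signs positive. -/
theorem torusChain_mem_supported {K l : List I} (hK : K.Nodup) (hl : l.Sublist K) :
    ∃ u : ℤˣ, torusChain P P' K l -
      Finsupp.single ((torusLabels K l).map (torusVertex P P' 1)) (u : ℤ) ∈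
      Finsupp.supported ℤ ℤ {L | ∃ ε : I → ℤˣ, (∃ j ∈ K, ε j = -1) ∧
        L = (torusLabels K l).map (torusVertex P P' ε)} := by
  induction K generalizing l with
  | nil => exact ⟨1, by simp [torusChain, torusLabels]⟩
  | cons j K ih =>
    obtain ⟨hj, hK⟩ := List.nodup_cons.mp hK
    rcases List.sublist_cons_iff.mp hl with hl | ⟨l, rfl, hl'⟩
    · obtain ⟨u, hu⟩ := ih hK hl
      have hx : torusChain P P' K l ∈ Finsupp.supported ℤ ℤ
          {L | ∃ ε : I → ℤˣ, L = (torusLabels K l).map (torusVertex P P' ε)} := by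
        rw [← sub_add_cancel (torusChain P P' K l)
          (Finsupp.single ((torusLabels K l).map (torusVertex P P' 1)) (u : ℤ))]
        refine Submodule.add_mem _ (Finsupp.supported_mono ?_ hu) ?_
        · rintro L ⟨ε, -, rfl⟩
          exact ⟨ε, rfl⟩
        · exact Finsupp.single_mem_supported _ _ ⟨1, rfl⟩
      have hjl : j ∉ l := fun h => hj (hl.subset h)
      rw [torusChain_cons_of_notMem P P' hjl, torusLabels_cons_of_notMem hjl]
      refine ⟨u, ?_⟩
      have e : suspend (P j) (torusChain P P' K l) - Finsupp.single
          ((Sum.inl j :: torusLabels K l).map (torusVertex P P' 1)) (u : ℤ) =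
          cone (P j) (torusChain P P' K l -
            Finsupp.single ((torusLabels K l).map (torusVertex P P' 1)) (u : ℤ)) -
          cone (-P j) (torusChain P P' K l) := by
        rw [map_sub, cone_single, suspend, LinearMap.sub_apply, List.map_cons]
        simp only [torusVertex, Pi.one_apply, Units.val_one, one_smul]
        abel
      rw [e]
      refine Submodule.sub_mem _ (cone_mem_supported hu ?_) (cone_mem_supported hx ?_)
      · rintro L ⟨ε, ⟨i, hi, hε⟩, rfl⟩
        have hij : i ≠ j := fun e => hj (e ▸ hi)
        refine ⟨Function.update ε j 1, ⟨i, by simp [hi], by simp [hij, hε]⟩, ?_⟩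
        rw [List.map_cons, map_torusVertex_update ε 1 hK hl hj]
        simp [torusVertex]
      · rintro L ⟨ε, rfl⟩
        refine ⟨Function.update ε j (-1), ⟨j, by simp, by simp⟩, ?_⟩
        rw [List.map_cons, map_torusVertex_update ε (-1) hK hl hj]
        simp [torusVertex]
    · obtain ⟨u, hu⟩ := ih hK hl'
      have hx : torusChain P P' K l ∈ Finsupp.supported ℤ ℤ
          {L | ∃ ε : I → ℤˣ, L = (torusLabels K l).map (torusVertex P P' ε)} := by
        rw [← sub_add_cancel (torusChain P P' K l)
          (Finsupp.single ((torusLabels K l).map (torusVertex P P' 1)) (u : ℤ))]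
        refine Submodule.add_mem _ (Finsupp.supported_mono ?_ hu) ?_
        · rintro L ⟨ε, -, rfl⟩
          exact ⟨ε, rfl⟩
        · exact Finsupp.single_mem_supported _ _ ⟨1, rfl⟩
      rw [torusChain_cons_cons, torusLabels_cons_cons]
      refine ⟨(-1) ^ K.length * u, ?_⟩
      have e : (-1 : ℤ) ^ K.length • suspendSegment (P j) (P' j) (torusChain P P' K l) -
          Finsupp.single ((Sum.inl j :: Sum.inr j :: torusLabels K l).map (torusVertex P P' 1))
            (((-1) ^ K.length * u : ℤˣ) : ℤ) =
          (-1 : ℤ) ^ K.length • (cone (P j) (cone (P' j) (torusChain P P' K l -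
            Finsupp.single ((torusLabels K l).map (torusVertex P P' 1)) (u : ℤ))) -
          cone (-P j) (cone (-P' j) (torusChain P P' K l))) := by
        simp only [map_sub, cone_single, suspendSegment, LinearMap.sub_apply, List.map_cons,
          LinearMap.comp_apply, torusVertex, Pi.one_apply, Units.val_one, one_smul, smul_sub,
          Finsupp.smul_single, smul_eq_mul, Units.val_mul, Units.val_pow_eq_pow_val, Units.val_neg]
        abel
      rw [e]
      refine Submodule.smul_mem _ _ (Submodule.sub_mem _ (cone_mem_supported (cone_mem_supported
        (s' := {L | ∃ M ∈ {L | ∃ ε : I → ℤˣ, (∃ j ∈ K, ε j = -1) ∧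
        L = (torusLabels K l).map (torusVertex P P' ε)}, L = P' j :: M}) hu
        fun L hL => ⟨L, hL, rfl⟩) ?_) (cone_mem_supported (cone_mem_supported
        (s' := {L | ∃ M ∈ {L | ∃ ε : I → ℤˣ, L = (torusLabels K l).map (torusVertex P P' ε)},
          L = -P' j :: M}) hx fun L hL => ⟨L, hL, rfl⟩) ?_))
      · rintro _ ⟨L, ⟨ε, ⟨i, hi, hε⟩, rfl⟩, rfl⟩
        have hij : i ≠ j := fun e => hj (e ▸ hi)
        refine ⟨Function.update ε j 1, ⟨i, by simp [hi], by simp [hij, hε]⟩, ?_⟩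
        rw [List.map_cons, List.map_cons, map_torusVertex_update ε 1 hK hl' hj]
        simp [torusVertex]
      · rintro _ ⟨L, ⟨ε, rfl⟩, rfl⟩
        refine ⟨Function.update ε j (-1), ⟨j, by simp, by simp⟩, ?_⟩
        rw [List.map_cons, List.map_cons, map_torusVertex_update ε (-1) hK hl' hj]
        simp [torusVertex]

end Torus

end OrderedChain

namespace OrderedChain

open ListCochain

/-- Coordinates adapted to a product of hyperbolic planes, indexed by `T`, and negative lines,
indexed by `U`; in the plane of index `i` two vectors `(-θ i, 1)` and `(x i, y i)` in the same
component of the negative cone are given. -/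
structure TorusFrame {n : ℕ} (s : Fin n → ℝ) (T U : Type) where
  coord : T ⊕ (T ⊕ U) ≃ Fin n
  pos : T → ℝ
  neg : T ⊕ U → ℝ
  θ : T → ℝ
  x : T → ℝ
  y : T → ℝ
  slope : T → ℝ
  s_pos : ∀ i, s (coord (Sum.inl i)) = pos i
  s_neg : ∀ a, s (coord (Sum.inr a)) = - neg a
  zero_lt_pos : ∀ i, 0 < pos i
  zero_lt_neg : ∀ a, 0 < neg a
  zero_lt_y : ∀ i, 0 < y i
  abs_θ_le : ∀ i, |θ i| ≤ slope i
  abs_x_le : ∀ i, |x i| ≤ slope i * y i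
  slope_lt : ∀ i, pos i * slope i ^ 2 < neg (Sum.inl i)
  zero_lt_θ : ∀ i, 0 < θ i
  zero_lt_x : ∀ i, 0 < x i

namespace TorusFrame

variable {n : ℕ} {s : Fin n → ℝ} {T U : Type} (F : TorusFrame s T U)

/-- The positive coordinate in the plane of index `i`. -/
def xc (i : T) : (Fin n → ℝ) →ₗ[ℝ] ℝ := LinearMap.proj (F.coord (Sum.inl i))

/-- The negative coordinate of index `a`. -/
def yc (a : T ⊕ U) : (Fin n → ℝ) →ₗ[ℝ] ℝ := LinearMap.proj (F.coord (Sum.inr a))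

/-- The starting points of the segments. -/
def P : T ⊕ U → (Fin n → ℝ)
  | Sum.inl i => Pi.single (F.coord (Sum.inr (Sum.inl i))) 1 -
      F.θ i • Pi.single (F.coord (Sum.inl i)) 1
  | Sum.inr u => Pi.single (F.coord (Sum.inr (Sum.inr u))) 1

/-- The end points of the segments. -/
def P' : T ⊕ U → (Fin n → ℝ)
  | Sum.inl i => F.x i • Pi.single (F.coord (Sum.inl i)) 1 +
      F.y i • Pi.single (F.coord (Sum.inr (Sum.inl i))) 1
  | Sum.inr u => Pi.single (F.coord (Sum.inr (Sum.inr u))) 1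

theorem pi_ext {v w : Fin n → ℝ} (hx : ∀ i, F.xc i v = F.xc i w) (hy : ∀ a, F.yc a v = F.yc a w) :
    v = w := by
  funext k
  obtain ⟨l, rfl⟩ := F.coord.surjective k
  rcases l with i | a
  · exact hx i
  · exact hy a

theorem yc_P (a b : T ⊕ U) [Decidable (b = a)] : F.yc b (F.P a) = if b = a then 1 else 0 := by
  rcases a with i | u
  · by_cases h : b = Sum.inl i <;>
      simp [yc, P, h]
  · by_cases h : b = Sum.inr u <;>
      simp [yc, P, h]

theorem xc_P_inl (i j : T) [Decidable (j = i)] :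
    F.xc j (F.P (Sum.inl i)) = if j = i then - F.θ i else 0 := by
  by_cases h : j = i <;> simp [xc, P, h]

theorem xc_P_inr (j : T) (u : U) : F.xc j (F.P (Sum.inr u)) = 0 := by
  simp [xc, P]

theorem yc_P'_inl (i : T) (b : T ⊕ U) [Decidable (b = Sum.inl i)] :
    F.yc b (F.P' (Sum.inl i)) = if b = Sum.inl i then F.y i else 0 := by
  by_cases h : b = Sum.inl i <;> simp [yc, P', h]

theorem xc_P'_inl (i j : T) [Decidable (j = i)] :
    F.xc j (F.P' (Sum.inl i)) = if j = i then F.x i else 0 := by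
  by_cases h : j = i <;> simp [xc, P', h]

variable [Fintype T] [Fintype U]

theorem diagForm_eq (w : Fin n → ℝ) :
    diagForm s w = ∑ i, F.pos i * F.xc i w ^ 2 - ∑ a, F.neg a * F.yc a w ^ 2 := by
  rw [diagForm, ← F.coord.sum_comp, Fintype.sum_sum_type, sub_eq_add_neg, ← Finset.sum_neg_distrib]
  simp only [F.s_pos, F.s_neg, neg_mul]
  rfl

variable (ε : T ⊕ U → ℤˣ)

/-- The vertices of the full-dimensional simplices, for a choice of signs. -/
def vert : T ⊕ (T ⊕ U) → (Fin n → ℝ) :=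
  Sum.elim (fun i => (ε (Sum.inl i) : ℤ) • F.P' (Sum.inl i)) fun a => (ε a : ℤ) • F.P a

/-- A convex cone on which the form is negative away from its apex. -/
def InCone (w : Fin n → ℝ) : Prop :=
  (∀ i, |F.xc i w| ≤ F.slope i * ((ε (Sum.inl i) : ℤ) * F.yc (Sum.inl i) w)) ∧
    ∀ a, 0 ≤ (ε a : ℤ) * F.yc a w

theorem sq_units (u : ℤˣ) (r : ℝ) : (((u : ℤ) : ℝ) * r) ^ 2 = r ^ 2 := by
  rcases Int.units_eq_one_or u with rfl | rfl <;> simp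

omit [Fintype T] [Fintype U] in
theorem InCone.sq_le {w : Fin n → ℝ} (h : F.InCone ε w) (i : T) :
    F.xc i w ^ 2 ≤ F.slope i ^ 2 * F.yc (Sum.inl i) w ^ 2 := by
  have h1 := pow_le_pow_left₀ (abs_nonneg _) (h.1 i) 2
  rwa [sq_abs, mul_pow, sq_units] at h1

omit [Fintype T] [Fintype U] in
theorem InCone.le_zero {w : Fin n → ℝ} (h : F.InCone ε w) (i : T) :
    F.pos i * F.xc i w ^ 2 ≤ F.neg (Sum.inl i) * F.yc (Sum.inl i) w ^ 2 := by
  have h1 := mul_le_mul_of_nonneg_left (h.sq_le F ε i) (F.zero_lt_pos i).le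
  have h2 := mul_le_mul_of_nonneg_right (F.slope_lt i).le (sq_nonneg (F.yc (Sum.inl i) w))
  linarith

omit [Fintype T] [Fintype U] in
theorem InCone.lt_zero {w : Fin n → ℝ} (h : F.InCone ε w) (i : T)
    (hi : 0 < (ε (Sum.inl i) : ℤ) * F.yc (Sum.inl i) w) :
    F.pos i * F.xc i w ^ 2 < F.neg (Sum.inl i) * F.yc (Sum.inl i) w ^ 2 := by
  have h1 := mul_le_mul_of_nonneg_left (h.sq_le F ε i) (F.zero_lt_pos i).le
  have h0 : 0 < F.yc (Sum.inl i) w ^ 2 := by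
    rw [← sq_units (ε (Sum.inl i))]
    exact pow_pos hi 2
  have h2 := mul_lt_mul_of_pos_right (F.slope_lt i) h0
  linarith

theorem InCone.diagForm_neg {w : Fin n → ℝ} (h : F.InCone ε w) {a : T ⊕ U}
    (ha : 0 < (ε a : ℤ) * F.yc a w) : diagForm s w < 0 := by
  rw [F.diagForm_eq, Fintype.sum_sum_type, sub_add_eq_sub_sub, ← Finset.sum_sub_distrib]
  have h1 : ∀ i ∈ Finset.univ, F.pos i * F.xc i w ^ 2 -
      F.neg (Sum.inl i) * F.yc (Sum.inl i) w ^ 2 ≤ 0 :=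
    fun i _ => sub_nonpos.2 (h.le_zero F ε i)
  have h2 : ∀ u ∈ Finset.univ, 0 ≤ F.neg (Sum.inr u) * F.yc (Sum.inr u) w ^ 2 :=
    fun u _ => mul_nonneg (F.zero_lt_neg _).le (sq_nonneg _)
  rcases a with i | u
  · have := Finset.sum_neg' h1 ⟨i, Finset.mem_univ i, sub_neg.2 (h.lt_zero F ε i ha)⟩
    have := Finset.sum_nonneg h2
    linarith
  · have h0 : 0 < F.yc (Sum.inr u) w ^ 2 := by
      rw [← sq_units (ε (Sum.inr u))]
      exact pow_pos ha 2
    have := Finset.sum_nonpos h1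
    have := Finset.sum_pos' h2 ⟨u, Finset.mem_univ u, mul_pos (F.zero_lt_neg _) h0⟩
    linarith

omit [Fintype T] [Fintype U] in
theorem InCone.add_smul {w w' : Fin n → ℝ} (h : F.InCone ε w) (h' : F.InCone ε w') {c c' : ℝ}
    (hc : 0 ≤ c) (hc' : 0 ≤ c') : F.InCone ε (c • w + c' • w') := by
  refine ⟨fun i => ?_, fun a => ?_⟩
  · simp only [map_add, map_smul, smul_eq_mul]
    have h1 := mul_le_mul_of_nonneg_left (h.1 i) hc
    have h2 := mul_le_mul_of_nonneg_left (h'.1 i) hc'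
    have h3 := abs_add_le (c * F.xc i w) (c' * F.xc i w')
    rw [abs_mul, abs_mul, abs_of_nonneg hc, abs_of_nonneg hc'] at h3
    linarith
  · simp only [map_add, map_smul, smul_eq_mul]
    have h1 := mul_nonneg hc (h.2 a)
    have h2 := mul_nonneg hc' (h'.2 a)
    linarith

/-- The index of the sign of a vertex. -/
def idx : T ⊕ (T ⊕ U) → T ⊕ U := Sum.elim Sum.inl id

theorem units_mul_self (u : ℤˣ) : ((u : ℤ) : ℝ) * ((u : ℤ) : ℝ) = 1 := by
  rcases Int.units_eq_one_or u with rfl | rfl <;> simp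

theorem abs_units (u : ℤˣ) : |((u : ℤ) : ℝ)| = 1 := by
  rcases Int.units_eq_one_or u with rfl | rfl <;> simp

omit [Fintype T] [Fintype U] in
theorem yc_vert_of_ne {l : T ⊕ (T ⊕ U)} {b : T ⊕ U} (h : b ≠ idx l) :
    F.yc b (F.vert ε l) = 0 := by
  classical
  rcases l with i | a
  · have h : b ≠ Sum.inl i := h
    simp only [vert, Sum.elim_inl, map_zsmul, yc_P'_inl, if_neg h, smul_zero]
  · have h : b ≠ a := h
    simp only [vert, Sum.elim_inr, map_zsmul, yc_P, if_neg h, smul_zero]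

omit [Fintype T] [Fintype U] in
theorem yc_vert_inl (i : T) :
    (ε (Sum.inl i) : ℤ) * F.yc (Sum.inl i) (F.vert ε (Sum.inl i)) = F.y i := by
  classical
  simp only [vert, Sum.elim_inl, map_zsmul, yc_P'_inl, if_pos]
  rw [zsmul_eq_mul, ← mul_assoc, units_mul_self, one_mul]

omit [Fintype T] [Fintype U] in
theorem yc_vert_inr (a : T ⊕ U) : (ε a : ℤ) * F.yc a (F.vert ε (Sum.inr a)) = 1 := by
  classical
  simp only [vert, Sum.elim_inr, map_zsmul, yc_P, if_pos]
  rw [zsmul_eq_mul, ← mul_assoc, units_mul_self, one_mul]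

omit [Fintype T] [Fintype U] in
theorem yc_vert_pos (l : T ⊕ (T ⊕ U)) : 0 < (ε (idx l) : ℤ) * F.yc (idx l) (F.vert ε l) := by
  rcases l with i | a
  · exact (F.yc_vert_inl ε i).symm ▸ F.zero_lt_y i
  · exact (F.yc_vert_inr ε a).symm ▸ one_pos

omit [Fintype T] [Fintype U] in
theorem xc_vert_of_ne {l : T ⊕ (T ⊕ U)} {i : T} (h : Sum.inl i ≠ idx l) :
    F.xc i (F.vert ε l) = 0 := by
  classical
  rcases l with j | j | u
  · have h : i ≠ j := fun e => h (congrArg Sum.inl e)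
    simp only [vert, Sum.elim_inl, map_zsmul, xc_P'_inl, if_neg h, smul_zero]
  · have h : i ≠ j := fun e => h (congrArg Sum.inl e)
    simp only [vert, Sum.elim_inr, map_zsmul, xc_P_inl, if_neg h, smul_zero]
  · simp only [vert, Sum.elim_inr, map_zsmul, xc_P_inr, smul_zero]

omit [Fintype T] [Fintype U] in
theorem xc_vert_inl (i : T) :
    F.xc i (F.vert ε (Sum.inl i)) = (ε (Sum.inl i) : ℤ) * F.x i := by
  classical
  simp only [vert, Sum.elim_inl, map_zsmul, xc_P'_inl, if_pos]
  rw [zsmul_eq_mul]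

omit [Fintype T] [Fintype U] in
theorem xc_vert_inr (i : T) :
    F.xc i (F.vert ε (Sum.inr (Sum.inl i))) = (ε (Sum.inl i) : ℤ) * - F.θ i := by
  classical
  simp only [vert, Sum.elim_inr, map_zsmul, xc_P_inl, if_pos]
  rw [zsmul_eq_mul]

omit [Fintype T] [Fintype U] in
theorem inCone_vert (l : T ⊕ (T ⊕ U)) : F.InCone ε (F.vert ε l) := by
  refine ⟨fun i => ?_, fun a => ?_⟩
  · by_cases h : Sum.inl i = idx l
    · rcases l with j | j | u
      · obtain rfl := Sum.inl_injective h
        rw [xc_vert_inl, yc_vert_inl, abs_mul, abs_units, one_mul]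
        exact F.abs_x_le i
      · obtain rfl := Sum.inl_injective h
        rw [xc_vert_inr, yc_vert_inr, abs_mul, abs_units, one_mul, abs_neg, mul_one]
        exact F.abs_θ_le i
      · cases h
    · rw [F.xc_vert_of_ne ε h, F.yc_vert_of_ne ε h, abs_zero, mul_zero, mul_zero]
  · by_cases h : a = idx l
    · subst h
      exact (F.yc_vert_pos ε l).le
    · rw [F.yc_vert_of_ne ε h, mul_zero]

end TorusFrame

end OrderedChain

namespace OrderedChain

open ListCochain

section Dual
variable {n : ℕ} {ι : Type*}

theorem linearIndependent_of_dual {v : ι → (Fin n → ℝ)} (φ : ι → (Fin n → ℝ) →ₗ[ℝ] ℝ)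
    (h0 : ∀ i j, i ≠ j → φ i (v j) = 0) (h1 : ∀ i, φ i (v i) ≠ 0) : LinearIndependent ℝ v := by
  rw [linearIndependent_iff']
  intro t c hc i hi
  have h := congrArg (φ i) hc
  rw [map_sum, Finset.sum_eq_single_of_mem i hi, map_smul, map_zero, smul_eq_mul] at h
  · exact (mul_eq_zero.1 h).resolve_right (h1 i)
  · intro j _ hj
    rw [map_smul, h0 i j hj.symm, smul_zero]

theorem generic_range_of_dual [Fintype ι] {v : ι → (Fin n → ℝ)} (φ : ι → (Fin n → ℝ) →ₗ[ℝ] ℝ)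
    (h0 : ∀ i j, i ≠ j → φ i (v j) = 0) (h1 : ∀ i, φ i (v i) ≠ 0) (hn : Fintype.card ι = n)
    {X : Set (Fin n → ℝ)} (hX : ∀ w ∈ X, ∀ i, φ i w ≠ 0) : Generic X (Set.range v) := by
  classical
  intro A hA hAn w hw hmem
  have hinj : Function.Injective v := (linearIndependent_of_dual φ h0 h1).injective
  obtain ⟨i, hi⟩ : ∃ i, v i ∉ A := by
    by_contra! h
    have := Finset.card_le_card_of_injOn (s := Finset.univ) v (fun i _ => h i) hinj.injOn
    rw [Finset.card_univ, hn] at this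
    omega
  refine hX w hw i (LinearMap.mem_ker.1 ((Submodule.span_le (p := LinearMap.ker (φ i))).2 ?_ hmem))
  intro x hx
  obtain ⟨j, rfl⟩ := hA hx
  exact h0 i j fun e => hi (e ▸ hx)

end Dual

section Count
variable {n : ℕ}

theorem inOpenCone_comp_equiv {ι κ : Type*} [Fintype ι] [Fintype κ] (e : κ ≃ ι)
    (x : ι → (Fin n → ℝ)) (w : Fin n → ℝ) : InOpenCone (x ∘ e) w ↔ InOpenCone x w := by
  constructor
  · rintro ⟨c, hc, rfl⟩
    refine ⟨c ∘ e.symm, fun i => hc _, ?_⟩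
    rw [← e.sum_comp]
    simp
  · rintro ⟨c, hc, rfl⟩
    exact ⟨c ∘ e, fun i => hc _, Equiv.sum_comp e fun i => c i • x i⟩

theorem count_eq_zero_of_supported {X : Set (Fin n → ℝ)} {S : Set (List (Fin n → ℝ))}
    {z : Ch (Fin n → ℝ)} (hz : z ∈ Finsupp.supported ℤ ℤ S)
    (h : ∀ l ∈ S, ∀ w ∈ X, ¬ InOpenCone (vertices n l) w) : count X z = 0 := by
  rw [count, Finsupp.linearCombination_apply, Finsupp.sum]
  refine Finset.sum_eq_zero fun l hl => ?_
  rw [countList, finsum_mem_eq_zero_of_forall_eq_zero, smul_zero]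
  exact fun w hw => if_neg (h l ((Finsupp.mem_supported _ _).1 hz hl) w hw)

theorem countList_ne_zero {X : Set (Fin n → ℝ)} {l : List (Fin n → ℝ)}
    (hfin : {w ∈ X | InOpenCone (vertices n l) w}.Finite)
    (hl : LinearIndependent ℝ (vertices n l)) {v : Fin n → ℝ} (hv : v ∈ X)
    (hv' : InOpenCone (vertices n l) v) : countList X l ≠ 0 := by
  classical
  have hdet : (Matrix.of (vertices n l)).det ≠ 0 :=
    ((Matrix.isUnit_iff_isUnit_det _).1 (Matrix.linearIndependent_rows_iff_isUnit.1 hl)).ne_zero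
  rw [countList, finsum_mem_eq_sum_of_inter_support_eq (t := hfin.toFinset), Finset.sum_congr rfl
    fun w hw => show coneIndex w (vertices n l) = _ from if_pos (hfin.mem_toFinset.1 hw).2,
    Finset.sum_const, nsmul_eq_mul]
  · refine mul_ne_zero (Nat.cast_ne_zero.2 (Finset.card_ne_zero_of_mem (a := v) ?_)) ?_
    · exact hfin.mem_toFinset.2 ⟨hv, hv'⟩
    · rcases hdet.lt_or_gt with h | h
      · rw [sign_neg h]; decide
      · rw [sign_pos h]; decide
  · ext w
    simp only [Set.mem_inter_iff, Function.mem_support, Set.Finite.coe_toFinset, Set.mem_ofPred_eq]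
    refine ⟨fun h => ⟨⟨h.1, ?_⟩, h.2⟩, fun h => ⟨h.1.1, h.2⟩⟩
    by_contra hw
    exact h.2 (if_neg hw)

end Count

namespace TorusFrame

variable {n : ℕ} {s : Fin n → ℝ} {T U : Type} (F : TorusFrame s T U) (ε : T ⊕ U → ℤˣ)

/-- Up to scaling, the basis dual to the vertices. -/
def dual : T ⊕ (T ⊕ U) → (Fin n → ℝ) →ₗ[ℝ] ℝ
  | Sum.inl i => F.xc i + F.θ i • F.yc (Sum.inl i)
  | Sum.inr (Sum.inl i) => F.x i • F.yc (Sum.inl i) - F.y i • F.xc i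
  | Sum.inr (Sum.inr u) => F.yc (Sum.inr u)

theorem yc_vert_inl' (i : T) :
    F.yc (Sum.inl i) (F.vert ε (Sum.inl i)) = (ε (Sum.inl i) : ℤ) * F.y i := by
  rw [← F.yc_vert_inl ε, ← mul_assoc, units_mul_self, one_mul]

theorem yc_vert_inr' (a : T ⊕ U) : F.yc a (F.vert ε (Sum.inr a)) = (ε a : ℤ) := by
  rw [← mul_one ((ε a : ℤ) : ℝ), ← F.yc_vert_inr ε, ← mul_assoc, units_mul_self, one_mul]

theorem dual_vert_of_ne {l l' : T ⊕ (T ⊕ U)} (h : l ≠ l') : F.dual l (F.vert ε l') = 0 := by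
  by_cases hi : idx l = idx l'
  · rcases l with i | i | u <;> rcases l' with j | j | u'
    · exact absurd (congrArg Sum.inl (Sum.inl_injective hi)) h
    · obtain rfl := Sum.inl_injective hi
      simp only [dual, LinearMap.add_apply, LinearMap.smul_apply, xc_vert_inr, yc_vert_inr',
        smul_eq_mul]
      ring
    · cases hi
    · obtain rfl := Sum.inl_injective hi
      simp only [dual, LinearMap.sub_apply, LinearMap.smul_apply, xc_vert_inl, yc_vert_inl',
        smul_eq_mul]
      ring
    · exact absurd (congrArg Sum.inr hi) h
    · cases hi
    · cases hi
    · cases hi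
    · exact absurd (congrArg Sum.inr hi) h
  · rcases l with i | i | u
    · simp [dual, F.xc_vert_of_ne ε hi, F.yc_vert_of_ne (b := Sum.inl i) ε hi]
    · simp [dual, F.xc_vert_of_ne ε hi, F.yc_vert_of_ne (b := Sum.inl i) ε hi]
    · exact F.yc_vert_of_ne ε hi

theorem det_pos (i : T) : 0 < F.x i + F.θ i * F.y i :=
  add_pos (F.zero_lt_x i) (mul_pos (F.zero_lt_θ i) (F.zero_lt_y i))

theorem dual_vert_self (l : T ⊕ (T ⊕ U)) : F.dual l (F.vert ε l) ≠ 0 := by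
  have hu : ∀ a, ((ε a : ℤ) : ℝ) ≠ 0 := fun a => Int.cast_ne_zero.2 (ε a).ne_zero
  rcases l with i | i | u
  · simp only [dual, LinearMap.add_apply, LinearMap.smul_apply, xc_vert_inl, yc_vert_inl',
      smul_eq_mul]
    convert mul_ne_zero (hu (Sum.inl i)) (F.det_pos i).ne' using 1
    ring
  · simp only [dual, LinearMap.sub_apply, LinearMap.smul_apply, xc_vert_inr, yc_vert_inr',
      smul_eq_mul]
    convert mul_ne_zero (hu (Sum.inl i)) (F.det_pos i).ne' using 1
    ring
  · exact (F.yc_vert_inr' ε (Sum.inr u)).symm ▸ hu _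

theorem linearIndependent_vert : LinearIndependent ℝ (F.vert ε) :=
  linearIndependent_of_dual F.dual (fun _ _ h => F.dual_vert_of_ne ε h) (F.dual_vert_self ε)

variable [Fintype T] [Fintype U]

include F in
theorem card_labels : Fintype.card (T ⊕ (T ⊕ U)) = n := by
  rw [Fintype.card_congr F.coord, Fintype.card_fin]

theorem generic_vert {X : Set (Fin n → ℝ)} (hX : ∀ w ∈ X, ∀ l, F.dual l w ≠ 0) :
    Generic X (Set.range (F.vert ε)) :=
  generic_range_of_dual F.dual (fun _ _ h => F.dual_vert_of_ne ε h) (F.dual_vert_self ε)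
    F.card_labels hX

theorem neg_vert : Neg s (Set.range (F.vert ε)) := by
  intro w hw
  have hconv : Convex ℝ {w | F.InCone ε w ∧ 0 < ∑ a, (ε a : ℤ) * F.yc a w} := by
    intro v hv v' hv' c c' hc hc' hcc
    refine ⟨hv.1.add_smul F ε hv'.1 hc hc', ?_⟩
    have h : ∑ a, (ε a : ℤ) * F.yc a (c • v + c' • v') =
        c * ∑ a, (ε a : ℤ) * F.yc a v + c' * ∑ a, (ε a : ℤ) * F.yc a v' := by
      rw [Finset.mul_sum, Finset.mul_sum, ← Finset.sum_add_distrib]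
      refine Finset.sum_congr rfl fun a _ => ?_
      simp only [map_add, map_smul, smul_eq_mul]
      ring
    rw [h]
    rcases hc.eq_or_lt with rfl | hc
    · rw [zero_add] at hcc
      rw [hcc, zero_mul, zero_add, one_mul]
      exact hv'.2
    · exact add_pos_of_pos_of_nonneg (mul_pos hc hv.2) (mul_nonneg hc' hv'.2.le)
  have hsub : Set.range (F.vert ε) ⊆ {w | F.InCone ε w ∧ 0 < ∑ a, (ε a : ℤ) * F.yc a w} := by
    rintro _ ⟨l, rfl⟩
    exact ⟨F.inCone_vert ε l, Finset.sum_pos' (fun a _ => (F.inCone_vert ε l).2 a)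
      ⟨idx l, Finset.mem_univ _, F.yc_vert_pos ε l⟩⟩
  obtain ⟨h, hpos⟩ := convexHull_min hsub hconv hw
  obtain ⟨a, ha⟩ : ∃ a, 0 < (ε a : ℤ) * F.yc a w := by
    by_contra! h'
    exact hpos.not_ge (Finset.sum_nonpos fun a _ => h' a)
  exact h.diagForm_neg F ε ha

theorem inCone_sum {c : T ⊕ (T ⊕ U) → ℝ} (hc : ∀ l, 0 < c l) :
    F.InCone ε (∑ l, c l • F.vert ε l) := by
  have h0 : F.InCone ε 0 := ⟨fun i => by simp, fun a => by simp⟩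
  refine Finset.sum_induction _ (F.InCone ε) (fun v v' h h' => ?_) h0 fun l _ => ?_
  · simpa using h.add_smul F ε h' zero_le_one zero_le_one
  · simpa using (F.inCone_vert ε l).add_smul F ε h0 (hc l).le zero_le_one

theorem pos_of_inOpenCone {w : Fin n → ℝ} (h : InOpenCone (F.vert ε) w) (a : T ⊕ U) :
    0 < (ε a : ℤ) * F.yc a w := by
  obtain ⟨c, hc, rfl⟩ := h
  rw [map_sum, Finset.mul_sum]
  have h1 : ∀ l, (ε a : ℤ) * F.yc a (c l • F.vert ε l) =
      c l * ((ε a : ℤ) * F.yc a (F.vert ε l)) := fun l => by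
    rw [map_smul, smul_eq_mul]; ring
  simp only [h1]
  refine Finset.sum_pos' (fun l _ => mul_nonneg (hc l).le ((F.inCone_vert ε l).2 a))
    ⟨Sum.inr a, Finset.mem_univ _, mul_pos (hc _) (F.yc_vert_pos ε (Sum.inr a))⟩

theorem lt_of_inOpenCone {w : Fin n → ℝ} (h : InOpenCone (F.vert ε) w) (i : T) :
    F.pos i * F.xc i w ^ 2 < F.neg (Sum.inl i) * F.yc (Sum.inl i) w ^ 2 := by
  have hp := F.pos_of_inOpenCone ε h (Sum.inl i)
  obtain ⟨c, hc, rfl⟩ := h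
  exact (F.inCone_sum ε hc).lt_zero F ε i hp

theorem inOpenCone_one {v : Fin n → ℝ} (hx : ∀ i, F.xc i v = 0) (hy : ∀ a, F.yc a v = 1) :
    InOpenCone (F.vert 1) v := by
  classical
  refine ⟨fun l => F.dual l v / F.dual l (F.vert 1 l), fun l => ?_, ?_⟩
  · rcases l with i | i | u
    · simp only [dual, LinearMap.add_apply, LinearMap.smul_apply, xc_vert_inl, yc_vert_inl',
        smul_eq_mul, hx, hy, Pi.one_apply, Units.val_one, Int.cast_one]
      have := F.det_pos i
      have := F.zero_lt_θ i
      simp only [one_mul, zero_add, mul_one]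
      positivity
    · simp only [dual, LinearMap.sub_apply, LinearMap.smul_apply, xc_vert_inr, yc_vert_inr',
        smul_eq_mul, hx, hy, Pi.one_apply, Units.val_one, Int.cast_one]
      have h1 := F.det_pos i
      have := F.zero_lt_x i
      simp only [one_mul, mul_one, mul_zero, sub_zero, mul_neg, sub_neg_eq_add]
      rw [mul_comm (F.y i)]
      positivity
    · simp [dual, hy, yc_vert_inr']
  · have hspan := (F.linearIndependent_vert 1).span_eq_top_of_card_eq_finrank'
      (F.card_labels.trans (Module.finrank_fin_fun ℝ).symm)
    obtain ⟨d, rfl⟩ := (Submodule.mem_span_range_iff_exists_fun ℝ).1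
      (hspan ▸ Submodule.mem_top : v ∈ Submodule.span ℝ (Set.range (F.vert 1)))
    refine Finset.sum_congr rfl fun l _ => ?_
    beta_reduce
    rw [map_sum, Finset.sum_eq_single_of_mem l (Finset.mem_univ l), map_smul, smul_eq_mul,
      mul_div_cancel_right₀ _ (F.dual_vert_self 1 l)]
    intro l' _ hl'
    rw [map_smul, F.dual_vert_of_ne 1 hl'.symm, smul_zero]

/-- The position of a torus label among the vertices. -/
def conv : (T ⊕ U) ⊕ (T ⊕ U) → T ⊕ (T ⊕ U)
  | Sum.inl a => Sum.inr a
  | Sum.inr (Sum.inl i) => Sum.inl i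
  | Sum.inr (Sum.inr u) => Sum.inr (Sum.inr u)

omit [Fintype T] [Fintype U] in
theorem torusVertex_eq : torusVertex F.P F.P' ε = F.vert ε ∘ conv := by
  funext l
  rcases l with a | i | u <;> rfl

variable [DecidableEq T] [DecidableEq U] {X : Set (Fin n → ℝ)} {K J : List (T ⊕ U)} {q : ℕ}

theorem torusChain_mem (hX : ∀ w ∈ X, ∀ l, F.dual l w ≠ 0) (hK : K.Nodup) (hq : K.length = q)
    {l : List (T ⊕ U)} (hl : l.Sublist K) :
    torusChain F.P F.P' K l ∈ Cn (NegGen s X) (q + l.length) := by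
  obtain ⟨u, hu⟩ := torusChain_mem_supported (P := F.P) (P' := F.P') hK hl
  have hmem : ∀ ε : T ⊕ U → ℤˣ, ((torusLabels K l).map (torusVertex F.P F.P' ε)).length =
      q + l.length ∧ NegGen s X {x | x ∈ (torusLabels K l).map (torusVertex F.P F.P' ε)} := by
    intro ε
    refine ⟨by rw [List.length_map, length_torusLabels hK hl, hq],
      NegGen.downClosed s X ?_ ⟨F.neg_vert ε, F.generic_vert ε hX⟩⟩
    intro x hx
    obtain ⟨l', _, rfl⟩ := List.mem_map.1 hx
    exact ⟨conv l', by rw [torusVertex_eq]; rfl⟩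
  rw [← sub_add_cancel (torusChain F.P F.P' K l)]
  refine Submodule.add_mem _ (Finsupp.supported_mono ?_ hu)
    (single_mem_Cn' (hmem 1).1 (hmem 1).2 (u : ℤ))
  rintro _ ⟨ε, _, rfl⟩
  exact hmem ε

theorem exists_equiv_vertices (hK : K.Nodup) (hK' : ∀ a, a ∈ K) (hJK : J.Sublist K)
    (hJ : ∀ a, a ∈ J ↔ ∃ i, a = Sum.inl i) :
    ∃ e : Fin n ≃ T ⊕ (T ⊕ U), ∀ ε : T ⊕ U → ℤˣ,
      vertices n ((torusLabels K J).map (torusVertex F.P F.P' ε)) = F.vert ε ∘ e := by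
  have hnd : ((torusLabels K J).map conv).Nodup := by
    refine List.Nodup.map_on (fun x hx y hy h => ?_) (nodup_torusLabels hK hJK)
    rcases x with a | i | u <;> rcases y with b | j | u'
    · exact congrArg _ (Sum.inr_injective h)
    · cases h
    · obtain ⟨_, h⟩ := (hJ _).1 ((mem_torusLabels hK hJK _).2.1 hy)
      cases h
    · cases h
    · exact congrArg _ (congrArg _ (Sum.inl_injective h))
    · cases h
    · obtain ⟨_, h⟩ := (hJ _).1 ((mem_torusLabels hK hJK _).2.1 hx)
      cases h
    · cases h
    · obtain ⟨_, h⟩ := (hJ _).1 ((mem_torusLabels hK hJK _).2.1 hx)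
      cases h
  have hall : ∀ l, l ∈ (torusLabels K J).map conv := by
    rintro (i | a)
    · exact List.mem_map.2 ⟨Sum.inr (Sum.inl i),
        (mem_torusLabels hK hJK _).2.2 ((hJ _).2 ⟨i, rfl⟩), rfl⟩
    · exact List.mem_map.2 ⟨Sum.inl a, (mem_torusLabels hK hJK _).1.2 (hK' a), rfl⟩
  have hlen : ((torusLabels K J).map conv).length = n := by
    rw [← F.card_labels, ← Fintype.card_congr (hnd.getEquivOfForallMemList _ hall),
      Fintype.card_fin]
  refine ⟨(finCongr hlen.symm).trans (hnd.getEquivOfForallMemList _ hall), fun ε => ?_⟩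
  funext k
  have hk : (k : ℕ) < (torusLabels K J).length := by
    rw [← List.length_map (f := conv), hlen]; exact k.2
  simp [vertices, torusVertex_eq, hk]

theorem count_torusChain_eq_zero (hK : K.Nodup) (hK' : ∀ a, a ∈ K) (hJK : J.Sublist K)
    (hJ : ∀ a, a ∈ J ↔ ∃ i, a = Sum.inl i)
    (h : ∀ ε, ∀ w ∈ X, ¬ InOpenCone (F.vert ε) w) : count X (torusChain F.P F.P' K J) = 0 := by
  obtain ⟨e, he⟩ := F.exists_equiv_vertices hK hK' hJK hJ
  obtain ⟨u, hu⟩ := torusChain_mem_supported (P := F.P) (P' := F.P') hK hJK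
  have hs := Finsupp.single_mem_supported ℤ (u : ℤ)
    (Set.mem_singleton ((torusLabels K J).map (torusVertex F.P F.P' 1)))
  rw [← sub_add_cancel (torusChain F.P F.P' K J), map_add, count_eq_zero_of_supported hu,
    count_eq_zero_of_supported hs, add_zero]
  · rintro _ rfl w hw
    rw [he, inOpenCone_comp_equiv]
    exact h 1 w hw
  · rintro _ ⟨ε, _, rfl⟩ w hw
    rw [he, inOpenCone_comp_equiv]
    exact h ε w hw

theorem count_torusChain_ne_zero (hK : K.Nodup) (hK' : ∀ a, a ∈ K) (hJK : J.Sublist K)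
    (hJ : ∀ a, a ∈ J ↔ ∃ i, a = Sum.inl i) (hfin : FiniteInCones s X)
    (h : ∀ ε, ∀ w ∈ X, InOpenCone (F.vert ε) w → ε = 1) {v : Fin n → ℝ} (hv : v ∈ X)
    (hv' : InOpenCone (F.vert 1) v) : count X (torusChain F.P F.P' K J) ≠ 0 := by
  obtain ⟨e, he⟩ := F.exists_equiv_vertices hK hK' hJK hJ
  obtain ⟨u, hu⟩ := torusChain_mem_supported (P := F.P) (P' := F.P') hK hJK
  rw [← sub_add_cancel (torusChain F.P F.P' K J), map_add, count_eq_zero_of_supported hu,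
    zero_add, count_single]
  · refine mul_ne_zero u.ne_zero (countList_ne_zero (hfin _ ?_) ?_ hv ?_)
    · rw [he, e.surjective.range_comp]
      exact F.neg_vert 1
    · rw [he]
      exact (F.linearIndependent_vert 1).comp _ e.injective
    · rw [he, inOpenCone_comp_equiv]
      exact hv'
  · rintro _ ⟨ε, ⟨a, _, ha⟩, rfl⟩ w hw
    rw [he, inOpenCone_comp_equiv]
    intro h'
    rw [h ε w hw h'] at ha
    exact (show (1 : ℤˣ) ≠ -1 by decide) ha

end TorusFrame

end OrderedChain

namespace OrderedChain

open ListCochain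

theorem koszul_smul_pow {I M : Type*} [AddCommGroup M] (τ : I → Module.End ℤ M) {c : ℤ}
    (hc : c * c = 1) (E : List I → M) (l : List I) :
    koszul τ (fun m => c ^ m.length • E m) l = (c ^ l.length * c) • koszul τ E l := by
  induction l generalizing E with
  | nil => simp [koszul]
  | cons i l ih =>
    have h : koszul τ (fun m => c ^ (i :: m).length • E (i :: m)) l =
        c • koszul τ (fun m => c ^ m.length • E (i :: m)) l := by
      rw [show c • koszul τ (fun m => c ^ m.length • E (i :: m)) l = LinearMap.lsmul ℤ M c
        (koszul τ (fun m => c ^ m.length • E (i :: m)) l) from rfl,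
        ← koszul_comp τ τ (LinearMap.lsmul ℤ M c) _ _ (by simp)]
      simp only [List.length_cons, pow_succ', mul_smul, LinearMap.lsmul_apply]
    have hl : c ^ l.length = c ^ (i :: l).length * c := by
      rw [List.length_cons, pow_succ, mul_assoc, hc, mul_one]
    rw [koszul, koszul, h, ih fun m => E (i :: m), smul_sub, smul_sub, smul_smul, map_smul, hl,
      mul_comm c, mul_assoc, hc, mul_one]

namespace TorusFrame

variable {n p q N : ℕ} {s : Fin n → ℝ} {T U : Type} [Fintype T] [Fintype U] [DecidableEq T]
  [DecidableEq U]

omit [DecidableEq T] [DecidableEq U] in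
theorem card_neg (F : TorusFrame s T U) :
    Fintype.card {i // s i < 0} = Fintype.card (T ⊕ U) := by
  have hs : ∀ a, s (F.coord (Sum.inr a)) < 0 := fun a => by
    rw [F.s_neg]; exact neg_neg_of_pos (F.zero_lt_neg a)
  refine (Fintype.card_congr (Equiv.ofBijective
    (fun a => (⟨F.coord (Sum.inr a), hs a⟩ : {i // s i < 0})) ⟨?_, ?_⟩)).symm
  · intro a b h
    exact Sum.inr_injective (F.coord.injective (congrArg Subtype.val h))
  · rintro ⟨i, hi⟩
    obtain ⟨l, rfl⟩ := F.coord.surjective i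
    rcases l with i | a
    · rw [F.s_pos] at hi
      exact absurd hi (F.zero_lt_pos i).not_gt
    · exact ⟨a, rfl⟩

/-- A lower bound for the rank of the cohomology of a normal subgroup `Γ`, in terms of the
translates of a torus by the powers of an element `g`. -/
theorem le_rank (F : TorusFrame s T U) (hT : Fintype.card T = p) (hp : p ≠ 0) {H : Type} [Group H]
    (a : H →* ((Fin n → ℝ) ≃ₗ[ℝ] (Fin n → ℝ))) (haQ : ∀ h x, diagForm s (a h x) = diagForm s x)
    (hadet : ∀ h, LinearMap.det (a h : (Fin n → ℝ) →ₗ[ℝ] (Fin n → ℝ)) = 1)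
    {Γ Γ' : Subgroup H} [Γ.Normal] (hΓ : Γ ≤ Γ')
    (htriv : ∀ h ∈ Γ', ∀ z ∈ Cn (Neg s) (Fintype.card (T ⊕ U)), bd z = 0 →
      ∃ y ∈ Cn (Neg s) (Fintype.card (T ⊕ U) + 1), bd y = cmap (a h) z - z)
    {g : H} (hg : g ∈ Γ') {t : T → H} (ht : ∀ i, t i ∈ Γ) (htt : ∀ i j, t i * t j = t j * t i)
    (hτ : ∀ i, a (t i) (F.P (Sum.inl i)) = F.P' (Sum.inl i))
    (hfix : ∀ i j, Sum.inl i ≠ j → a (t i) (F.P j) = F.P j ∧ a (t i) (F.P' j) = F.P' j)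
    {X : Set (Fin n → ℝ)} (hX : ∀ k : ℤ, IsTarget s (a (g ^ k) '' X))
    (hΓX : ∀ h ∈ Γ, a h '' X = X)
    (hdual : ∀ k : ℤ, |k| < N → ∀ w ∈ X, ∀ l, F.dual l (a (g ^ k) w) ≠ 0)
    (hone : ∀ ε, ∀ w ∈ X, InOpenCone (F.vert ε) w → ε = 1) {v : Fin n → ℝ} (hv : v ∈ X)
    (hv' : InOpenCone (F.vert 1) v)
    (hzero : ∀ k : ℤ, k ≠ 0 → |k| < N → ∀ ε, ∀ w ∈ X, ¬ InOpenCone (F.vert ε) (a (g ^ k) w)) :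
    (N : Cardinal) ≤ Module.rank ℚ (groupCohomology (Rep.trivial ℚ Γ ℚ) p) := by
  have hΓn : Γ.Normal := inferInstance
  let J : List (T ⊕ U) := Finset.univ.toList.map Sum.inl
  let K : List (T ⊕ U) := J ++ Finset.univ.toList.map Sum.inr
  have hJK : J.Sublist K := List.sublist_append_left _ _
  have hJ : ∀ x, x ∈ J ↔ ∃ i, x = Sum.inl i := fun x => by simp [J, eq_comm]
  have hK' : ∀ x, x ∈ K := by rintro (x | x) <;> simp [J, K]
  have hK : K.Nodup := by
    refine List.Nodup.append (List.Nodup.map Sum.inl_injective (Finset.nodup_toList _))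
      (List.Nodup.map Sum.inr_injective (Finset.nodup_toList _)) fun x hx hx' => ?_
    obtain ⟨i, _, rfl⟩ := List.mem_map.1 hx
    simp at hx'
  have hJlen : J.length = p := by simp [J, hT]
  have hKlen : K.length = Fintype.card (T ⊕ U) := by simp [J, K]
  have hcoe : ∀ x y : H, (a x : (Fin n → ℝ) → _) ∘ a y = a (x * y) := fun x y => by
    rw [map_mul]; rfl
  have hpow : ∀ k k' : ℤ, a (g ^ k') '' X = a (g ^ k) '' (a (g ^ (k' - k)) '' X) := by
    intro k k'
    rw [← Set.image_comp, hcoe, ← _root_.zpow_add, add_sub_cancel]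
  have hsub : ∀ k k' : Fin N, |((k' : ℕ) : ℤ) - ((k : ℕ) : ℤ)| < N := by
    intro k k'
    have := k.2
    have := k'.2
    rw [abs_lt]
    omega
  let c : ℤ := (-1) ^ (K.length + 1)
  have hc : c * c = 1 := by rw [← pow_two, ← pow_mul, mul_comm, pow_mul]; simp
  let E₀ : List (T ⊕ U) → Ch (Fin n → ℝ) := fun l => c ^ l.length • torusChain F.P F.P' K l
  let τ : T ⊕ U → H := Sum.elim t 1
  have hτΓ : ∀ i, τ i ∈ Γ := by
    rintro (i | u)
    · exact ht i
    · exact Γ.one_mem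
  have hE₀bd : ∀ l : List (T ⊕ U), l.Sublist K →
      bd (E₀ l) = koszul (fun i => cmap (a (τ i))) E₀ l := by
    intro l hl
    have h := bd_torusChain (P := F.P) (P' := F.P')
      (τ := fun i => ((a (τ i)).toLinearMap.toAddMonoidHom)) ?_ ?_ hK hl
    · rw [koszul_smul_pow _ hc, map_smul, h, smul_smul]
      rfl
    · rintro (i | u)
      · exact hτ i
      · simp only [τ, Sum.elim_inr, Pi.one_apply, map_one]
        rfl
    · rintro (i | u) j hij
      · exact hfix i j hij
      · simp only [τ, Sum.elim_inr, Pi.one_apply, map_one]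
        exact ⟨rfl, rfl⟩
  have hsym : ∀ (k : Fin N) (h : Γ), IsSym s (a (g ^ ((k : ℕ) : ℤ)) '' X) (a h) := by
    refine fun k h => ⟨haQ _, hadet _, ?_⟩
    have h1 := hΓX _ (hΓn.conj_mem h h.2 (g ^ ((k : ℕ) : ℤ))⁻¹)
    rw [inv_inv] at h1
    conv_rhs => rw [← h1]
    rw [← Set.image_comp, ← Set.image_comp, hcoe, hcoe]
    congr 3
    group
  refine le_rank_of_count (q := Fintype.card (T ⊕ U)) hp ?_ F.card_neg (a.comp Γ.subtype)
    (fun k : Fin N => a (g ^ ((k : ℕ) : ℤ)) '' X) (fun k => hX _) hsym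
    (fun h => htriv h (hΓ h.2))
    (fun k i => ⟨g ^ ((k : ℕ) : ℤ) * τ i * (g ^ ((k : ℕ) : ℤ))⁻¹, hΓn.conj_mem _ (hτΓ i) _⟩)
    ?_ J hJlen (fun k l => cmap (a (g ^ ((k : ℕ) : ℤ))) (E₀ l)) ?_ ?_ ?_ ?_ ?_
  · rw [← F.card_labels, Fintype.card_sum (α := T) (β := T ⊕ U), hT, add_comm]
  · intro k i j
    have : τ i * τ j = τ j * τ i := by
      rcases i with i | u <;> rcases j with j | u' <;> simp [τ, htt]
    refine Subtype.ext ?_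
    simp only [Subgroup.coe_mul, conj_mul, this]
  · intro k k' l hl
    rw [hpow k k']
    refine cmap_mem (K := NegGen s (a (g ^ (((k' : ℕ) : ℤ) - ((k : ℕ) : ℤ))) '' X))
      (Submodule.smul_mem _ _ ?_) fun S hS => ⟨hS.1.image (haQ _), hS.2.image _⟩
    refine F.torusChain_mem ?_ hK hKlen (hl.trans hJK)
    rintro _ ⟨w, hw, rfl⟩
    exact hdual _ (hsub k k') w hw
  · intro k l hl
    rw [bd_cmap, hE₀bd l (hl.trans hJK)]
    refine (koszul_comp _ _ (cmap (a (g ^ ((k : ℕ) : ℤ)))) _ _ fun i _ x => ?_).symm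
    rw [cmap_cmap, cmap_cmap, hcoe]
    change _ = cmap ((a (g ^ ((k : ℕ) : ℤ) * τ i * (g ^ ((k : ℕ) : ℤ))⁻¹) : (Fin n → ℝ) → _) ∘ _) _
    rw [hcoe, inv_mul_cancel_right]
  · intro k k'
    have hE₀ : E₀ [] ∈ Cn (Neg s) (Fintype.card (T ⊕ U)) := mono_mem (K := NegGen s ∅)
      (Submodule.smul_mem _ _ (F.torusChain_mem (by simp) hK hKlen (List.nil_sublist _)))
      fun _ h => h.1
    have h0 := hE₀bd [] (List.nil_sublist _)
    obtain ⟨y, hy, hyk⟩ := htriv _ (Γ'.zpow_mem hg ((k : ℕ) : ℤ)) _ hE₀ h0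
    obtain ⟨y', hy', hyk'⟩ := htriv _ (Γ'.zpow_mem hg ((k' : ℕ) : ℤ)) _ hE₀ h0
    exact ⟨y - y', Submodule.sub_mem _ hy hy', by rw [map_sub, hyk, hyk', sub_sub_sub_cancel_right]⟩
  · intro k
    rw [count_cmap _ (hadet _), map_smul, smul_eq_mul]
    have hX0 := (hX 0).finite
    rw [zpow_zero, map_one, LinearEquiv.coe_one, Set.image_id] at hX0
    exact mul_ne_zero (pow_ne_zero _ (left_ne_zero_of_mul_eq_one hc))
      (F.count_torusChain_ne_zero hK hK' hJK hJ hX0 hone hv hv')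
  · intro k k' hkk
    rw [hpow k k', count_cmap _ (hadet _), map_smul,
      F.count_torusChain_eq_zero hK hK' hJK hJ, smul_zero]
    rintro ε _ ⟨w, hw, rfl⟩
    refine hzero _ ?_ (hsub k k') ε w hw
    rw [sub_ne_zero]
    exact fun h => hkk (Fin.ext (Int.natCast_inj.1 h.symm))

end TorusFrame

end OrderedChain

/-- Avoiding squares in a quadratic progression. -/
theorem exists_not_isSquare_mul (A : Finset ℤ) (hA : ∀ α ∈ A, 0 < α) {b b' : ℤ} (hb : 0 < b)
    (hb' : 0 < b') : ∃ t : ℤ, ∀ α ∈ A, ¬ IsSquare (α * (b + t ^ 2 * b')) := by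
  set P : ℤ := 2 * b * b' * ∏ α ∈ A, α with hP
  have hprod : 0 < ∏ α ∈ A, α := Finset.prod_pos hA
  have hP0 : 0 < P := by positivity
  have hPA : ∀ α ∈ A, α ∣ P := fun α hα => (Finset.dvd_prod_of_mem _ hα).mul_left _
  have hu : (1 + b * b' * P ^ 2).natAbs ≠ 1 := by
    have : 0 < b * b' * P ^ 2 := by positivity
    omega
  obtain ⟨l, hl, hlu⟩ := Int.exists_prime_and_dvd hu
  have hlP : ¬ l ∣ P := fun h => hl.not_dvd_one <|
    (Int.dvd_add_left ((h.pow two_ne_zero).mul_left (b * b'))).1 hlu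
  have key : ∃ m : ℤ, l ∣ 1 + b * b' * m ^ 2 ∧ ¬ l ^ 2 ∣ 1 + b * b' * m ^ 2 := by
    by_cases h : l ^ 2 ∣ 1 + b * b' * P ^ 2
    · refine ⟨P + l, ?_, fun h' => ?_⟩
      · have : 1 + b * b' * (P + l) ^ 2 = (1 + b * b' * P ^ 2) + l * (b * b' * (2 * P + l)) := by
          ring
        rw [this]
        exact hlu.add (dvd_mul_right _ _)
      · have : 1 + b * b' * (P + l) ^ 2 - (1 + b * b' * P ^ 2) - l ^ 2 * (b * b') =
          l * (2 * b * b' * P) := by ring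
        have h2 : l * l ∣ l * (2 * b * b' * P) := by
          rw [← this, ← sq]
          exact (h'.sub h).sub (dvd_mul_right _ _)
        have h3 := (mul_dvd_mul_iff_left hl.ne_zero).1 h2
        rcases hl.dvd_or_dvd h3 with h4 | h4
        · exact hlP (h4.trans (dvd_mul_right _ _))
        · exact hlP h4
    · exact ⟨P, hlu, h⟩
  obtain ⟨m, hm, hm'⟩ := key
  refine ⟨b * m, fun α hα ⟨c, hc⟩ => hm' ?_⟩
  have hc' : α * b * (1 + b * b' * m ^ 2) = c * c := by rw [← hc]; ring
  have hlc : l ∣ c := by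
    have : l ∣ c * c := hc' ▸ hm.mul_left _
    exact (hl.dvd_or_dvd this).elim id id
  have h2 : l ^ 2 ∣ α * b * (1 + b * b' * m ^ 2) := by
    rw [hc', sq]; exact mul_dvd_mul hlc hlc
  refine hl.pow_dvd_of_dvd_mul_left 2 (fun h => ?_) h2
  rcases hl.dvd_or_dvd h with h | h
  · exact hlP (h.trans (hPA α hα))
  · exact hlP (h.trans ⟨2 * b' * ∏ α ∈ A, α, by rw [hP]; ring⟩)

/-- A congruence that detects the positive solutions of a Pell equation. -/
theorem Pell.exists_forall_dvd_pos {D : ℤ} (hD : 9 ≤ D) (h : ¬ IsSquare D) :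
    ∃ m : ℤ, 0 < m ∧ ∀ x y : ℤ, x ^ 2 - D * y ^ 2 = 1 → m ∣ x - 1 → 0 < x := by
  obtain ⟨a, ha⟩ := Pell.IsFundamental.exists_of_not_isSquare (by omega) h
  have h4 : 4 ≤ a.x := by
    have h1 := a.prop
    have h2 := ha.2.1
    have h3 := ha.1
    nlinarith
  refine ⟨a.x - 1, by omega, fun x y hxy hm => ?_⟩
  obtain ⟨n, hn⟩ := ha.eq_zpow_or_neg_zpow (Pell.Solution₁.mk x y hxy)
  rcases hn with hn | hn
  · have := Pell.Solution₁.x_zpow_pos ha.x_pos n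
    rwa [← hn] at this
  · have hpow : ∀ n : ℕ, a.x - 1 ∣ (a ^ n).x - 1 ∧ a.x - 1 ∣ D * a.y * (a ^ n).y := by
      intro n
      induction n with
      | zero => simp
      | succ n ih =>
        obtain ⟨⟨c, hc⟩, d, hd⟩ := ih
        have h1 : D * (a.y * a.y) = (a.x - 1) * (a.x + 1) := by linear_combination -a.prop
        rw [pow_succ', Pell.Solution₁.x_mul, Pell.Solution₁.y_mul]
        refine ⟨⟨a.x * c + 1 + d, ?_⟩, a.x * d + (a.x + 1) * (a ^ n).x, ?_⟩
        · linear_combination a.x * hc + hd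
        · linear_combination a.x * hd + (a ^ n).x * h1
    have hx : (a ^ n).x = (a ^ n.natAbs).x := by
      rcases Int.natAbs_eq n with h | h
      · conv_lhs => rw [h, zpow_natCast]
      · conv_lhs => rw [h, _root_.zpow_neg, zpow_natCast, Pell.Solution₁.x_inv]
    have h1 : x = -(a ^ n.natAbs).x := by
      rw [← hx, ← Pell.Solution₁.x_neg, ← hn, Pell.Solution₁.x_mk]
    have h2 : a.x - 1 ∣ 2 := by
      have := dvd_neg.2 (hm.add (hpow n.natAbs).1)
      rwa [h1, show -(-(a ^ n.natAbs).x - 1 + ((a ^ n.natAbs).x - 1)) = 2 by ring] at this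
    have := Int.le_of_dvd two_pos h2
    omega

/-- Positive solutions of the Pell equation congruent to the trivial solution. -/
theorem Pell.exists_dvd_of_not_isSquare {D m : ℤ} (hD : 0 < D) (h : ¬ IsSquare D) (hm : m ≠ 0) :
    ∃ a : Pell.Solution₁ D, 0 < a.x ∧ 0 < a.y ∧ m ∣ a.x - 1 ∧ m ∣ a.y := by
  have h' : ¬ IsSquare (D * m ^ 2) := by
    rintro ⟨c, hc⟩
    obtain ⟨d, rfl⟩ : m ∣ c := by
      rw [← Int.pow_dvd_pow_iff two_ne_zero, sq c, ← hc]
      exact dvd_mul_left _ _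
    refine h ⟨d, mul_right_cancel₀ (pow_ne_zero 2 hm) (hc.trans (by ring))⟩
  obtain ⟨b, hb, hb'⟩ := Pell.Solution₁.exists_pos_of_not_isSquare (by positivity) h'
  have hp := b.prop
  refine ⟨Pell.Solution₁.mk (b.x ^ 2 + D * (|m| * b.y) ^ 2) (2 * b.x * (|m| * b.y)) ?_, ?_, ?_, ?_,
    ?_⟩
  · have := sq_abs m
    linear_combination (b.x ^ 2 - D * |m| ^ 2 * b.y ^ 2 + 1) * (hp - D * b.y ^ 2 * this)
  · rw [Pell.Solution₁.x_mk]; positivity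
  · rw [Pell.Solution₁.y_mk]; positivity
  · rw [Pell.Solution₁.x_mk, mul_pow, sq_abs]
    exact ⟨2 * D * m * b.y ^ 2, by linear_combination hp⟩
  · rw [Pell.Solution₁.y_mk]
    exact ((self_dvd_abs m).mul_right _).mul_left _

/-- An orthogonal family whose norms take both signs on prescribed index sets can be modified so
that no product of the negative of a negative norm with a positive norm is a square. -/
theorem LinearMap.BilinForm.exists_orthogonal_not_isSquare {ι M : Type*} [Fintype ι] [DecidableEq ι]
    [AddCommGroup M] (β : LinearMap.BilinForm ℤ M) (pos : ι → Prop)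
    (hneg : ∀ j, ¬ pos j → ∃ j', j' ≠ j ∧ ¬ pos j') (f : ι → M)
    (hf : ∀ i j, i ≠ j → β (f i) (f j) = 0) (hfp : ∀ i, pos i → 9 ≤ β (f i) (f i))
    (hfn : ∀ i, ¬ pos i → β (f i) (f i) ≤ -9) :
    ∃ f : ι → M, (∀ i j, i ≠ j → β (f i) (f j) = 0) ∧ (∀ i, pos i → 9 ≤ β (f i) (f i)) ∧
      (∀ i, ¬ pos i → β (f i) (f i) ≤ -9) ∧
      ∀ i j, pos i → ¬ pos j → ¬ IsSquare (-(β (f i) (f i) * β (f j) (f j))) := by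
  classical
  suffices h : ∀ s : Finset ι, ∃ f : ι → M, (∀ i j, i ≠ j → β (f i) (f j) = 0) ∧
      (∀ i, pos i → 9 ≤ β (f i) (f i)) ∧ (∀ i, ¬ pos i → β (f i) (f i) ≤ -9) ∧
      ∀ j ∈ s, ∀ i, pos i → ¬ pos j → ¬ IsSquare (-(β (f i) (f i) * β (f j) (f j))) by
    obtain ⟨f, h1, h2, h3, h4⟩ := h Finset.univ
    exact ⟨f, h1, h2, h3, fun i j => h4 j (Finset.mem_univ _) i⟩
  intro s
  induction s using Finset.induction_on with
  | empty => exact ⟨f, hf, hfp, hfn, by simp⟩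
  | insert j s _ ih =>
    obtain ⟨f, hf, hfp, hfn, hs⟩ := ih
    by_cases hj : pos j
    · refine ⟨f, hf, hfp, hfn, fun k hk i hi hk' => ?_⟩
      rcases Finset.mem_insert.1 hk with rfl | hk
      · exact absurd hj hk'
      · exact hs k hk i hi hk'
    obtain ⟨l, hlj, hl⟩ := hneg j hj
    have hbj := hfn j hj
    have hbl := hfn l hl
    obtain ⟨t, ht⟩ := exists_not_isSquare_mul
      ((Finset.univ.filter pos).image (fun i => β (f i) (f i)) ∪
        (Finset.univ.filter pos).image
          fun i => β (f i) (f i) * (β (f j) (f j) * β (f l) (f l)))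
      (b := -β (f j) (f j)) (b' := -β (f l) (f l)) (by
        intro α hα
        simp only [Finset.mem_union, Finset.mem_image, Finset.mem_filter, Finset.mem_univ,
          true_and] at hα
        rcases hα with ⟨i, hi, rfl⟩ | ⟨i, hi, rfl⟩
        · linarith [hfp i hi]
        · exact mul_pos (by linarith [hfp i hi])
            (mul_pos_of_neg_of_neg (by linarith) (by linarith))) (by linarith) (by linarith)
    have hfj : ∀ i, i ≠ j → β (f i) (f j) = 0 ∧ β (f j) (f i) = 0 := fun i hi =>
      ⟨hf _ _ hi, hf _ _ hi.symm⟩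
    have hfl : ∀ i, i ≠ l → β (f i) (f l) = 0 ∧ β (f l) (f i) = 0 := fun i hi =>
      ⟨hf _ _ hi, hf _ _ hi.symm⟩
    set u := f j + t • f l with hu
    set v := (t * β (f l) (f l)) • f j - β (f j) (f j) • f l with hv
    have huu : β u u = β (f j) (f j) + t ^ 2 * β (f l) (f l) := by
      simp [hu, (hfj l hlj).1, (hfj l hlj).2]; ring
    have hvv : β v v = β (f j) (f j) * β (f l) (f l) *
        (β (f j) (f j) + t ^ 2 * β (f l) (f l)) := by
      simp [hv, (hfj l hlj).1, (hfj l hlj).2]; ring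
    have huv : β u v = 0 := by
      simp [hu, hv, (hfj l hlj).1, (hfj l hlj).2]; ring
    have hvu : β v u = 0 := by
      simp [hu, hv, (hfj l hlj).1, (hfj l hlj).2]; ring
    have hiu : ∀ i, i ≠ j → i ≠ l → β (f i) u = 0 ∧ β u (f i) = 0 := fun i h1 h2 => by
      simp [hu, hfj i h1, hfl i h2]
    have hiv : ∀ i, i ≠ j → i ≠ l → β (f i) v = 0 ∧ β v (f i) = 0 := fun i h1 h2 => by
      simp [hv, hfj i h1, hfl i h2]
    have huu' : β u u ≤ -9 := by rw [huu]; nlinarith [sq_nonneg t]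
    set f' := Function.update (Function.update f j u) l v with hf'
    have hf'j : f' j = u := by simp [hf', hlj.symm]
    have hf'l : f' l = v := by simp [hf']
    have hf'i : ∀ i, i ≠ j → i ≠ l → f' i = f i := fun i h1 h2 => by simp [hf', h1, h2]
    have hf'p : ∀ i, pos i → f' i = f i := fun i hi =>
      hf'i i (fun h => hj (h ▸ hi)) (fun h => hl (h ▸ hi))
    refine ⟨f', ?_, fun i hi => by rw [hf'p i hi]; exact hfp i hi, ?_, ?_⟩
    · intro i k hik
      by_cases hi : i = j
      · subst hi
        rw [hf'j]
        by_cases hk : k = l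
        · rw [hk, hf'l, huv]
        · rw [hf'i k hik.symm hk, (hiu k hik.symm hk).2]
      by_cases hi' : i = l
      · subst hi'
        rw [hf'l]
        by_cases hk : k = j
        · rw [hk, hf'j, hvu]
        · rw [hf'i k hk hik.symm, (hiv k hk hik.symm).2]
      rw [hf'i i hi hi']
      by_cases hk : k = j
      · rw [hk, hf'j, (hiu i hi hi').1]
      by_cases hk' : k = l
      · rw [hk', hf'l, (hiv i hi hi').1]
      rw [hf'i k hk hk', hf _ _ hik]
    · intro i hi
      by_cases hi1 : i = j
      · rwa [hi1, hf'j]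
      by_cases hi2 : i = l
      · rw [hi2, hf'l, hvv, ← huu]
        nlinarith [mul_nonneg_of_nonpos_of_nonpos (a := β (f j) (f j) + 9)
          (b := β (f l) (f l) + 9) (by linarith) (by linarith)]
      · rw [hf'i i hi1 hi2]; exact hfn i hi
    · intro k hk i hi hk'
      rw [hf'p i hi]
      by_cases hk1 : k = j
      · have := ht (β (f i) (f i)) (by simpa using Or.inl ⟨i, hi, rfl⟩)
        rw [hk1, hf'j, huu]
        convert this using 2
        ring
      by_cases hk2 : k = l
      · have := ht (β (f i) (f i) * (β (f j) (f j) * β (f l) (f l)))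
          (Finset.mem_union_right _ (Finset.mem_image.2 ⟨i, by simpa using hi, rfl⟩))
        rw [hk2, hf'l, hvv]
        convert this using 2
        ring
      rw [hf'i k hk1 hk2]
      exact hs k ((Finset.mem_insert.1 hk).resolve_left hk1) i hi hk'

theorem Matrix.IsSymm.exists_int_diagonal {n : ℕ} {B : Matrix (Fin n) (Fin n) ℤ} (hB : B.IsSymm)
    (hdet : B.det ≠ 0) : ∃ (E : Matrix (Fin n) (Fin n) ℤ) (σ : Fin n → ℤ),
      Eᵀ * B * E = diagonal σ ∧ E.det ≠ 0 ∧ ∀ i, 9 ≤ |σ i| := by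
  let β : LinearMap.BilinForm ℚ (Fin n → ℚ) := Matrix.toBilin' (B.map (Int.cast : ℤ → ℚ))
  have hβ : LinearMap.IsSymm β := by
    refine ⟨fun x y => ?_⟩
    change β x y = β y x
    simp only [β, Matrix.toBilin'_apply]
    rw [Finset.sum_comm]
    refine Finset.sum_congr rfl fun i _ => Finset.sum_congr rfl fun j _ => ?_
    rw [Matrix.map_apply, Matrix.map_apply, hB.apply]
    ring
  have h2 : Invertible (2 : ℚ) := invertibleOfNonzero two_ne_zero
  obtain ⟨v, hv⟩ := LinearMap.BilinForm.exists_orthogonal_basis hβ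
  obtain ⟨d, hd⟩ := IsLocalization.exist_integer_multiples (nonZeroDivisors ℤ)
    (Finset.univ : Finset (Fin (Module.finrank ℚ (Fin n → ℚ)) × Fin n)) (fun k => v k.1 k.2)
  have hn : n = Module.finrank ℚ (Fin n → ℚ) := by simp
  have hd' : ∀ i j : Fin n, ∃ z : ℤ, (z : ℚ) = (d : ℤ) * v (Fin.cast hn j) i := fun i j => by
    obtain ⟨z, hz⟩ := hd (Fin.cast hn j, i) (Finset.mem_univ _)
    exact ⟨z, by simpa using hz⟩
  choose z hz using hd'
  let E : Matrix (Fin n) (Fin n) ℤ := Matrix.of fun i j => 3 * z i j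
  have hE : ∀ j, (fun i => (E i j : ℚ)) = ((3 : ℚ) * (d : ℤ)) • v (Fin.cast hn j) := fun j => by
    funext i
    simp [E, hz, mul_assoc]
  have hd0 : ((3 : ℚ) * (d : ℤ)) ≠ 0 := by
    simp
  have hEdet : E.det ≠ 0 := by
    intro h
    have h1 : (E.map (Int.castRingHom ℚ)).det = 0 := by
      rw [← RingHom.mapMatrix_apply, ← RingHom.map_det, h, map_zero]
    rw [← Matrix.det_transpose] at h1
    have h3 : LinearIndependent ℚ (E.map (Int.castRingHom ℚ))ᵀ.row := by
      have h4 : LinearIndependent ℚ (fun j : Fin n => v (Fin.cast hn j)) :=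
        v.linearIndependent.comp _ (Fin.cast_injective hn)
      have h5 := h4.units_smul (fun _ => Units.mk0 _ hd0)
      convert h5 using 1
      funext j
      exact hE j
    rw [Matrix.linearIndependent_rows_iff_isUnit, Matrix.isUnit_iff_isUnit_det, h1] at h3
    exact not_isUnit_zero h3
  have key : ∀ j k, ((Eᵀ * B * E) j k : ℚ) =
      β (fun i => (E i j : ℚ)) (fun i => (E i k : ℚ)) := fun j k => by
    simp only [β, Matrix.toBilin'_apply, Matrix.mul_apply, Matrix.transpose_apply, Matrix.map_apply,
      Finset.sum_mul]
    push_cast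
    rw [Finset.sum_comm]
  have hdiag : Eᵀ * B * E = diagonal fun j => (Eᵀ * B * E) j j := by
    ext j k
    by_cases hjk : j = k
    · rw [hjk, Matrix.diagonal_apply_eq]
    · rw [Matrix.diagonal_apply_ne _ hjk, ← Int.cast_inj (α := ℚ), key, hE, hE]
      have := hv (i := Fin.cast hn j) (j := Fin.cast hn k) (fun h => hjk (by simpa using h))
      rw [Function.onFun] at this
      simp [this]
  refine ⟨E, _, hdiag, hEdet, fun j => ?_⟩
  have h0 : (Eᵀ * B * E) j j ≠ 0 := by
    intro h
    have h1 := congrArg Matrix.det hdiag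
    rw [Matrix.det_mul, Matrix.det_mul, Matrix.det_transpose, Matrix.det_diagonal] at h1
    rw [Finset.prod_eq_zero (f := fun i => (Eᵀ * B * E) i i) (Finset.mem_univ j) h] at h1
    simp [hdet, hEdet] at h1
  have h9 : (9 : ℤ) ∣ (Eᵀ * B * E) j j := by
    rw [Matrix.mul_apply]
    refine Finset.dvd_sum fun i _ => ?_
    rw [Matrix.mul_apply, Finset.sum_mul]
    refine Finset.dvd_sum fun l _ => ?_
    exact ⟨z l j * B l i * z i j, by simp [E]; ring⟩
  exact Int.le_of_dvd (abs_pos.2 h0) ((dvd_abs _ _).2 h9)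

theorem Matrix.ncard_setOf_pos_eq {n : ℕ} {B : Matrix (Fin n) (Fin n) ℝ}
    {E S : Matrix (Fin n) (Fin n) ℝ} (hE : IsUnit E) (hS : IsUnit S) {σ τ : Fin n → ℝ}
    (h : Eᵀ * B * E = diagonal σ) (h' : Sᵀ * B * S = diagonal τ) :
    {i | 0 < σ i}.ncard = {i | 0 < τ i}.ncard := by
  have key : ∀ {E : Matrix (Fin n) (Fin n) ℝ} {σ : Fin n → ℝ}, IsUnit E →
      Eᵀ * B * E = diagonal σ → QuadraticMap.Equivalent B.toQuadraticForm'
        (QuadraticMap.weightedSumSquares ℝ σ) := by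
    intro E σ hE h
    refine QuadraticMap.Equivalent.symm ⟨⟨LinearEquiv.ofBijective E.mulVecLin ?_, fun m => ?_⟩⟩
    · exact ⟨Matrix.mulVec_injective_of_isUnit hE, Matrix.mulVec_surjective_iff_isUnit.2 hE⟩
    · change Matrix.toLinearMap₂' ℝ B (E *ᵥ m) (E *ᵥ m) = _
      rw [Matrix.toLinearMap₂'_apply', QuadraticMap.weightedSumSquares_apply,
        Matrix.mulVec_mulVec, Matrix.dotProduct_mulVec, ← Matrix.vecMul_transpose,
        Matrix.vecMul_vecMul, ← Matrix.mul_assoc, h, ← Matrix.dotProduct_mulVec]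
      refine Finset.sum_congr rfl fun i _ => ?_
      rw [Matrix.mulVec_diagonal, smul_eq_mul]
      ring
  rw [← QuadraticForm.sigPos_of_equiv_weightedSumSquares (key hE h),
    ← QuadraticForm.sigPos_of_equiv_weightedSumSquares (key hS h')]

theorem Matrix.exists_int_diagonal_not_isSquare {n p : ℕ} (hn : p + 2 ≤ n)
    {B : Matrix (Fin n) (Fin n) ℤ} (hB : B.IsSymm) (hdet : B.det ≠ 0)
    (hsig : ∃ S : Matrix (Fin n) (Fin n) ℝ, IsUnit S ∧
      Sᵀ * (B.map ((↑) : ℤ → ℝ)) * S =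
        Matrix.diagonal (fun i : Fin n => if (i : ℕ) < p then (1 : ℝ) else -1)) :
    ∃ (E : Matrix (Fin n) (Fin n) ℤ) (σ : Fin n → ℤ), Eᵀ * B * E = diagonal σ ∧ E.det ≠ 0 ∧
      (∀ i : Fin n, (i : ℕ) < p → 9 ≤ σ i) ∧ (∀ i : Fin n, ¬ (i : ℕ) < p → σ i ≤ -9) ∧
      ∀ i j : Fin n, (i : ℕ) < p → ¬ (j : ℕ) < p → ¬ IsSquare (-(σ i * σ j)) := by
  obtain ⟨E, σ, hE, hEdet, hσ⟩ := hB.exists_int_diagonal hdet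
  obtain ⟨S, hS, hSB⟩ := hsig
  have hcard : {i | 0 < σ i}.ncard = {i : Fin n | (i : ℕ) < p}.ncard := by
    have hEu : IsUnit (E.map (Int.cast : ℤ → ℝ)) := by
      rw [Matrix.isUnit_iff_isUnit_det, isUnit_iff_ne_zero]
      have : (E.map (Int.cast : ℤ → ℝ)).det = (E.det : ℝ) :=
        ((Int.castRingHom ℝ).map_det E).symm
      rw [this]
      exact_mod_cast hEdet
    have hE' : (E.map (Int.cast : ℤ → ℝ))ᵀ * B.map (Int.cast : ℤ → ℝ) * E.map (Int.cast : ℤ → ℝ) =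
        diagonal fun i => (σ i : ℝ) := by
      have := congrArg (Int.castRingHom ℝ).mapMatrix hE
      rw [map_mul, map_mul] at this
      simp only [RingHom.mapMatrix_apply, Int.coe_castRingHom] at this
      rw [Matrix.diagonal_map (by simp)] at this
      exact this
    have h := Matrix.ncard_setOf_pos_eq hEu hS hE' hSB
    convert h using 2
    · simp
    · ext i
      simp only [Set.mem_ofPred_eq]
      split_ifs with h <;> simp [h]
  have hcard' : Fintype.card {i : Fin n // (i : ℕ) < p} = Fintype.card {i // 0 < σ i} := by
    rw [← Nat.card_eq_fintype_card, ← Nat.card_eq_fintype_card]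
    exact hcard.symm
  let e := Fintype.equivOfCardEq hcard'
  let π : Equiv.Perm (Fin n) := e.extendSubtype
  have hπ : ∀ i : Fin n, (i : ℕ) < p → 0 < σ (π i) := fun i hi =>
    e.extendSubtype_mem i hi
  have hπ' : ∀ i : Fin n, ¬ (i : ℕ) < p → ¬ 0 < σ (π i) := fun i hi =>
    e.extendSubtype_not_mem i hi
  let β : LinearMap.BilinForm ℤ (Fin n → ℤ) := Matrix.toBilin' B
  have key : ∀ (f : Fin n → Fin n → ℤ) j k,
      ((Matrix.of fun i j => f j i)ᵀ * B * (Matrix.of fun i j => f j i)) j k = β (f j) (f k) := by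
    intro f j k
    simp only [β, Matrix.toBilin'_apply, Matrix.mul_apply, Matrix.transpose_apply, Finset.sum_mul,
      Matrix.of_apply]
    rw [Finset.sum_comm]
  have key₀ : ∀ j k, β (fun i => E i (π j)) (fun i => E i (π k)) = diagonal σ (π j) (π k) :=
    fun j k => by
      rw [← hE]
      exact (key (fun j i => E i j) (π j) (π k)).symm
  obtain ⟨f, h1, h2, h3, h4⟩ := LinearMap.BilinForm.exists_orthogonal_not_isSquare β
    (fun i : Fin n => (i : ℕ) < p) (fun j hj => by
      by_cases h : (j : ℕ) = p
      · exact ⟨⟨p + 1, by omega⟩, by simp [Fin.ext_iff]; omega, by simp⟩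
      · exact ⟨⟨p, by omega⟩, by simp [Fin.ext_iff]; omega, by simp⟩)
    (fun j i => E i (π j)) (fun i j hij => by
      rw [key₀, Matrix.diagonal_apply_ne _ (π.injective.ne hij)])
    (fun i hi => by
      rw [key₀, Matrix.diagonal_apply_eq]
      have := hσ (π i)
      rwa [abs_of_pos (hπ i hi)] at this)
    (fun i hi => by
      rw [key₀, Matrix.diagonal_apply_eq]
      have := hσ (π i)
      rw [abs_of_nonpos (not_lt.1 (hπ' i hi))] at this
      linarith)
  have hdiag : (Matrix.of fun i j => f j i)ᵀ * B * (Matrix.of fun i j => f j i) =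
      diagonal fun i => β (f i) (f i) := by
    ext j k
    rw [key]
    by_cases hjk : j = k
    · rw [hjk, Matrix.diagonal_apply_eq]
    · rw [Matrix.diagonal_apply_ne _ hjk, h1 _ _ hjk]
  refine ⟨_, _, hdiag, fun h => ?_, h2, h3, h4⟩
  have h5 := congrArg Matrix.det hdiag
  rw [Matrix.det_mul, h, mul_zero, Matrix.det_diagonal] at h5
  obtain ⟨i, -, hi⟩ := Finset.prod_eq_zero_iff.1 h5.symm
  by_cases hip : (i : ℕ) < p
  · linarith [h2 i hip]
  · linarith [h3 i hip]

namespace Matrix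

section Boost

variable {ι R : Type*} [DecidableEq ι] [CommRing R]

/-- The hyperbolic rotation by `(x, y)` in the coordinate plane `(i, o)`. -/
def boost (i o : ι) (a b x y : R) : Matrix ι ι R :=
  Matrix.of fun k => if k = i then Pi.single i y + Pi.single o (b * x) else
    if k = o then Pi.single i (a * x) + Pi.single o y else Pi.single k 1

variable {i o : ι}

theorem boost_mulVec [Fintype ι] (a b x y : R) (w : ι → R) (k : ι) :
    (boost i o a b x y *ᵥ w) k = if k = i then y * w i + b * x * w o else
      if k = o then a * x * w i + y * w o else w k := by
  have h : ∀ (c d : R), (Pi.single i c + Pi.single o d : ι → R) ⬝ᵥ w = c * w i + d * w o :=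
    fun c d => by rw [add_dotProduct, single_dotProduct, single_dotProduct]
  change (if k = i then Pi.single i y + Pi.single o (b * x) else
    if k = o then Pi.single i (a * x) + Pi.single o y else Pi.single k 1) ⬝ᵥ w = _
  split_ifs <;> simp only [h, single_dotProduct, one_mul]

theorem boost_mul [Fintype ι] (hio : i ≠ o) (a b x y x' y' : R) :
    boost i o a b x y * boost i o a b x' y' =
      boost i o a b (y * x' + x * y') (y * y' + a * b * (x * x')) := by
  refine Matrix.ext_of_mulVec_single fun l => ?_
  rw [← Matrix.mulVec_mulVec]
  ext k
  simp only [boost_mulVec, if_true, hio.symm, if_false]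
  split_ifs <;> ring

theorem boost_zero_one (a b : R) : boost i o a b 0 1 = 1 := by
  ext k l
  simp only [boost, of_apply, mul_zero, Pi.single_zero, zero_add, add_zero, Matrix.one_apply]
  split_ifs <;> simp_all [eq_comm]

theorem transpose_boost_mul_diagonal [Fintype ι] (hio : i ≠ o) {σ : ι → R} {a b : R} (ha : σ i = a)
    (hb : σ o = -b) (x y : R) :
    (boost i o a b x y)ᵀ * diagonal σ = diagonal σ * boost i o a b (-x) y := by
  ext k l
  rw [Matrix.mul_diagonal, Matrix.diagonal_mul]
  simp only [boost, Matrix.transpose_apply, Matrix.of_apply]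
  by_cases hk : k = i <;> by_cases hl : l = i <;> by_cases hk' : k = o <;> by_cases hl' : l = o <;>
    subst_vars <;> simp_all [Pi.single_apply, mul_comm, eq_comm]
  all_goals ring

theorem boost_commute [Fintype ι] {i' o' : ι} (h : i ≠ i') (h' : i ≠ o') (h'' : o ≠ i')
    (h''' : o ≠ o') (a b x y a' b' x' y' : R) :
    boost i o a b x y * boost i' o' a' b' x' y' = boost i' o' a' b' x' y' * boost i o a b x y := by
  refine Matrix.ext_of_mulVec_single fun l => ?_
  rw [← Matrix.mulVec_mulVec, ← Matrix.mulVec_mulVec]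
  ext k
  simp only [boost_mulVec, h, h', h'', h''', h.symm, h'.symm, h''.symm, h'''.symm, if_false]
  split_ifs <;> simp_all

theorem boost_map {S : Type*} [CommRing S] (f : R →+* S) (a b x y : R) :
    (boost i o a b x y).map f = boost i o (f a) (f b) (f x) (f y) := by
  ext k l
  simp only [boost, Matrix.map_apply, Matrix.of_apply]
  split_ifs <;> simp [Pi.single_apply, apply_ite f]

theorem dvd_boost_sub_one (m a b x y : R) (hx : m ∣ x) (hy : m ∣ y - 1) (k l : ι) :
    m ∣ (boost i o a b x y - 1) k l := by
  have h : (boost i o a b x y - 1) k l = if k = i then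
      (if l = i then y - 1 else 0) + (if l = o then b * x else 0) else if k = o then
      (if l = i then a * x else 0) + (if l = o then y - 1 else 0) else 0 := by
    rw [Matrix.sub_apply, Matrix.one_apply]
    simp only [boost, Matrix.of_apply]
    split_ifs <;> simp_all [Pi.single_apply, eq_comm]
    ring
  rw [h]
  have hx' := fun c : R => hx.mul_left c
  split_ifs <;> simp only [add_zero, zero_add, dvd_zero, hy, hx', dvd_add]

/-- Hyperbolic rotations with parameters the solutions of a Pell equation. -/
def boostGL {n : ℕ} {i o : Fin n} (hio : i ≠ o) (a b : ℤ) :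
    Pell.Solution₁ (a * b) →* GeneralLinearGroup (Fin n) ℤ :=
  MonoidHom.toHomUnits
    { toFun := fun s => boost i o a b s.y s.x
      map_one' := boost_zero_one a b
      map_mul' := fun s s' => by
        rw [boost_mul hio, Pell.Solution₁.x_mul, Pell.Solution₁.y_mul] }

theorem mul_right_cancel_of_det_ne_zero {n : ℕ} {E A C : Matrix (Fin n) (Fin n) ℤ}
    (hE : E.det ≠ 0) (h : A * E = C * E) : A = C := by
  have h1 := congrArg (· * E.adjugate) h
  simp only [Matrix.mul_assoc, Matrix.mul_adjugate, Matrix.mul_smul, Matrix.mul_one] at h1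
  exact smul_right_injective _ hE h1

end Boost

end Matrix

/-- Hyperbolic rotations close to the identity define elements of the orthogonal group. -/
theorem SOLam.exists_mul_eq_mul_boost {n : ℕ} {B E : Matrix (Fin n) (Fin n) ℤ} {σ : Fin n → ℤ}
    {i o : Fin n} {a b : ℤ} (hE : Eᵀ * B * E = diagonal σ) (hdet : E.det ≠ 0)
    (hio : i ≠ o) (ha : σ i = a) (hb : σ o = -b) (s : Pell.Solution₁ (a * b))
    (hx : E.det ∣ s.x - 1) (hy : E.det ∣ s.y) :
    ∃ h : SOLam n B, ((h : GeneralLinearGroup (Fin n) ℤ) : Matrix (Fin n) (Fin n) ℤ) * E =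
      E * boost i o a b (s ^ 2).y (s ^ 2).x := by
  have key : ∀ s : Pell.Solution₁ (a * b), E.det ∣ s.x - 1 → E.det ∣ s.y →
      ∃ C : Matrix (Fin n) (Fin n) ℤ, C * E = E * boost i o a b s.y s.x := by
    intro s hx hy
    have h1 := dvd_boost_sub_one (i := i) (o := o) E.det a b s.y s.x hy hx
    choose C hC using h1
    refine ⟨1 + E * Matrix.of C * E.adjugate, ?_⟩
    have h2 : boost i o a b s.y s.x = 1 + E.det • Matrix.of C := by
      rw [← sub_eq_iff_eq_add']
      ext k l
      rw [hC]; rfl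
    rw [h2, Matrix.add_mul, Matrix.mul_assoc, Matrix.adjugate_mul, Matrix.mul_add, Matrix.one_mul,
      Matrix.mul_one, Matrix.mul_smul, Matrix.mul_smul, Matrix.mul_one]
  obtain ⟨C, hC⟩ := key s hx hy
  obtain ⟨C', hC'⟩ := key s⁻¹ (by simpa using hx) (by simpa using hy)
  have hmul : ∀ {s s' : Pell.Solution₁ (a * b)} {C C' : Matrix (Fin n) (Fin n) ℤ},
      C * E = E * boost i o a b s.y s.x → C' * E = E * boost i o a b s'.y s'.x →
        (C * C') * E = E * boost i o a b (s * s').y (s * s').x := by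
    intro s s' C C' h h'
    rw [Matrix.mul_assoc, h', ← Matrix.mul_assoc, h, Matrix.mul_assoc, boost_mul hio,
      Pell.Solution₁.x_mul, Pell.Solution₁.y_mul]
  have hinv : C * C' = 1 := by
    refine mul_right_cancel_of_det_ne_zero hdet ?_
    rw [hmul hC hC', mul_inv_cancel, Pell.Solution₁.y_one, Pell.Solution₁.x_one, boost_zero_one,
      Matrix.mul_one, Matrix.one_mul]
  have hinv' : C' * C = 1 := mul_eq_one_comm.1 hinv
  let g : GeneralLinearGroup (Fin n) ℤ := ⟨C, C', hinv, hinv'⟩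
  have hB : Cᵀ * B * C = B := by
    have h1 : Eᵀ * ((Cᵀ * B * C) * E) = Eᵀ * (B * E) := by
      calc Eᵀ * ((Cᵀ * B * C) * E) = (C * E)ᵀ * B * (C * E) := by
            rw [Matrix.transpose_mul]; simp only [Matrix.mul_assoc]
        _ = (boost i o a b s.y s.x)ᵀ * (Eᵀ * B * E) * boost i o a b s.y s.x := by
            rw [hC, Matrix.transpose_mul]; simp only [Matrix.mul_assoc]
        _ = Eᵀ * (B * E) := by
            rw [hE, transpose_boost_mul_diagonal hio ha hb, Matrix.mul_assoc, boost_mul hio,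
              show s.x * s.y + -s.y * s.x = 0 by ring,
              show s.x * s.x + a * b * (-s.y * s.y) = 1 by linear_combination s.prop,
              boost_zero_one, Matrix.mul_one, ← hE, Matrix.mul_assoc]
    have h2 := congrArg Matrix.transpose h1
    rw [Matrix.transpose_mul, Matrix.transpose_mul Eᵀ, Matrix.transpose_transpose] at h2
    have h3 := Matrix.transpose_injective (mul_right_cancel_of_det_ne_zero hdet h2)
    exact mul_right_cancel_of_det_ne_zero hdet h3
  have hdet1 : C.det * C.det = 1 := by
    have h1 : C.det * C'.det = 1 := by rw [← Matrix.det_mul, hinv, Matrix.det_one]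
    rcases Int.isUnit_iff.1 (IsUnit.of_mul_eq_one _ h1) with h | h <;> rw [h] <;> norm_num
  refine ⟨⟨g * g, ?_, ?_⟩, ?_⟩
  · change (C * C)ᵀ * B * (C * C) = B
    rw [Matrix.transpose_mul]
    calc Cᵀ * Cᵀ * B * (C * C) = Cᵀ * (Cᵀ * B * C) * C := by simp only [Matrix.mul_assoc]
      _ = B := by rw [hB, hB]
  · change (C * C).det = 1
    rw [Matrix.det_mul, hdet1]
  · change (C * C) * E = _
    rw [hmul hC hC, ← sq]

open OrderedChain

section FrameRep

variable {n : ℕ} {B E : Matrix (Fin n) (Fin n) ℤ}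

theorem Matrix.det_map_intCast_ne_zero (hdet : E.det ≠ 0) :
    (E.map (Int.castRingHom ℝ)).det ≠ 0 := by
  rw [← RingHom.mapMatrix_apply, ← RingHom.map_det]
  simpa using hdet

/-- The action of integral matrices on real vectors, in the coordinates given by `E`. -/
noncomputable def frameRep (hdet : E.det ≠ 0) :
    GeneralLinearGroup (Fin n) ℤ →* ((Fin n → ℝ) ≃ₗ[ℝ] (Fin n → ℝ)) :=
  (LinearMap.GeneralLinearGroup.generalLinearEquiv ℝ (Fin n → ℝ)).toMonoidHom.comp <|
    (GeneralLinearGroup.toLin (n := Fin n) (R := ℝ)).toMonoidHom.comp <|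
    (MulAut.conj (GeneralLinearGroup.mkOfDetNeZero _
      (det_map_intCast_ne_zero hdet))⁻¹).toMonoidHom.comp <|
    GeneralLinearGroup.map (Int.castRingHom ℝ)

theorem mulVec_frameRep (hdet : E.det ≠ 0) (h : GeneralLinearGroup (Fin n) ℤ) (w : Fin n → ℝ) :
    E.map (Int.castRingHom ℝ) *ᵥ frameRep hdet h w =
      (h : Matrix (Fin n) (Fin n) ℤ).map (Int.castRingHom ℝ) *ᵥ
        (E.map (Int.castRingHom ℝ) *ᵥ w) := by
  set e := GeneralLinearGroup.mkOfDetNeZero _ (det_map_intCast_ne_zero hdet)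
  have h1 : frameRep hdet h w =
      ((e⁻¹ * GeneralLinearGroup.map (Int.castRingHom ℝ) h * e : GeneralLinearGroup (Fin n) ℝ) :
        Matrix (Fin n) (Fin n) ℝ) *ᵥ w := by
    have : e = e⁻¹⁻¹ := (inv_inv e).symm
    conv_rhs => rw [this]
    rfl
  rw [h1, mulVec_mulVec, mulVec_mulVec]
  have h2 : E.map (Int.castRingHom ℝ) = (e : Matrix (Fin n) (Fin n) ℝ) := rfl
  have h3 : (h : Matrix (Fin n) (Fin n) ℤ).map (Int.castRingHom ℝ) =
      (GeneralLinearGroup.map (Int.castRingHom ℝ) h : GeneralLinearGroup (Fin n) ℝ) := rfl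
  rw [h2, h3, ← Units.val_mul, ← Units.val_mul]
  congr 2
  group

theorem mulVec_injective_of_frame (hdet : E.det ≠ 0) :
    Function.Injective (E.map (Int.castRingHom ℝ) *ᵥ · : (Fin n → ℝ) → Fin n → ℝ) :=
  mulVec_injective_of_det_ne_zero (det_map_intCast_ne_zero hdet)

theorem diagForm_eq_of_frame {σ : Fin n → ℤ} (hE : Eᵀ * B * E = diagonal σ) (w : Fin n → ℝ) :
    diagForm (fun i => (σ i : ℝ)) w = (E.map (Int.castRingHom ℝ) *ᵥ w) ⬝ᵥ
      (B.map (Int.castRingHom ℝ) *ᵥ (E.map (Int.castRingHom ℝ) *ᵥ w)) := by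
  have h := congrArg (Int.castRingHom ℝ).mapMatrix hE
  rw [map_mul, map_mul] at h
  simp only [RingHom.mapMatrix_apply] at h
  rw [Matrix.diagonal_map (map_zero _), Matrix.transpose_map] at h
  rw [mulVec_mulVec, dotProduct_mulVec, ← vecMul_transpose, vecMul_vecMul, ← Matrix.mul_assoc, h,
    ← dotProduct_mulVec]
  refine Finset.sum_congr rfl fun i _ => ?_
  rw [mulVec_diagonal]
  simp only [eq_intCast]
  ring

theorem diagForm_frameRep {σ : Fin n → ℤ} (hE : Eᵀ * B * E = diagonal σ) (hdet : E.det ≠ 0)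
    {h : GeneralLinearGroup (Fin n) ℤ} (hh : h ∈ SOLam n B) (w : Fin n → ℝ) :
    diagForm (fun i => (σ i : ℝ)) (frameRep hdet h w) = diagForm (fun i => (σ i : ℝ)) w := by
  rw [diagForm_eq_of_frame hE, diagForm_eq_of_frame hE, mulVec_frameRep]
  have h1 := congrArg (Int.castRingHom ℝ).mapMatrix hh.1
  rw [map_mul, map_mul] at h1
  simp only [RingHom.mapMatrix_apply] at h1
  rw [Matrix.transpose_map] at h1
  conv_rhs => rw [← h1]
  generalize E.map (Int.castRingHom ℝ) *ᵥ w = u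
  rw [mulVec_mulVec, dotProduct_mulVec, ← vecMul_transpose, vecMul_vecMul, ← Matrix.mul_assoc,
    ← dotProduct_mulVec]

theorem det_frameRep (hdet : E.det ≠ 0) {h : GeneralLinearGroup (Fin n) ℤ}
    (hh : h ∈ SOLam n B) :
    LinearMap.det (frameRep hdet h : (Fin n → ℝ) →ₗ[ℝ] (Fin n → ℝ)) = 1 := by
  set M := LinearMap.toMatrix' (frameRep hdet h : (Fin n → ℝ) →ₗ[ℝ] (Fin n → ℝ)) with hM
  have h1 : E.map (Int.castRingHom ℝ) * M =
      (h : Matrix (Fin n) (Fin n) ℤ).map (Int.castRingHom ℝ) * E.map (Int.castRingHom ℝ) := by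
    refine ext_of_mulVec_single fun i => ?_
    rw [← mulVec_mulVec, ← mulVec_mulVec, ← mulVec_frameRep hdet, hM, LinearMap.toMatrix'_mulVec]
    rfl
  have h2 := congrArg Matrix.det h1
  rw [det_mul, det_mul, mul_comm] at h2
  have h3 := mul_right_cancel₀ (det_map_intCast_ne_zero hdet) h2
  rw [hM, LinearMap.det_toMatrix'] at h3
  rw [h3, ← RingHom.mapMatrix_apply, ← RingHom.map_det, hh.2, map_one]

theorem frameRep_zpow_eq_boost (hdet : E.det ≠ 0) {i o : Fin n} (hio : i ≠ o) {a b : ℤ}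
    {s : Pell.Solution₁ (a * b)} {h : GeneralLinearGroup (Fin n) ℤ}
    (hh : (h : Matrix (Fin n) (Fin n) ℤ) * E = E * boost i o a b s.y s.x) (k : ℤ) (w : Fin n → ℝ) :
    frameRep hdet (h ^ k) w = boost i o (a : ℝ) b ((s ^ k).y : ℤ) ((s ^ k).x : ℤ) *ᵥ w := by
  have h1 : ∀ w, frameRep hdet h w =
      (GeneralLinearGroup.map (Int.castRingHom ℝ) (boostGL hio a b s) :
        Matrix (Fin n) (Fin n) ℝ) *ᵥ w := by
    intro w
    refine mulVec_injective_of_frame hdet ?_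
    simp only
    rw [mulVec_frameRep, mulVec_mulVec, mulVec_mulVec, ← Matrix.map_mul, hh, Matrix.map_mul]
    rfl
  have h2 : frameRep hdet h = LinearMap.GeneralLinearGroup.generalLinearEquiv ℝ (Fin n → ℝ)
      (GeneralLinearGroup.toLin (GeneralLinearGroup.map (Int.castRingHom ℝ)
        (boostGL hio a b s))) := by
    ext1 w
    rw [h1]
    rfl
  rw [map_zpow, h2, ← map_zpow, ← map_zpow, ← map_zpow, ← map_zpow]
  change (boost i o a b (s ^ k).y (s ^ k).x).map (Int.castRingHom ℝ) *ᵥ w = _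
  rw [boost_map]
  rfl

/-- Principal congruence subgroups. -/
theorem exists_normal_finiteIndex_congr (H : Subgroup (GeneralLinearGroup (Fin n) ℤ)) {m : ℤ}
    (hm : m ≠ 0) : ∃ Γ : Subgroup H, Γ.Normal ∧ Γ.FiniteIndex ∧ ∀ h ∈ Γ,
      ∃ C : Matrix (Fin n) (Fin n) ℤ,
        ((h : GeneralLinearGroup (Fin n) ℤ) : Matrix (Fin n) (Fin n) ℤ) = 1 + m • C := by
  have : NeZero m.natAbs := ⟨Int.natAbs_ne_zero.2 hm⟩
  let φ : H →* GeneralLinearGroup (Fin n) (ZMod m.natAbs) :=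
    (GeneralLinearGroup.map (Int.castRingHom (ZMod m.natAbs))).comp H.subtype
  refine ⟨φ.ker, inferInstance, Subgroup.finiteIndex_ker φ, fun h hh => ?_⟩
  have h1 : ((h : GeneralLinearGroup (Fin n) ℤ) : Matrix (Fin n) (Fin n) ℤ).map
      (Int.castRingHom (ZMod m.natAbs)) = 1 :=
    congrArg Units.val (MonoidHom.mem_ker.1 hh)
  have h2 : ∀ k l, m ∣ ((h : GeneralLinearGroup (Fin n) ℤ) : Matrix (Fin n) (Fin n) ℤ) k l -
      (1 : Matrix (Fin n) (Fin n) ℤ) k l := by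
    intro k l
    rw [← Int.natAbs_dvd, ← ZMod.intCast_zmod_eq_zero_iff_dvd]
    have h3 := congrFun (congrFun h1 k) l
    rw [Matrix.map_apply, eq_intCast] at h3
    rw [Int.cast_sub, h3, sub_eq_zero, Matrix.one_apply, Matrix.one_apply]
    split_ifs <;> simp
  choose C hC using h2
  exact ⟨Matrix.of C, by ext k l; simp [← hC]⟩

end FrameRep

/-- The solutions of a Pell equation whose second component is divisible by `m`. -/
def Pell.Solution₁.dvdSubgroup (D m : ℤ) : Subgroup (Pell.Solution₁ D) where
  carrier := {s | m ∣ s.y}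
  one_mem' := by simp
  mul_mem' {s t} hs ht := by
    change m ∣ (s * t).y
    rw [Pell.Solution₁.y_mul]
    exact (Dvd.dvd.mul_left ht _).add (Dvd.dvd.mul_right hs _)
  inv_mem' {s} hs := by
    change m ∣ s⁻¹.y
    rw [Pell.Solution₁.y_inv]
    exact dvd_neg.2 hs

theorem Pell.Solution₁.dvd_y_zpow {D m : ℤ} {s : Pell.Solution₁ D} (hs : m ∣ s.y) (k : ℤ) :
    m ∣ (s ^ k).y :=
  (dvdSubgroup D m).zpow_mem (x := s) hs k

theorem Pell.Solution₁.y_zpow_ne_zero {D : ℤ} {s : Pell.Solution₁ D} (hx : 0 < s.x) (hy : 0 < s.y)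
    {k : ℤ} (hk : k ≠ 0) : (s ^ k).y ≠ 0 := by
  have h := Pell.Solution₁.sign_y_zpow_eq_sign_of_x_pos_of_y_pos hx hy k
  intro h0
  rw [h0, Int.sign_zero] at h
  exact hk (Int.sign_eq_zero_iff_zero.1 h.symm)

/-- Finite-index subgroups contain hyperbolic rotations in the coordinate planes. -/
theorem SOLam.exists_mem_mul_eq_mul_boost {n : ℕ} {B E : Matrix (Fin n) (Fin n) ℤ} {σ : Fin n → ℤ}
    {i o : Fin n} {a b : ℤ} (hE : Eᵀ * B * E = diagonal σ) (hdet : E.det ≠ 0) (hio : i ≠ o)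
    (ha : σ i = a) (hb : σ o = -b) (hab : 0 < a * b) (hsq : ¬ IsSquare (a * b))
    (Γ : Subgroup (SOLam n B)) [Γ.FiniteIndex] {m : ℤ} (hm : m ≠ 0) :
    ∃ h ∈ Γ, ∃ s : Pell.Solution₁ (a * b), 0 < s.x ∧ 0 < s.y ∧ m ∣ s.y ∧
      ((h : GeneralLinearGroup (Fin n) ℤ) : Matrix (Fin n) (Fin n) ℤ) * E =
        E * boost i o a b s.y s.x := by
  obtain ⟨s, hx, hy, hx1, hy1⟩ :=
    Pell.exists_dvd_of_not_isSquare hab hsq (mul_ne_zero hdet hm)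
  obtain ⟨h, hh⟩ := SOLam.exists_mul_eq_mul_boost hE hdet hio ha hb s
    ((dvd_mul_right _ _).trans hx1) ((dvd_mul_right _ _).trans hy1)
  obtain ⟨e, he, -, hmem⟩ := Subgroup.exists_pow_mem_of_index_ne_zero
    (H := Γ) Subgroup.FiniteIndex.index_ne_zero h
  have hpow : ∀ e : ℕ, (((h ^ e : SOLam n B) : GeneralLinearGroup (Fin n) ℤ) :
      Matrix (Fin n) (Fin n) ℤ) * E = E * boost i o a b ((s ^ 2) ^ e).y ((s ^ 2) ^ e).x := by
    intro e
    induction e with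
    | zero => simp [boost_zero_one]
    | succ e ih =>
      rw [pow_succ (s ^ 2), Pell.Solution₁.x_mul, Pell.Solution₁.y_mul, ← boost_mul hio,
        ← Matrix.mul_assoc, ← ih, Matrix.mul_assoc, ← hh, ← Matrix.mul_assoc, pow_succ]
      rfl
  refine ⟨h ^ e, hmem, (s ^ 2) ^ e, Pell.Solution₁.x_pow_pos (Pell.Solution₁.x_pow_pos hx _) _,
    ?_, ?_, hpow e⟩
  · obtain ⟨e, rfl⟩ := Nat.exists_eq_succ_of_ne_zero he.ne'
    exact Pell.Solution₁.y_pow_succ_pos (Pell.Solution₁.x_pow_pos hx _)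
      (Pell.Solution₁.y_pow_succ_pos hx hy 1) e
  · rw [← pow_mul, ← zpow_natCast]
    exact Pell.Solution₁.dvd_y_zpow ((dvd_mul_left _ _).trans hy1) _

theorem exists_irrational_slope {a b x y : ℝ} (ha : 0 < a) (hb : 0 < b) (hx : 0 < x) (hy : 0 < y)
    (h : y ^ 2 - a * b * x ^ 2 = 1) : ∃ θ m : ℝ, Irrational θ ∧ 0 < θ ∧ θ ≤ m ∧
      0 < b * x - y * θ ∧ 0 < y - a * x * θ ∧ b * x - y * θ ≤ m * (y - a * x * θ) ∧
      a * m ^ 2 < b := by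
  obtain ⟨θ, hθ, hθ0, hθ1⟩ := exists_irrational_btwn (show (0 : ℝ) < b * x / y by positivity)
  rw [lt_div_iff₀ hy] at hθ1
  have h1 : 0 < b * x - y * θ := by linarith
  have h2 : 0 < y - a * x * θ := by
    have : 0 < y * (y - a * x * θ) := by nlinarith [mul_pos (mul_pos ha hx) h1]
    exact pos_of_mul_pos_right this hy.le
  have h3 : a * θ ^ 2 < b := by
    have h4 : (θ * y) ^ 2 < (b * x) ^ 2 := by gcongr
    have h5 : 0 < y ^ 2 * (b - a * θ ^ 2) := by nlinarith
    nlinarith [pos_of_mul_pos_right h5 (by positivity)]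
  refine ⟨θ, max θ ((b * x - y * θ) / (y - a * x * θ)), hθ, hθ0, le_max_left _ _, h1, h2, ?_, ?_⟩
  · rw [← div_le_iff₀ h2]; exact le_max_right _ _
  · rcases max_choice θ ((b * x - y * θ) / (y - a * x * θ)) with h4 | h4 <;> rw [h4]
    · exact h3
    · rw [div_pow, ← mul_div_assoc, div_lt_iff₀ (by positivity)]
      have : a * (b * x - y * θ) ^ 2 - b * (y - a * x * θ) ^ 2 = a * θ ^ 2 - b := by
        linear_combination (a * θ ^ 2 - b) * h
      linarith

/-- Values congruent modulo a large integer are equal. -/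
theorem Int.eq_of_dvd_sub_of_abs_lt {M x y : ℤ} (h : M ∣ x - y) (h' : |x - y| < M) : x = y :=
  sub_eq_zero.1 (Int.eq_zero_of_abs_lt_dvd h h')

section Planes

variable {T U : Type} [Fintype T] [Fintype U] {a x : T → ℤ} {b y : T ⊕ U → ℤ}

theorem neg_sum_le_plane (hb : ∀ j, 0 < b j)
    (hsum : ∑ i, a i * x i ^ 2 - ∑ j, b j * y j ^ 2 = -∑ j, b j)
    (hlt : ∀ i, a i * x i ^ 2 < b (Sum.inl i) * y (Sum.inl i) ^ 2) (i : T) :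
    -∑ j, b j ≤ a i * x i ^ 2 - b (Sum.inl i) * y (Sum.inl i) ^ 2 := by
  rw [← hsum, Fintype.sum_sum_type, ← sub_sub, ← Finset.sum_sub_distrib]
  have h1 : ∑ i, (a i * x i ^ 2 - b (Sum.inl i) * y (Sum.inl i) ^ 2) ≤
      a i * x i ^ 2 - b (Sum.inl i) * y (Sum.inl i) ^ 2 := by
    rw [← neg_le_neg_iff, ← Finset.sum_neg_distrib]
    exact Finset.single_le_sum
      (f := fun i => -(a i * x i ^ 2 - b (Sum.inl i) * y (Sum.inl i) ^ 2))
      (fun i _ => by linarith [hlt i]) (Finset.mem_univ i)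
  have h2 : 0 ≤ ∑ u, b (Sum.inr u) * y (Sum.inr u) ^ 2 :=
    Finset.sum_nonneg fun u _ => mul_nonneg (hb _).le (sq_nonneg _)
  linarith

theorem le_sum_neg (hb : ∀ j, 0 < b j) (j : T ⊕ U) : b j ≤ ∑ j, b j :=
  Finset.single_le_sum (fun j _ => (hb j).le) (Finset.mem_univ j)

theorem pos_of_planes {M : ℤ} (hb : ∀ j, 0 < b j)
    (hsum : ∑ i, a i * x i ^ 2 - ∑ j, b j * y j ^ 2 = -∑ j, b j)
    (hlt : ∀ i, a i * x i ^ 2 < b (Sum.inl i) * y (Sum.inl i) ^ 2)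
    (hM : ∑ j, b j < M) (hM2 : 2 < M) (hbM : ∀ i, b (Sum.inl i) ∣ M) {K : T → ℤ}
    (hK : ∀ i, K i ∣ M)
    (hpell : ∀ i (X Y : ℤ), X ^ 2 - a i * b (Sum.inl i) * Y ^ 2 = 1 → K i ∣ X - 1 → 0 < X)
    (hx : ∀ i, M ∣ x i) (hy : ∀ j, M ∣ y j - 1) (j : T ⊕ U) : 0 < y j := by
  have hplane : ∀ i, a i * x i ^ 2 - b (Sum.inl i) * y (Sum.inl i) ^ 2 = - b (Sum.inl i) := by
    intro i
    refine Int.eq_of_dvd_sub_of_abs_lt (M := M) ?_ ?_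
    · have : a i * x i ^ 2 - b (Sum.inl i) * y (Sum.inl i) ^ 2 - -b (Sum.inl i) =
        x i * (a i * x i) - (y (Sum.inl i) - 1) * (b (Sum.inl i) * (y (Sum.inl i) + 1)) := by ring
      rw [this]
      exact ((hx i).mul_right _).sub ((hy _).mul_right _)
    · have h1 := neg_sum_le_plane hb hsum hlt i
      have h2 := le_sum_neg hb (Sum.inl i)
      have h3 := hlt i
      have h4 := hb (Sum.inl i)
      rw [abs_lt]
      constructor <;> linarith
  rcases j with i | u
  · obtain ⟨z, hz⟩ := (hbM i).trans (hx i)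
    refine hpell i _ z ?_ ((hK i).trans (hy _))
    have h1 := hplane i
    rw [hz] at h1
    refine mul_left_cancel₀ (hb (Sum.inl i)).ne' ?_
    linear_combination -h1
  · have hy0 : ∀ j, 1 ≤ y j ^ 2 := fun j => by
      have : y j ≠ 0 := fun h => by
        have h1 := hy j
        rw [h, zero_sub, dvd_neg] at h1
        linarith [Int.le_of_dvd one_pos h1]
      have := pow_pos (abs_pos.2 this) 2
      rw [sq_abs] at this
      linarith
    have hU : ∑ u, b (Sum.inr u) * (y (Sum.inr u) ^ 2 - 1) = 0 := by
      rw [Fintype.sum_sum_type, Fintype.sum_sum_type (f := b), ← sub_sub,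
        ← Finset.sum_sub_distrib, Finset.sum_congr rfl fun i _ => hplane i] at hsum
      simp only [mul_sub, mul_one, Finset.sum_sub_distrib, Finset.sum_neg_distrib] at hsum ⊢
      linarith
    have h1 := (Finset.sum_eq_zero_iff_of_nonneg fun u _ =>
      mul_nonneg (hb (Sum.inr u)).le (sub_nonneg.2 (hy0 _))).1 hU u (Finset.mem_univ u)
    have h2 : y (Sum.inr u) ^ 2 = 1 := by
      have := (mul_eq_zero.1 h1).resolve_left (hb _).ne'
      linarith
    rcases sq_eq_one_iff.1 h2 with h | h
    · rw [h]; exact one_pos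
    · have h3 := hy (Sum.inr u)
      rw [h, show (-1 - 1 : ℤ) = -2 by norm_num, dvd_neg] at h3
      linarith [Int.le_of_dvd two_pos h3]

theorem false_of_planes {M : ℤ} (ha : ∀ i, 0 < a i) (hb : ∀ j, 0 < b j)
    (hsum : ∑ i, a i * x i ^ 2 - ∑ j, b j * y j ^ 2 = -∑ j, b j)
    (hlt : ∀ i, a i * x i ^ 2 < b (Sum.inl i) * y (Sum.inl i) ^ 2) (i : T) {X : ℤ}
    (hX : b (Sum.inl i) ∣ X) (hX0 : X ≠ 0) (hM : a i * X ^ 2 + ∑ j, b j < M)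
    (hx : M ∣ x i - X) (hy : M ∣ y (Sum.inl i) - 1) : False := by
  have h1 := neg_sum_le_plane hb hsum hlt i
  have h2 := le_sum_neg hb (Sum.inl i)
  have h3 := hlt i
  have h4 := hb (Sum.inl i)
  have h0 : 0 ≤ a i * X ^ 2 := mul_nonneg (ha i).le (sq_nonneg _)
  have h5 : a i * x i ^ 2 - b (Sum.inl i) * y (Sum.inl i) ^ 2 = a i * X ^ 2 - b (Sum.inl i) := by
    refine Int.eq_of_dvd_sub_of_abs_lt (M := M) ?_ ?_
    · have : a i * x i ^ 2 - b (Sum.inl i) * y (Sum.inl i) ^ 2 - (a i * X ^ 2 - b (Sum.inl i)) =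
        (x i - X) * (a i * (x i + X)) -
          (y (Sum.inl i) - 1) * (b (Sum.inl i) * (y (Sum.inl i) + 1)) := by ring
      rw [this]
      exact (hx.mul_right _).sub (hy.mul_right _)
    · rw [abs_lt]
      constructor <;> linarith
  have h6 : b (Sum.inl i) ≤ X ^ 2 :=
    Int.le_of_dvd (by positivity) (hX.trans (dvd_pow_self _ two_ne_zero))
  nlinarith [ha i]

end Planes

namespace OrderedChain.TorusFrame

section Boost

variable {n : ℕ} {s : Fin n → ℝ} {T U : Type} [DecidableEq T] [DecidableEq U]

theorem map_P_of_boost (F : TorusFrame s T U) {A : (Fin n → ℝ) ≃ₗ[ℝ] (Fin n → ℝ)} {i : T}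
    {x y : ℝ} (hA : ∀ w, A w = boost (F.coord (Sum.inl i)) (F.coord (Sum.inr (Sum.inl i)))
      (F.pos i) (F.neg (Sum.inl i)) x y *ᵥ w)
    (hx : F.x i = F.neg (Sum.inl i) * x - y * F.θ i) (hy : F.y i = y - F.pos i * x * F.θ i) :
    A (F.P (Sum.inl i)) = F.P' (Sum.inl i) := by
  have hPx : F.P (Sum.inl i) (F.coord (Sum.inl i)) = - F.θ i :=
    (F.xc_P_inl i i).trans (if_pos rfl)
  have hPy : F.P (Sum.inl i) (F.coord (Sum.inr (Sum.inl i))) = 1 :=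
    (F.yc_P (Sum.inl i) (Sum.inl i)).trans (if_pos rfl)
  refine F.pi_ext (fun j => ?_) fun b => ?_
  · rw [xc_P'_inl, hA, xc, LinearMap.proj_apply, boost_mulVec, hPx, hPy, hx]
    by_cases h : j = i
    · subst h
      simp only [if_true]
      ring
    · have := F.xc_P_inl i j
      rw [xc, LinearMap.proj_apply] at this
      simp [h, this]
  · rw [yc_P'_inl, hA, yc, LinearMap.proj_apply, boost_mulVec, hPx, hPy, hy]
    by_cases h : b = Sum.inl i
    · subst h
      simp only [EmbeddingLike.apply_eq_iff_eq, reduceCtorEq, if_true, if_false]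
      ring
    · have := F.yc_P (Sum.inl i) b
      rw [yc, LinearMap.proj_apply] at this
      simp [h, this]

omit [DecidableEq T] [DecidableEq U] in
theorem map_eq_self_of_boost (F : TorusFrame s T U) {A : (Fin n → ℝ) ≃ₗ[ℝ] (Fin n → ℝ)} {i : T}
    {a b x y : ℝ} (hA : ∀ w, A w = boost (F.coord (Sum.inl i)) (F.coord (Sum.inr (Sum.inl i)))
      a b x y *ᵥ w) {w : Fin n → ℝ} (hx : F.xc i w = 0) (hy : F.yc (Sum.inl i) w = 0) : A w = w := by
  rw [xc, LinearMap.proj_apply] at hx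
  rw [yc, LinearMap.proj_apply] at hy
  ext k
  rw [hA, boost_mulVec, hx, hy]
  split_ifs with h h'
  · simp [h, hx]
  · simp [h', hy]
  · rfl

theorem map_P_of_ne (F : TorusFrame s T U) {A : (Fin n → ℝ) ≃ₗ[ℝ] (Fin n → ℝ)} {i : T}
    {a b x y : ℝ} (hA : ∀ w, A w = boost (F.coord (Sum.inl i)) (F.coord (Sum.inr (Sum.inl i)))
      a b x y *ᵥ w) {j : T ⊕ U} (hj : Sum.inl i ≠ j) :
    A (F.P j) = F.P j ∧ A (F.P' j) = F.P' j := by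
  have h1 : ∀ {w}, F.xc i w = 0 → F.yc (Sum.inl i) w = 0 → A w = w := F.map_eq_self_of_boost hA
  rcases j with j | u
  · have hij : i ≠ j := fun h => hj (congrArg _ h)
    exact ⟨h1 (by simp [xc_P_inl, hij]) (by simp [yc_P, hij]),
      h1 (by simp [xc_P'_inl, hij]) (by simp [yc_P'_inl, hij])⟩
  · have h2 := h1 (F.xc_P_inr i u) (by simp [yc_P])
    exact ⟨h2, h2⟩

end Boost

section Irrational

variable {n : ℕ} {s : Fin n → ℝ} {T U : Type}

theorem dual_ne_zero (F : TorusFrame s T U) {a X Y : T → ℤ} {b : T ⊕ U → ℤ}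
    (hθ : ∀ i, Irrational (F.θ i)) (hx : ∀ i, F.x i = b (Sum.inl i) * X i - Y i * F.θ i)
    (hy : ∀ i, F.y i = Y i - a i * X i * F.θ i)
    (hpell : ∀ i, Y i ^ 2 - a i * b (Sum.inl i) * X i ^ 2 = 1) {u : Fin n → ℤ}
    (hu : ∀ j, u (F.coord (Sum.inr j)) ≠ 0) (l : T ⊕ (T ⊕ U)) :
    F.dual l (fun k => (u k : ℝ)) ≠ 0 := by
  have key : ∀ i {c d : ℤ}, (c : ℝ) + d * F.θ i = 0 → c = 0 ∧ d = 0 := by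
    intro i c d h
    by_cases hd : d = 0
    · subst hd
      simpa using h
    · exact absurd h (((hθ i).intCast_mul hd).intCast_add c).ne_zero
  rcases l with i | i | j
  · intro h
    refine hu (Sum.inl i) (key i (c := u (F.coord (Sum.inl i))) ?_).2
    simp only [dual, LinearMap.add_apply, LinearMap.smul_apply, smul_eq_mul, xc, yc,
      LinearMap.proj_apply] at h
    linear_combination h
  · intro h
    set ux := u (F.coord (Sum.inl i)) with hux
    set uy := u (F.coord (Sum.inr (Sum.inl i))) with huy
    simp only [dual, LinearMap.sub_apply, LinearMap.smul_apply, smul_eq_mul, xc, yc,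
      LinearMap.proj_apply, hx, hy, ← hux, ← huy] at h
    obtain ⟨h1, h2⟩ := key i (c := b (Sum.inl i) * X i * uy - Y i * ux)
      (d := a i * X i * ux - Y i * uy) (by push_cast; linear_combination h)
    refine hu (Sum.inl i) ?_
    linear_combination (-uy) * hpell i - Y i * h2 - a i * X i * h1
  · exact Int.cast_ne_zero.2 (hu (Sum.inr j))

/-- Frames with irrational slopes exist for arbitrary hyperbolic rotations. -/
theorem exists_irrational (c : T ⊕ (T ⊕ U) ≃ Fin n) {a X Y : T → ℤ} {b : T ⊕ U → ℤ}
    (hs : ∀ i, s (c (Sum.inl i)) = a i) (hs' : ∀ j, s (c (Sum.inr j)) = -b j)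
    (ha : ∀ i, 0 < a i) (hb : ∀ j, 0 < b j) (hX : ∀ i, 0 < X i) (hY : ∀ i, 0 < Y i)
    (hpell : ∀ i, Y i ^ 2 - a i * b (Sum.inl i) * X i ^ 2 = 1) :
    ∃ F : TorusFrame s T U, F.coord = c ∧ F.pos = (fun i => (a i : ℝ)) ∧
      F.neg = (fun j => (b j : ℝ)) ∧ (∀ i, Irrational (F.θ i)) ∧
      (∀ i, F.x i = b (Sum.inl i) * X i - Y i * F.θ i) ∧
      ∀ i, F.y i = Y i - a i * X i * F.θ i := by
  choose θ m h1 h2 h3 h4 h5 h6 h7 using fun i => exists_irrational_slope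
    (a := a i) (b := b (Sum.inl i)) (x := X i) (y := Y i) (Int.cast_pos.2 (ha i))
    (Int.cast_pos.2 (hb _)) (Int.cast_pos.2 (hX i)) (Int.cast_pos.2 (hY i))
    (by exact_mod_cast hpell i)
  exact ⟨{
    coord := c
    pos := fun i => a i
    neg := fun j => b j
    θ := θ
    x := fun i => b (Sum.inl i) * X i - Y i * θ i
    y := fun i => Y i - a i * X i * θ i
    slope := m
    s_pos := hs
    s_neg := hs'
    zero_lt_pos := fun i => Int.cast_pos.2 (ha i)
    zero_lt_neg := fun j => Int.cast_pos.2 (hb j)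
    zero_lt_y := h5
    abs_θ_le := fun i => by rw [abs_of_pos (h2 i)]; exact h3 i
    abs_x_le := fun i => by rw [abs_of_pos (h4 i)]; exact h6 i
    slope_lt := h7
    zero_lt_θ := h2
    zero_lt_x := h4 }, rfl, rfl, rfl, h1, fun _ => rfl, fun _ => rfl⟩

end Irrational

end OrderedChain.TorusFrame

section Coset

variable {n : ℕ} {B E : Matrix (Fin n) (Fin n) ℤ} {σ v : Fin n → ℤ} {m M κ : ℤ}

/-- The vectors on a level set of the form which, in the coordinates given by `E`, are congruent
to `v` modulo `m`. -/
def cosetLevel (E : Matrix (Fin n) (Fin n) ℤ) (σ v : Fin n → ℤ) (m κ : ℤ) : Set (Fin n → ℝ) :=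
  {w | diagForm (fun i => (σ i : ℝ)) w = κ ∧ ∃ l : Fin n → ℤ,
    E.map (Int.castRingHom ℝ) *ᵥ w = Int.castRingHom ℝ ∘ (E *ᵥ v + m • l)}

theorem exists_int_of_mem_cosetLevel (hdet : E.det ≠ 0) {w : Fin n → ℝ}
    (hw : w ∈ cosetLevel E σ v (M * E.det) κ) :
    ∃ u : Fin n → ℤ, w = (fun i => (u i : ℝ)) ∧ ∀ i, M ∣ u i - v i := by
  obtain ⟨-, l, hl⟩ := hw
  refine ⟨v + M • E.adjugate *ᵥ l, mulVec_injective_of_frame hdet ?_, fun i => ?_⟩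
  · have h := RingHom.map_mulVec (Int.castRingHom ℝ) E (v + M • E.adjugate *ᵥ l)
    simp only at hl ⊢
    rw [hl]
    ext k
    refine Eq.trans ?_ (h k)
    rw [Matrix.mulVec_add, Matrix.mulVec_smul, Matrix.mulVec_mulVec, Matrix.mul_adjugate,
      Matrix.smul_mulVec, Matrix.one_mulVec, smul_smul]
    rfl
  · rw [Pi.add_apply, add_sub_cancel_left]
    exact dvd_mul_right _ _

theorem self_mem_cosetLevel (hv : diagForm (fun i => (σ i : ℝ)) (fun i => (v i : ℝ)) = κ) :
    (fun i => (v i : ℝ)) ∈ cosetLevel E σ v m κ := by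
  refine ⟨hv, 0, ?_⟩
  ext k
  rw [smul_zero, add_zero]
  exact (RingHom.map_mulVec (Int.castRingHom ℝ) E v k).symm

theorem frameRep_mem_cosetLevel (hE : Eᵀ * B * E = diagonal σ) (hdet : E.det ≠ 0)
    {h : GeneralLinearGroup (Fin n) ℤ} (hh : h ∈ SOLam n B) {C : Matrix (Fin n) (Fin n) ℤ}
    (hC : (h : Matrix (Fin n) (Fin n) ℤ) = 1 + m • C) {w : Fin n → ℝ}
    (hw : w ∈ cosetLevel E σ v m κ) : frameRep hdet h w ∈ cosetLevel E σ v m κ := by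
  obtain ⟨hw, l, hl⟩ := hw
  refine ⟨(diagForm_frameRep hE hdet hh w).trans hw, l + C *ᵥ (E *ᵥ v + m • l), ?_⟩
  rw [mulVec_frameRep, hl]
  ext k
  refine (RingHom.map_mulVec (Int.castRingHom ℝ) (h : Matrix (Fin n) (Fin n) ℤ) _ k).symm.trans ?_
  rw [hC, Matrix.add_mulVec, Matrix.one_mulVec, Matrix.smul_mulVec, smul_add, add_assoc]
  rfl

theorem isTarget_of_int {X : Set (Fin n → ℝ)} (hκ : κ ≠ 0)
    (hX : ∀ w ∈ X, diagForm (fun i => (σ i : ℝ)) w = κ)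
    (hint : ∀ w ∈ X, ∃ u : Fin n → ℤ, w = fun i => (u i : ℝ)) :
    IsTarget (fun i => (σ i : ℝ)) X where
  countable := (Set.countable_range fun (u : Fin n → ℤ) i => (u i : ℝ)).mono fun w hw => by
    obtain ⟨u, rfl⟩ := hint w hw
    exact ⟨u, rfl⟩
  zero_notMem := fun h => by
    have := hX 0 h
    simp only [diagForm, Pi.zero_apply, ne_eq, OfNat.ofNat_ne_zero, not_false_eq_true, zero_pow,
      mul_zero, Finset.sum_const_zero] at this
    exact hκ (by exact_mod_cast this.symm)
  finite := finiteInCones κ hX hint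

end Coset

theorem exists_le_forall_dvd {T U : Type} [Fintype T] [Fintype U] {b : U → ℤ} {K : T → ℤ}
    (hb : ∀ j, 0 < b j) (hK : ∀ i, 0 < K i) {R : ℤ} (hR : 0 ≤ R) :
    ∃ M, R ≤ M ∧ (∀ j, b j ∣ M) ∧ ∀ i, K i ∣ M := by
  refine ⟨((∏ j, b j) * ∏ i, K i) * R, le_mul_of_one_le_left hR ?_, fun j => ?_, fun i => ?_⟩
  · exact mul_pos (Finset.prod_pos fun j _ => hb j) (Finset.prod_pos fun i _ => hK i)
  · exact ((Finset.dvd_prod_of_mem b (Finset.mem_univ j)).mul_right _).mul_right _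
  · exact ((Finset.dvd_prod_of_mem K (Finset.mem_univ i)).mul_left _).mul_right _

/-- Boosts of integral vectors congruent to a fixed one. -/
theorem exists_int_boost_mulVec {n : ℕ} {i o : Fin n} (hio : i ≠ o) (a b x y : ℤ) {M : ℤ}
    {u v : Fin n → ℤ} (hu : ∀ k, M ∣ u k - v k) :
    ∃ u' : Fin n → ℤ, boost i o (a : ℝ) b x y *ᵥ (fun k => (u k : ℝ)) = (fun k => (u' k : ℝ)) ∧
      M ∣ u' i - (y * v i + b * x * v o) ∧ M ∣ u' o - (a * x * v i + y * v o) ∧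
      ∀ k, k ≠ i → k ≠ o → M ∣ u' k - v k := by
  refine ⟨boost i o a b x y *ᵥ u, ?_, ?_, ?_, fun k h h' => ?_⟩
  · ext k
    rw [boost_mulVec, boost_mulVec]
    split_ifs <;> push_cast <;> rfl
  · rw [boost_mulVec, if_pos rfl, show y * u i + b * x * u o - (y * v i + b * x * v o) =
      y * (u i - v i) + b * x * (u o - v o) by ring]
    exact ((hu i).mul_left _).add ((hu o).mul_left _)
  · rw [boost_mulVec, if_neg hio.symm, if_pos rfl, show a * x * u i + y * u o -
      (a * x * v i + y * v o) = a * x * (u i - v i) + y * (u o - v o) by ring]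
    exact ((hu i).mul_left _).add ((hu o).mul_left _)
  · rw [boost_mulVec, if_neg h, if_neg h']
    exact hu k

theorem SOLam.exists_finiteIndex_le_rank {n : ℕ} {T U : Type} [Fintype T] [Fintype U]
    [DecidableEq T] [DecidableEq U] (c : T ⊕ (T ⊕ U) ≃ Fin n) {i₀ : T} {o : T ⊕ U}
    (ho : o ≠ Sum.inl i₀) {B E : Matrix (Fin n) (Fin n) ℤ} {σ : Fin n → ℤ}
    (hE : Eᵀ * B * E = diagonal σ) (hdet : E.det ≠ 0) (hpos : ∀ i, 9 ≤ σ (c (Sum.inl i)))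
    (hneg : ∀ j, σ (c (Sum.inr j)) ≤ -9)
    (hσ : ∀ i j, ¬ IsSquare (-(σ (c (Sum.inl i)) * σ (c (Sum.inr j))))) (N : ℕ) :
    ∃ Γ : Subgroup (SOLam n B), Γ.FiniteIndex ∧ (N : Cardinal) ≤
      Module.rank ℚ (groupCohomology (Rep.trivial ℚ Γ ℚ) (Fintype.card T)) := by
  obtain ⟨a, hσa⟩ : ∃ a : T → ℤ, ∀ i, σ (c (Sum.inl i)) = a i := ⟨_, fun _ => rfl⟩
  obtain ⟨b, hσb⟩ : ∃ b : T ⊕ U → ℤ, ∀ j, σ (c (Sum.inr j)) = -b j :=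
    ⟨fun j => -σ (c (Sum.inr j)), fun j => (neg_neg _).symm⟩
  have ha9 : ∀ i, 9 ≤ a i := fun i => hσa i ▸ hpos i
  have hb9 : ∀ j, 9 ≤ b j := fun j => neg_le_neg_iff.1 (hσb j ▸ hneg j)
  have hsq : ∀ i j, ¬ IsSquare (a i * b j) := fun i j => by
    have := hσ i j
    rwa [hσa, hσb, mul_neg, neg_neg] at this
  have ha : ∀ i, 0 < a i := fun i => by linarith [ha9 i]
  have hb : ∀ j, 0 < b j := fun j => by linarith [hb9 j]
  have hne : ∀ i j, c (Sum.inl i) ≠ c (Sum.inr j) := fun i j h => by simp at h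
  let s : Fin n → ℝ := fun i => (σ i : ℝ)
  let rep : SOLam n B →* ((Fin n → ℝ) ≃ₗ[ℝ] (Fin n → ℝ)) :=
    (frameRep hdet).comp (SOLam n B).subtype
  have hrep : ∀ h : SOLam n B, rep h = frameRep hdet h := fun _ => rfl
  have hrepQ : ∀ h x, diagForm s (rep h x) = diagForm s x :=
    fun h x => diagForm_frameRep hE hdet h.2 x
  obtain ⟨Γ₁, hΓ₁, hΓ₁', htriv⟩ := exists_normal_finiteIndex_trivial rfl rep hrepQ
  obtain ⟨g, hg, r, hrx, hry, hrb, hgr⟩ := SOLam.exists_mem_mul_eq_mul_boost hE hdet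
    (hne i₀ o) (hσa i₀) (hσb o) (mul_pos (ha _) (hb _)) (hsq i₀ o) Γ₁ (hb (Sum.inl i₀)).ne'
  choose K hK0 hK using fun i => Pell.exists_forall_dvd_pos (D := a i * b (Sum.inl i))
    (by nlinarith [ha9 i, hb9 (Sum.inl i)]) (hsq _ _)
  have hsum : ∀ k ∈ Finset.Ioo (-N : ℤ) N, 0 ≤ a i₀ * (b o * (r ^ k).y) ^ 2 + (r ^ k).x :=
    fun k _ => add_nonneg (mul_nonneg (ha i₀).le (sq_nonneg _))
      (Pell.Solution₁.x_zpow_pos hrx k).le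
  have hb0 : 0 < ∑ j, b j := (hb o).trans_le (le_sum_neg hb o)
  obtain ⟨M, hM, hbM, hKM⟩ := exists_le_forall_dvd hb hK0
    (show 0 ≤ 3 + ∑ j, b j + ∑ k ∈ Finset.Ioo (-N : ℤ) N,
      (a i₀ * (b o * (r ^ k).y) ^ 2 + (r ^ k).x) from
      add_nonneg (add_nonneg three_pos.le hb0.le) (Finset.sum_nonneg hsum))
  have hMk : ∀ k : ℤ, |k| < N →
      3 + ∑ j, b j + (a i₀ * (b o * (r ^ k).y) ^ 2 + (r ^ k).x) ≤ M := fun k hk =>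
    (add_le_add_right (Finset.single_le_sum hsum (Finset.mem_Ioo.2 (abs_lt.1 hk))) _).trans hM
  have hM0 : 3 + ∑ j, b j ≤ M := le_trans (by linarith [Finset.sum_nonneg hsum]) hM
  obtain ⟨Γ₂, hΓ₂, hΓ₂', hcongr⟩ := exists_normal_finiteIndex_congr (SOLam n B)
    (mul_ne_zero (show M ≠ 0 by linarith) hdet)
  have hΓ : (Γ₁ ⊓ Γ₂).Normal := inferInstance
  have hΓ' : (Γ₁ ⊓ Γ₂).FiniteIndex := inferInstance
  choose t ht sol hsolx hsoly _ htsol using fun i => SOLam.exists_mem_mul_eq_mul_boost hE hdet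
    (hne i (Sum.inl i)) (hσa i) (hσb _) (mul_pos (ha _) (hb _)) (hsq i _) (Γ₁ ⊓ Γ₂) one_ne_zero
  have hpell : ∀ i, (sol i).x ^ 2 - a i * b (Sum.inl i) * (sol i).y ^ 2 = 1 := fun i => (sol i).prop
  obtain ⟨F, hFc, hFpos, hFneg, hFθ, hFx, hFy⟩ := TorusFrame.exists_irrational (s := s) c
    (fun i => by simp [s, hσa]) (fun j => by simp [s, hσb]) ha hb hsoly hsolx hpell
  rw [F.card_neg] at htriv
  let v : Fin n → ℤ := fun k => Sum.elim 0 1 (c.symm k)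
  have hvx : ∀ i, v (c (Sum.inl i)) = 0 := fun i => by simp [v]
  have hvy : ∀ j, v (c (Sum.inr j)) = 1 := fun j => by simp [v]
  have hform : ∀ u : Fin n → ℤ, diagForm s (fun k => (u k : ℝ)) =
      ((∑ i, a i * u (c (Sum.inl i)) ^ 2 - ∑ j, b j * u (c (Sum.inr j)) ^ 2 : ℤ) : ℝ) := by
    intro u
    rw [F.diagForm_eq, hFpos, hFneg]
    simp only [TorusFrame.xc, TorusFrame.yc, LinearMap.proj_apply, hFc]
    push_cast
    rfl
  let X := cosetLevel E σ v (M * E.det) (-∑ j, b j)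
  have hXint : ∀ k : ℤ, ∀ w ∈ X, ∃ u : Fin n → ℤ, rep (g ^ k) w = (fun l => (u l : ℝ)) ∧
      ∑ i, a i * u (c (Sum.inl i)) ^ 2 - ∑ j, b j * u (c (Sum.inr j)) ^ 2 = -∑ j, b j ∧
      M ∣ u (c (Sum.inl i₀)) - b o * (r ^ k).y ∧ M ∣ u (c (Sum.inr o)) - (r ^ k).x ∧
      ∀ j, j ≠ o → M ∣ u (c (Sum.inr j)) - 1 := by
    intro k w hw
    obtain ⟨u, rfl, hu⟩ := exists_int_of_mem_cosetLevel hdet hw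
    obtain ⟨u', hu', hi, ho', hk⟩ := exists_int_boost_mulVec (hne i₀ o) (a i₀) (b o) (r ^ k).y
      (r ^ k).x hu
    rw [hvx, hvy, mul_zero, zero_add, mul_one] at hi ho'
    have h1 : rep (g ^ k) (fun l => (u l : ℝ)) = fun l => (u' l : ℝ) :=
      (frameRep_zpow_eq_boost hdet (hne i₀ o) hgr k _).trans hu'
    refine ⟨u', h1, ?_, hi, ho', fun j hj => ?_⟩
    · have h2 := (hrepQ (g ^ k) _).trans hw.1
      rw [h1, hform] at h2
      exact_mod_cast h2
    · have h2 := hk (c (Sum.inr j)) (hne _ _).symm (by simpa using hj)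
      rwa [hvy] at h2
  have hXint0 : ∀ w ∈ X, ∃ u : Fin n → ℤ, w = (fun l => (u l : ℝ)) ∧
      ∑ i, a i * u (c (Sum.inl i)) ^ 2 - ∑ j, b j * u (c (Sum.inr j)) ^ 2 = -∑ j, b j ∧
      (∀ i, M ∣ u (c (Sum.inl i))) ∧ ∀ j, M ∣ u (c (Sum.inr j)) - 1 := by
    intro w hw
    obtain ⟨u, rfl, hu⟩ := exists_int_of_mem_cosetLevel hdet hw
    refine ⟨u, rfl, ?_, fun i => ?_, fun j => ?_⟩
    · have h2 := hw.1
      rw [hform] at h2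
      exact_mod_cast h2
    · simpa [hvx] using hu (c (Sum.inl i))
    · simpa [hvy] using hu (c (Sum.inr j))
  have hplane : ∀ ε {u : Fin n → ℤ}, InOpenCone (F.vert ε) (fun k => (u k : ℝ)) → ∀ i,
      a i * u (c (Sum.inl i)) ^ 2 < b (Sum.inl i) * u (c (Sum.inr (Sum.inl i))) ^ 2 := by
    intro ε u hu i
    have h := F.lt_of_inOpenCone ε hu i
    simp only [TorusFrame.xc, TorusFrame.yc, LinearMap.proj_apply, hFc, hFpos, hFneg] at h
    exact_mod_cast h
  have hndvd : ∀ {x y : ℤ}, M ∣ x - y → 0 < y → y < M → x ≠ 0 := by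
    rintro x y h hy hyM rfl
    rw [zero_sub, dvd_neg] at h
    exact hyM.not_ge (Int.le_of_dvd hy h)
  have htF : ∀ i w, rep (t i) w = boost (F.coord (Sum.inl i)) (F.coord (Sum.inr (Sum.inl i)))
      (F.pos i) (F.neg (Sum.inl i)) ((sol i).y : ℝ) (sol i).x *ᵥ w := by
    intro i w
    have h := frameRep_zpow_eq_boost hdet (hne i (Sum.inl i)) (htsol i) 1 w
    rw [zpow_one, zpow_one] at h
    rw [hFc, hFpos, hFneg]
    exact h
  refine ⟨Γ₁ ⊓ Γ₂, hΓ', F.le_rank rfl (Fintype.card_pos_iff.2 ⟨i₀⟩).ne' rep hrepQ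
    (fun h => det_frameRep hdet h.2) (Γ := Γ₁ ⊓ Γ₂) inf_le_left htriv hg ht ?_ ?_ ?_ (X := X)
    ?_ ?_ ?_ ?_ (v := fun k => (v k : ℝ)) ?_ ?_ ?_⟩
  · intro i j
    rcases eq_or_ne i j with rfl | hij
    · rfl
    refine Subtype.ext (Units.ext (mul_right_cancel_of_det_ne_zero hdet ?_))
    have h : ∀ i j, (((t i * t j : SOLam n B) : GeneralLinearGroup (Fin n) ℤ) :
        Matrix (Fin n) (Fin n) ℤ) * E =
        E * (boost (c (Sum.inl i)) (c (Sum.inr (Sum.inl i))) (a i) (b (Sum.inl i))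
          (sol i).y (sol i).x * boost (c (Sum.inl j)) (c (Sum.inr (Sum.inl j))) (a j)
          (b (Sum.inl j)) (sol j).y (sol j).x) := by
      intro i j
      rw [← Matrix.mul_assoc, ← htsol, Matrix.mul_assoc, ← htsol, ← Matrix.mul_assoc]
      rfl
    refine (h i j).trans (Eq.trans ?_ (h j i).symm)
    rw [boost_commute (by simpa using hij) (hne _ _) (hne _ _).symm (by simpa using hij)]
  · exact fun i => F.map_P_of_boost (htF i) (by simp [hFx, hFneg]) (by simp [hFy, hFpos])
  · exact fun i j => F.map_P_of_ne (htF i)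
  · refine fun k => isTarget_of_int (κ := -∑ j, b j) (by linarith) ?_ ?_
    · rintro _ ⟨w, hw, rfl⟩
      exact (hrepQ _ _).trans hw.1
    · rintro _ ⟨w, hw, rfl⟩
      obtain ⟨u, hu, -⟩ := hXint k w hw
      exact ⟨u, hu⟩
  · have h1 : ∀ h ∈ Γ₁ ⊓ Γ₂, ∀ w ∈ X, rep h w ∈ X := fun h hh w hw => by
      obtain ⟨C, hC⟩ := hcongr h hh.2
      exact frameRep_mem_cosetLevel hE hdet h.2 hC hw
    refine fun h hh => Set.Subset.antisymm ?_ fun w hw => ⟨rep h⁻¹ w, h1 _ (inv_mem hh) w hw, ?_⟩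
    · rintro _ ⟨w, hw, rfl⟩
      exact h1 h hh w hw
    · rw [map_inv]
      exact (rep h).apply_symm_apply w
  · intro k hk w hw l
    obtain ⟨u, hu, -, -, h1, h2⟩ := hXint k w hw
    rw [hu]
    refine F.dual_ne_zero (fun i => hFθ i) hFx hFy hpell (fun j => ?_) l
    rw [hFc]
    have h3 := hMk k hk
    have h4 := Pell.Solution₁.x_zpow_pos hrx k
    have h5 : 0 ≤ a i₀ * (b o * (r ^ k).y) ^ 2 := mul_nonneg (ha i₀).le (sq_nonneg _)
    by_cases hj : j = o
    · subst hj
      exact hndvd h1 h4 (by linarith)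
    · exact hndvd (h2 j hj) one_pos (by linarith)
  · intro ε w hw hε
    obtain ⟨u, rfl, h1, h2, h3⟩ := hXint0 w hw
    ext j
    have h4 : 0 < u (c (Sum.inr j)) := pos_of_planes hb h1 (hplane ε hε) (by linarith)
      (by linarith) (fun i => hbM _) hKM hK h2 h3 j
    have h5 := F.pos_of_inOpenCone ε hε j
    rw [TorusFrame.yc, LinearMap.proj_apply, hFc] at h5
    rcases Int.units_eq_one_or (ε j) with h | h
    · simp [h]
    · rw [h] at h5
      have h6 : (0 : ℝ) < u (c (Sum.inr j)) := Int.cast_pos.2 h4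
      simp only [Units.val_neg, Units.val_one, Int.cast_neg, Int.cast_one, neg_mul, one_mul] at h5
      linarith
  · refine self_mem_cosetLevel ((hform v).trans ?_)
    simp [hvx, hvy]
  · refine F.inOpenCone_one (fun i => ?_) fun j => ?_
    · simp [TorusFrame.xc, hFc, hvx]
    · simp [TorusFrame.yc, hFc, hvy]
  · intro k hk0 hk ε w hw hε
    obtain ⟨u, hu, h1, h2, -, h3⟩ := hXint k w hw
    rw [hu] at hε
    have h4 := hMk k hk
    have h5 := Pell.Solution₁.x_zpow_pos hrx k
    exact false_of_planes ha hb h1 (hplane ε hε) i₀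
      ((Pell.Solution₁.dvd_y_zpow hrb k).mul_left _)
      (mul_ne_zero (hb o).ne' (Pell.Solution₁.y_zpow_ne_zero hrx hry hk0)) (by linarith) h2
      (h3 _ ho.symm)

/-- Theorem 1.1 of the paper. Fix `1 ≤ p ≤ q` with `p + q ≥ 3` and `p` odd.
Let `B` be a symmetric unimodular integral `(p+q) × (p+q)` matrix of signature `(p, q)`.
Then for every `N ≥ 1` there is a finite-index subgroup `Γ ≤ SO(Λ)` such that the group
cohomology `H^p(Γ; ℚ)` with trivial rational coefficients has dimension at least `N`. -/
theorem exists_finite_index_subgroup_large_cohomology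
    (p q : ℕ) (hp1 : 1 ≤ p) (hpq : p ≤ q) (hpq3 : 3 ≤ p + q) (hodd : Odd p)
    (B : Matrix (Fin (p + q)) (Fin (p + q)) ℤ) (hsymm : B.IsSymm)
    (hdet : B.det = 1 ∨ B.det = -1)
    (hsig : ∃ S : Matrix (Fin (p + q)) (Fin (p + q)) ℝ, IsUnit S ∧
      Sᵀ * (B.map ((↑) : ℤ → ℝ)) * S =
        Matrix.diagonal (fun i : Fin (p + q) => if (i : ℕ) < p then (1 : ℝ) else -1)) :
    ∀ N : ℕ, 1 ≤ N → ∃ Γ : Subgroup ↥(SOLam (p + q) B), Γ.FiniteIndex ∧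
      (N : Cardinal) ≤ Module.rank ℚ (groupCohomology (Rep.trivial ℚ ↥Γ ℚ) p) := by
  intro N _
  obtain ⟨r, rfl⟩ := Nat.exists_eq_add_of_le hpq
  obtain ⟨E, σ, hE, hE0, hpos, hneg, hσ⟩ := Matrix.exists_int_diagonal_not_isSquare
    (by omega) hsymm (by rcases hdet with h | h <;> rw [h] <;> norm_num) hsig
  let c : Fin p ⊕ (Fin p ⊕ Fin r) ≃ Fin (p + (p + r)) :=
    (Equiv.sumCongr (Equiv.refl _) finSumFinEquiv).trans finSumFinEquiv
  have hc : ∀ i, (c (Sum.inl i) : ℕ) < p := fun i => by simp [c]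
  have hc' : ∀ j, ¬ (c (Sum.inr j) : ℕ) < p := fun j => by simp [c]
  obtain ⟨o, ho⟩ : ∃ o : Fin p ⊕ Fin r, o ≠ Sum.inl ⟨0, hp1⟩ := by
    rcases Nat.eq_zero_or_pos r with rfl | hr
    · exact ⟨Sum.inl ⟨1, by omega⟩, by simp⟩
    · exact ⟨Sum.inr ⟨0, hr⟩, by simp⟩
  have h := SOLam.exists_finiteIndex_le_rank c ho hE hE0 (fun i => hpos _ (hc i))
    (fun j => hneg _ (hc' j)) (fun i j => hσ _ _ (hc i) (hc' j)) N
  rwa [Fintype.card_fin] at h
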